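/- Let n ≥ 2 and let E = E(r_1,…,r_n) ⊂ ℝ^{2n} be an open ellipsoid with half axes 0 < r_1 ≤ … ≤ r_n, at least two of which are different. For ε ∈ (0,1) set U_ε = (1+ε)E \ closure((1−ε)E). Then s(U_ε) → 0 as ε → 0⁺; more precisely, there exists ε₀ > 0, depending only on r_1,…,r_n, such that for all ε ∈ (0, ε₀] every symplectic embedding of a sphere S_r^{2n−1} into U_ε satisfies π^n r^{2n}/n! < vol(U_ε). -/

import Mathlib

open Metric Set MeasureTheory Real Filter Topology Bornology
open scoped ContDiff ENNReal

noncomputable section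

/-- `ℝ^{2n}` with the Euclidean structure. -/
abbrev R2n (n : ℕ) := EuclideanSpace ℝ (Fin (2 * n))

/-- The standard symplectic form `ω_st = Σ dx_i ∧ dy_i` on `ℝ^{2n}`,
evaluated on a pair of (tangent) vectors. -/
def sympForm (n : ℕ) (v w : R2n n) : ℝ :=
  ∑ i : Fin n,
    (v ⟨2 * i.1, by have := i.isLt; omega⟩ * w ⟨2 * i.1 + 1, by have := i.isLt; omega⟩ -
      v ⟨2 * i.1 + 1, by have := i.isLt; omega⟩ * w ⟨2 * i.1, by have := i.isLt; omega⟩)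

/-- `φ` is a symplectic embedding of the open set `N ⊆ ℝ^{2n}` into `U ⊆ ℝ^{2n}`:
a smooth injective map on `N` with image in `U` whose derivative preserves `ω_st`. -/
def IsSympEmbOn (n : ℕ) (N U : Set (R2n n)) (φ : R2n n → R2n n) : Prop :=
  IsOpen N ∧ ContDiffOn ℝ ∞ φ N ∧ InjOn φ N ∧ MapsTo φ N U ∧
    ∀ p ∈ N, ∀ v w : R2n n,
      sympForm n (fderiv ℝ φ p v) (fderiv ℝ φ p w) = sympForm n v w

/-- A symplectic embedding of (a neighbourhood of) an arbitrary set `A ⊆ ℝ^{2n}` into `U`. -/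
def SympEmbNbhd (n : ℕ) (A U : Set (R2n n)) : Prop :=
  ∃ N φ, A ⊆ N ∧ IsSympEmbOn n N U φ

/-- The spherical capacity `s(U)`. -/
def sphericalCap (n : ℕ) (U : Set (R2n n)) : ℝ≥0∞ :=
  sSup {c : ℝ≥0∞ | ∃ r : ℝ, 0 < r ∧ c = ENNReal.ofReal (π * r ^ 2) ∧
    SympEmbNbhd n (sphere (0 : R2n n) r) U}

/-- The quadratic form defining the ellipsoid with symplectic half axes `a i`. -/
def ellQ (n : ℕ) (a : Fin n → ℝ) (z : R2n n) : ℝ :=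
  ∑ i : Fin n,
    ((z ⟨2 * i.1, by have := i.isLt; omega⟩) ^ 2 +
      (z ⟨2 * i.1 + 1, by have := i.isLt; omega⟩) ^ 2) / (a i) ^ 2

/-- The open ellipsoid `E(a 0, …, a (n-1)) ⊆ ℝ^{2n}`. -/
def ellipsoid (n : ℕ) (a : Fin n → ℝ) : Set (R2n n) := {z | ellQ n a z < 1}

/-- The boundary `∂E(a 0, …, a (n-1)) ⊆ ℝ^{2n}` of an ellipsoid. -/
def ellipsoidBdry (n : ℕ) (a : Fin n → ℝ) : Set (R2n n) := {z | ellQ n a z = 1}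

/-- The ellipsoidal shell `U_ε = (1+ε)E \ closure((1-ε)E)`. -/
def ellShell (n : ℕ) (a : Fin n → ℝ) (ε : ℝ) : Set (R2n n) :=
  ellipsoid n (fun i => (1 + ε) * a i) \ closure (ellipsoid n (fun i => (1 - ε) * a i))

/-- The `δ`-shell capacity `c_δ(U)`, defined via embeddings of the closed
shells `r A_δ = closure(B_r) \ B_{r(1-δ)}`. -/
def shellCap (n : ℕ) (δ : ℝ) (U : Set (R2n n)) : ℝ≥0∞ :=
  sSup {c : ℝ≥0∞ | ∃ r : ℝ, 0 < r ∧ c = ENNReal.ofReal (π * r ^ 2) ∧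
    SympEmbNbhd n (closedBall (0 : R2n n) r \ ball 0 (r * (1 - δ))) U}

/-- The ellipsoidal capacity `e(U)`: the supremum of `π r₁²` over symplectic embeddings of
boundaries of ellipsoids with half axes `r₁ ≤ … ≤ r_n` (here `r₁ = ⨅ i, a i`). -/
def ellipsoidalCap (n : ℕ) (U : Set (R2n n)) : ℝ≥0∞ :=
  sSup {c : ℝ≥0∞ | ∃ a : Fin n → ℝ, (∀ i, 0 < a i) ∧ Monotone a ∧
    c = ENNReal.ofReal (π * (⨅ i, a i) ^ 2) ∧ SympEmbNbhd n (ellipsoidBdry n a) U}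

/-- The Gromov radius `c_B(U)`. -/
def gromovRadius (n : ℕ) (U : Set (R2n n)) : ℝ≥0∞ :=
  sSup {c : ℝ≥0∞ | ∃ r : ℝ, 0 < r ∧ c = ENNReal.ofReal (π * r ^ 2) ∧
    ∃ φ, IsSympEmbOn n (ball (0 : R2n n) r) U φ}

/-- The determinant of `1 + t A` is interpolated by its values at `d + 1` nodes. -/
theorem Matrix.det_one_add_smul_eq_sum_basis {d : ℕ} (A : Matrix (Fin d) (Fin d) ℝ) (v : Fin (d + 1) → ℝ)
    (hv : Function.Injective v) (t : ℝ) :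
    (1 + t • A).det =
      ∑ i, (Lagrange.basis Finset.univ v i).eval t * (1 + v i • A).det := by
  set P : Polynomial ℝ :=
    ((Polynomial.X : Polynomial ℝ) • A.map Polynomial.C
      + (1 : Matrix (Fin d) (Fin d) ℝ).map Polynomial.C).det with hP
  have hev : ∀ s : ℝ, P.eval s = (1 + s • A).det := by
    intro s
    rw [hP, ← Polynomial.coe_evalRingHom, RingHom.map_det]
    congr 1
    ext i j
    by_cases hij : i = j <;> simp [hij] <;> ring
  have hdeg : P.degree < (Finset.univ : Finset (Fin (d + 1))).card := by
    refine lt_of_le_of_lt (Polynomial.degree_le_natDegree) ?_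
    have := Polynomial.natDegree_det_X_add_C_le A (1 : Matrix (Fin d) (Fin d) ℝ)
    rw [Finset.card_univ, Fintype.card_fin]
    rw [Fintype.card_fin] at this
    exact_mod_cast Nat.lt_succ_of_le this
  have h := Lagrange.eq_interpolate (s := Finset.univ) (v := v) hv.injOn hdeg
  rw [← hev, h, Lagrange.interpolate_apply, Polynomial.eval_finsetSum]
  refine Finset.sum_congr rfl fun i _ => ?_
  rw [Polynomial.eval_mul, Polynomial.eval_C, ← hev, mul_comm]

theorem sum_basis_eval_eq_one {d : ℕ} (v : Fin (d + 1) → ℝ) (hv : Function.Injective v) (t : ℝ) :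
    ∑ i, (Lagrange.basis Finset.univ v i).eval t = 1 := by
  rw [← Polynomial.eval_finsetSum, Lagrange.sum_basis hv.injOn Finset.univ_nonempty,
    Polynomial.eval_one]

theorem ContinuousLinearMap.det_one_add_smul_eq_sum_basis {d : ℕ}
    (A : EuclideanSpace ℝ (Fin d) →L[ℝ] EuclideanSpace ℝ (Fin d)) (v : Fin (d + 1) → ℝ)
    (hv : Function.Injective v) (t : ℝ) :
    (1 + t • A).det =
      ∑ i, (Lagrange.basis Finset.univ v i).eval t * (1 + v i • A).det := by
  let b := (EuclideanSpace.basisFun (Fin d) ℝ).toBasis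
  have key : ∀ s : ℝ, (1 + s • A).det = (1 + s • LinearMap.toMatrix b b (A : _ →ₗ[ℝ] _)).det := by
    intro s
    rw [ContinuousLinearMap.det, ← LinearMap.det_toMatrix b]
    congr 1
    rw [ContinuousLinearMap.toLinearMap_add, map_add, ContinuousLinearMap.toLinearMap_smul,
      map_smul]
    congr 1
    exact LinearMap.toMatrix_one b
  simp only [key]
  exact Matrix.det_one_add_smul_eq_sum_basis _ v hv t

/-- A linear endomorphism close to the identity has positive determinant. -/
theorem ContinuousLinearMap.det_one_add_smul_pos {d : ℕ}
    (A : EuclideanSpace ℝ (Fin d) →L[ℝ] EuclideanSpace ℝ (Fin d)) {t : ℝ} (ht : 0 ≤ t)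
    (hA : t * ‖A‖ < 1) : 0 < (1 + t • A).det := by
  by_contra! hle
  have hcont : ContinuousOn (fun s : ℝ => (1 + s • A).det) (Icc 0 t) := by
    apply Continuous.continuousOn
    exact ContinuousLinearMap.continuous_det.comp (by fun_prop)
  have h0 : (1 + (0 : ℝ) • A).det = 1 := by
    have : (1 + (0 : ℝ) • A) = 1 := by ext1 x; simp
    rw [this, ContinuousLinearMap.det]
    exact LinearMap.det_id
  have := intermediate_value_Icc' ht hcont
  obtain ⟨s, hs, hs0⟩ := this (show (0 : ℝ) ∈ _ from ⟨hle, by simp only [h0]; exact zero_le_one⟩)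
  have hn : ‖-(s • A)‖ < 1 := by
    rw [norm_neg, norm_smul, Real.norm_of_nonneg hs.1]
    exact lt_of_le_of_lt (mul_le_mul_of_nonneg_right hs.2 (norm_nonneg _)) hA
  have hu : IsUnit (1 + s • A) := by
    have := (Units.oneSub (-(s • A)) hn).isUnit
    simpa using this
  have hu' : IsUnit ((1 + s • A : EuclideanSpace ℝ (Fin d) →L[ℝ] EuclideanSpace ℝ (Fin d)) :
      EuclideanSpace ℝ (Fin d) →ₗ[ℝ] EuclideanSpace ℝ (Fin d)) := by
    obtain ⟨w, hw⟩ := hu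
    refine ⟨⟨w.1, w.2, ?_, ?_⟩, congrArg (fun z : EuclideanSpace ℝ (Fin d) →L[ℝ]
      EuclideanSpace ℝ (Fin d) => (z : EuclideanSpace ℝ (Fin d) →ₗ[ℝ] EuclideanSpace ℝ (Fin d))) hw⟩
    · exact congrArg (fun z : EuclideanSpace ℝ (Fin d) →L[ℝ] EuclideanSpace ℝ (Fin d) =>
        (z : EuclideanSpace ℝ (Fin d) →ₗ[ℝ] EuclideanSpace ℝ (Fin d))) w.3
    · exact congrArg (fun z : EuclideanSpace ℝ (Fin d) →L[ℝ] EuclideanSpace ℝ (Fin d) =>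
        (z : EuclideanSpace ℝ (Fin d) →ₗ[ℝ] EuclideanSpace ℝ (Fin d))) w.4
  have := LinearMap.isUnit_iff_isUnit_det _ |>.1 hu'
  exact this.ne_zero hs0

/-- A perturbation `x + t u(x)` of the identity by a Lipschitz field supported in the open ball
maps the ball bijectively to itself when `t` is small. -/
theorem image_ball_id_add_smul {E : Type*} [NormedAddCommGroup E] [NormedSpace ℝ E]
    [FiniteDimensional ℝ E] {u : E → E} {L : NNReal} (hu : LipschitzWith L u) {ρ : ℝ}
    (h0 : ∀ x, ρ ≤ ‖x‖ → u x = 0) {t : ℝ} (ht : 0 ≤ t) (htL : t * L < 1) :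
    InjOn (fun x => x + t • u x) univ ∧ (fun x => x + t • u x) '' ball 0 ρ = ball 0 ρ := by
  have hA : ApproximatesLinearOn (fun x => x + t • u x)
      ((ContinuousLinearEquiv.refl ℝ E : E ≃L[ℝ] E) : E →L[ℝ] E) univ (t.toNNReal * L) := by
    intro x _ y _
    have := hu.dist_le_mul x y
    simp only [ContinuousLinearEquiv.coe_refl, ContinuousLinearMap.coe_id', id_eq]
    have e : x + t • u x - (y + t • u y) - (x - y) = t • (u x - u y) := by
      rw [smul_sub]; abel
    rw [e, norm_smul, Real.norm_of_nonneg ht, NNReal.coe_mul, Real.coe_toNNReal _ ht, mul_assoc]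
    rw [dist_eq_norm, dist_eq_norm] at this
    gcongr
  have hc : Subsingleton E ∨ t.toNNReal * L <
      ‖((ContinuousLinearEquiv.refl ℝ E).symm : E →L[ℝ] E)‖₊⁻¹ := by
    by_cases hs : Subsingleton E
    · exact Or.inl hs
    · right
      have := not_subsingleton_iff_nontrivial.1 hs
      have : ‖((ContinuousLinearEquiv.refl ℝ E).symm : E →L[ℝ] E)‖₊ = 1 := by
        have : ((ContinuousLinearEquiv.refl ℝ E).symm : E →L[ℝ] E) = ContinuousLinearMap.id ℝ E :=
          rfl
        rw [this]
        exact NNReal.eq (by simp)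
      rw [this, inv_one, ← NNReal.coe_lt_coe]
      simpa [Real.coe_toNNReal _ ht] using htL
  have hinj := hA.injOn hc
  have hsurj := hA.surjective hc
  have hfix : ∀ x : E, x ∉ ball (0 : E) ρ → x + t • u x = x := by
    intro x hx
    rw [mem_ball_zero_iff, not_lt] at hx
    rw [h0 x hx, smul_zero, add_zero]
  refine ⟨hinj, Subset.antisymm ?_ ?_⟩
  · rintro _ ⟨x, hx, rfl⟩
    by_contra hy
    have := hinj (mem_univ _) (mem_univ x) (hfix _ hy)
    exact hy (by simpa only [this] using hx)
  · intro y hy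
    obtain ⟨x, rfl⟩ := hsurj y
    refine ⟨x, ?_, rfl⟩
    by_contra hx
    exact hx (by simpa only [hfix x hx] using hy)

theorem lipschitzWith_of_lipschitzOnWith_closedBall {E : Type*} [NormedAddCommGroup E]
    [NormedSpace ℝ E] {w u : E → E} {L : NNReal} {ρ : ℝ}
    (hw : LipschitzOnWith L w (closedBall 0 ρ)) (h0 : ∀ x, ‖x‖ = ρ → w x = 0)
    (hin : ∀ x, ‖x‖ ≤ ρ → u x = w x) (hout : ∀ x, ρ ≤ ‖x‖ → u x = 0) : LipschitzWith L u := by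
  have key : ∀ x y : E, ‖x‖ ≤ ρ → ρ ≤ ‖y‖ → dist (u x) (u y) ≤ L * dist x y := by
    intro x y hx hy
    have hc : ContinuousOn (fun s : ℝ => ‖x + s • (y - x)‖) (Icc 0 1) := by fun_prop
    obtain ⟨s, hs, hs'⟩ := intermediate_value_Icc zero_le_one hc
      (show ρ ∈ _ from ⟨by simpa using hx, by simpa using hy⟩)
    set z := x + s • (y - x)
    have hz : ‖z‖ = ρ := hs'
    have h1 := hw.dist_le_mul x (by simpa using hx) z (by simp [hz])
    rw [h0 z hz] at h1
    rw [hin x hx, hout y hy]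
    refine h1.trans ?_
    gcongr
    have : x - z = -(s • (y - x)) := by simp [z]
    rw [dist_eq_norm, this, norm_neg, norm_smul, Real.norm_of_nonneg hs.1, dist_comm,
      dist_eq_norm]
    exact mul_le_of_le_one_left (norm_nonneg _) hs.2
  refine LipschitzWith.of_dist_le_mul fun x y => ?_
  rcases le_total ‖x‖ ρ with hx | hx <;> rcases le_total ‖y‖ ρ with hy | hy
  · rw [hin x hx, hin y hy]
    exact hw.dist_le_mul x (by simpa using hx) y (by simpa using hy)
  · exact key x y hx hy
  · rw [dist_comm, dist_comm x]; exact key y x hy hx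
  · rw [hout x hx, hout y hy, dist_self]; positivity

/-- There is no `C¹` retraction of a closed ball onto its boundary sphere. -/
theorem not_exists_contDiff_retraction_sphere {d : ℕ} {ρ : ℝ} (hρ : 0 < ρ)
    (R : EuclideanSpace ℝ (Fin d) → EuclideanSpace ℝ (Fin d)) (hR : ContDiff ℝ 1 R)
    (hsph : ∀ x, ‖R x‖ = ρ) (hid : ∀ x, ‖x‖ = ρ → R x = x) : False := by
  let w : EuclideanSpace ℝ (Fin d) → EuclideanSpace ℝ (Fin d) := fun x => R x - x
  have hw : ContDiff ℝ 1 w := hR.sub contDiff_id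
  obtain ⟨L, hL⟩ : ∃ L : NNReal, LipschitzOnWith L w (closedBall 0 ρ) :=
    hw.contDiffOn.exists_lipschitzOnWith (by norm_num) (convex_closedBall _ _)
      (isCompact_closedBall _ _)
  let u : EuclideanSpace ℝ (Fin d) → EuclideanSpace ℝ (Fin d) := fun x => if ‖x‖ ≤ ρ then w x else 0
  have hin : ∀ x, ‖x‖ ≤ ρ → u x = w x := fun x hx => if_pos hx
  have hw0 : ∀ x, ‖x‖ = ρ → w x = 0 := fun x hx => by simp [w, hid x hx]
  have hout : ∀ x, ρ ≤ ‖x‖ → u x = 0 := by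
    intro x hx
    rcases hx.eq_or_lt with h | h
    · rw [hin x h.ge, hw0 x h.symm]
    · exact if_neg (not_le.2 h)
  have hu := lipschitzWith_of_lipschitzOnWith_closedBall hL hw0 hin hout
  let A : EuclideanSpace ℝ (Fin d) → EuclideanSpace ℝ (Fin d) →L[ℝ] EuclideanSpace ℝ (Fin d) := fun x => fderiv ℝ w x
  have hAc : Continuous A := hw.continuous_fderiv one_ne_zero
  have hdw : ∀ x, HasFDerivAt w (A x) x := fun x =>
    (hw.differentiable one_ne_zero x).hasFDerivAt
  have hdu : ∀ x ∈ ball (0 : EuclideanSpace ℝ (Fin d)) ρ, HasFDerivAt u (A x) x := by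
    intro x hx
    refine (hdw x).congr_of_eventuallyEq ?_
    filter_upwards [isOpen_ball.mem_nhds hx] with y hy
    exact hin y (mem_ball_zero_iff.1 hy).le
  have hAL : ∀ x ∈ ball (0 : EuclideanSpace ℝ (Fin d)) ρ, ‖A x‖ ≤ L := fun x hx =>
    (hdu x hx).le_of_lipschitz hu
  set μ : Measure (EuclideanSpace ℝ (Fin d)) := volume
  have hsmall : ∀ t : ℝ, 0 ≤ t → t * L < 1 →
      ∫ x in ball (0 : EuclideanSpace ℝ (Fin d)) ρ, (1 + t • A x).det ∂μ = μ.real (ball 0 ρ) := by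
    intro t ht htL
    obtain ⟨hi, him⟩ := image_ball_id_add_smul hu hout ht htL
    have h := integral_image_eq_integral_abs_det_fderiv_smul μ
      (measurableSet_ball (x := (0 : EuclideanSpace ℝ (Fin d))) (ε := ρ)) (f := fun x => x + t • u x)
      (f' := fun x => 1 + t • A x)
      (fun x hx => ((hasFDerivAt_id x).add ((hdu x hx).const_smul t)).hasFDerivWithinAt)
      (hi.mono (subset_univ _)) (fun _ => (1 : ℝ))
    rw [him] at h
    simp only [smul_eq_mul, mul_one, integral_const, MeasurableSet.univ, measureReal_restrict_apply,
      univ_inter] at h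
    rw [h]
    refine setIntegral_congr_fun measurableSet_ball fun x hx => ?_
    refine (abs_of_pos ?_).symm
    refine ContinuousLinearMap.det_one_add_smul_pos _ ht (lt_of_le_of_lt ?_ htL)
    exact mul_le_mul_of_nonneg_left (hAL x hx) ht
  have hIntg : ∀ t : ℝ, IntegrableOn (fun x => (1 + t • A x).det) (ball (0 : EuclideanSpace ℝ (Fin d)) ρ) μ := by
    intro t
    have hc : Continuous (fun x => (1 + t • A x).det) :=
      ContinuousLinearMap.continuous_det.comp (by fun_prop)
    exact (hc.continuousOn.integrableOn_compact (isCompact_closedBall (0 : EuclideanSpace ℝ (Fin d)) ρ)).mono_set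
      ball_subset_closedBall
  let v : Fin (d + 1) → ℝ := fun i => (i : ℝ) / ((d + 1) * (L + 1))
  have hv : Function.Injective v := by
    intro i j hij
    have hne : ((d : ℝ) + 1) * (L + 1) ≠ 0 := by positivity
    have := (div_left_inj' hne).1 hij
    exact Fin.ext (by exact_mod_cast this)
  have hv0 : ∀ i, 0 ≤ v i := fun i => by positivity
  have hvL : ∀ i, v i * L < 1 := by
    intro i
    have hi : (i : ℝ) < d + 1 := by exact_mod_cast i.isLt
    have hL0 : (0 : ℝ) ≤ L := L.2
    rw [show v i * L = (i : ℝ) * L / ((d + 1) * (L + 1)) by simp only [v]; ring,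
      div_lt_one (by positivity)]
    have h1 : (i : ℝ) * L ≤ (d + 1) * L := mul_le_mul_of_nonneg_right hi.le hL0
    nlinarith
  have h1 : ∫ x in ball (0 : EuclideanSpace ℝ (Fin d)) ρ, (1 + (1 : ℝ) • A x).det ∂μ = μ.real (ball 0 ρ) := by
    have : ∀ x, (1 + (1 : ℝ) • A x).det = ∑ i, (Lagrange.basis Finset.univ v i).eval 1 *
        (1 + v i • A x).det := fun x =>
      ContinuousLinearMap.det_one_add_smul_eq_sum_basis _ v hv 1
    simp only [this]
    rw [integral_finsetSum _ fun i _ => (hIntg (v i)).const_mul _]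
    simp only [integral_const_mul]
    rw [Finset.sum_congr rfl fun i _ => by rw [hsmall (v i) (hv0 i) (hvL i)], ← Finset.sum_mul,
      sum_basis_eval_eq_one v hv, one_mul]
  have h2 : ∀ x, (1 + (1 : ℝ) • A x).det = 0 := by
    intro x
    have hDR : HasFDerivAt R (1 + (1 : ℝ) • A x) x := by
      have := (hdw x).add (hasFDerivAt_id x)
      have e : (w + id : EuclideanSpace ℝ (Fin d) → EuclideanSpace ℝ (Fin d)) = R := by ext1 y; simp [w]
      rw [e] at this
      have e2 : A x + ContinuousLinearMap.id ℝ _ = 1 + (1 : ℝ) • A x := by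
        ext1 y; simp [add_comm]
      rwa [e2] at this
    have hinner : ∀ y, inner ℝ (R x) ((1 + (1 : ℝ) • A x) y) = 0 := by
      intro y
      have hn := hDR.norm_sq
      have hconst : (fun y => ‖R y‖ ^ 2) = fun _ => ρ ^ 2 := by ext y; rw [hsph]
      rw [hconst] at hn
      have := congrArg (fun T => T y) (hn.unique (hasFDerivAt_const _ _))
      simp only [smul_apply, ContinuousLinearMap.comp_apply,
        innerSL_apply_apply, zero_apply] at this
      simpa using this
    by_contra hne
    have hs : Function.Surjective (⇑(1 + (1 : ℝ) • A x)) := by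
      have hu : IsUnit (LinearMap.det ((1 + (1 : ℝ) • A x : EuclideanSpace ℝ (Fin d) →L[ℝ] EuclideanSpace ℝ (Fin d)) : EuclideanSpace ℝ (Fin d) →ₗ[ℝ] EuclideanSpace ℝ (Fin d))) :=
        isUnit_iff_ne_zero.2 hne
      have := (LinearMap.isUnit_iff_isUnit_det _).2 hu
      exact ((Module.End.isUnit_iff _).1 this).2
    obtain ⟨y, hy⟩ := hs (R x)
    have := hinner y
    rw [hy, inner_self_eq_zero] at this
    have h3 := hsph x
    rw [this, norm_zero] at h3
    exact hρ.ne h3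
  simp only [h2, integral_zero] at h1
  have : 0 < μ.real (ball (0 : EuclideanSpace ℝ (Fin d)) ρ) :=
    ENNReal.toReal_pos (measure_ball_pos _ _ hρ).ne' measure_ball_lt_top.ne
  exact this.ne h1

open scoped Manifold in
theorem exists_eq_zero_of_eq_id_off_ball {d : ℕ} {ρ : ℝ} (hρ : 0 ≤ ρ)
    {G : EuclideanSpace ℝ (Fin d) → EuclideanSpace ℝ (Fin d)} (hG : Continuous G)
    (hid : ∀ x, ρ ≤ ‖x‖ → G x = x) : ∃ x, G x = 0 := by
  by_contra! hne
  let t : EuclideanSpace ℝ (Fin d) → Set (EuclideanSpace ℝ (Fin d)) := fun x =>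
    if ‖x‖ < ρ + 1 then ball (G x) ‖G x‖ else {x}
  have ht : ∀ x, Convex ℝ (t x) := by
    intro x
    simp only [t]
    split_ifs
    · exact convex_ball _ _
    · exact convex_singleton _
  have hloc : ∀ x, ∃ U ∈ 𝓝 x, ∃ g : EuclideanSpace ℝ (Fin d) → EuclideanSpace ℝ (Fin d),
      ContMDiffOn 𝓘(ℝ, EuclideanSpace ℝ (Fin d)) 𝓘(ℝ, EuclideanSpace ℝ (Fin d)) 1 g U ∧
        ∀ y ∈ U, g y ∈ t y := by
    intro x
    rcases lt_or_ge ‖x‖ (ρ + 1) with hx | hx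
    · have h1 : ∀ᶠ y in 𝓝 x, ‖y‖ < ρ + 1 := continuous_norm.continuousAt.eventually_lt_const hx
      have h2 : ∀ᶠ y in 𝓝 x, dist (G x) (G y) < ‖G y‖ := by
        refine ContinuousAt.eventually_lt (by fun_prop) (by fun_prop) ?_
        rw [dist_self]
        exact norm_pos_iff.2 (hne x)
      refine ⟨_, h1.and h2, fun _ => G x, contMDiffOn_const, fun y hy => ?_⟩
      simp only [t, if_pos hy.1]
      exact hy.2
    · have h1 : ∀ᶠ y in 𝓝 x, ρ < ‖y‖ :=
        continuous_norm.continuousAt.eventually_const_lt (by linarith)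
      refine ⟨_, h1, id, contMDiffOn_id, fun y hy => ?_⟩
      have hy' : ρ < ‖y‖ := hy
      simp only [t]
      split_ifs
      · rw [hid y hy'.le, id, mem_ball, dist_self]
        linarith
      · rfl
  obtain ⟨g, hg⟩ := exists_contMDiffMap_forall_mem_convex_of_local
    𝓘(ℝ, EuclideanSpace ℝ (Fin d)) (n := 1) ht hloc
  have hgs : ContDiff ℝ 1 g := g.contMDiff.contDiff
  have hgid : ∀ x, ρ + 1 ≤ ‖x‖ → g x = x := by
    intro x hx
    have := hg x
    simp only [t, if_neg (not_lt.2 hx)] at this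
    exact this
  have hg0 : ∀ x, g x ≠ 0 := by
    intro x h0
    rcases lt_or_ge ‖x‖ (ρ + 1) with hx | hx
    · have := hg x
      simp only [t, if_pos hx, h0, mem_ball, dist_zero_left] at this
      exact lt_irrefl _ this
    · have h1 := hgid x hx
      rw [h0] at h1
      rw [← h1, norm_zero] at hx
      linarith
  refine not_exists_contDiff_retraction_sphere (d := d) (ρ := ρ + 1) (by linarith)
    (fun x => ((ρ + 1) / ‖g x‖) • g x) ?_ ?_ ?_
  · exact (contDiff_const.div (hgs.norm ℝ hg0) fun x => norm_ne_zero_iff.2 (hg0 x)).smul hgs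
  · intro x
    have := norm_ne_zero_iff.2 (hg0 x)
    rw [norm_smul, norm_div, norm_norm, div_mul_cancel₀ _ this, Real.norm_of_nonneg (by linarith)]
  · intro x hx
    have : ‖x‖ ≠ 0 := by rw [hx]; linarith
    simp only [hgid x hx.ge]
    rw [← hx, div_self this, one_smul]

/-- A continuous self-map of a finite-dimensional space that is the identity off a ball is
surjective. -/
theorem surjective_of_eq_id_off_ball {X : Type*} [NormedAddCommGroup X] [NormedSpace ℝ X]
    [FiniteDimensional ℝ X] {ρ : ℝ} {G : X → X} (hG : Continuous G)
    (hid : ∀ x, ρ ≤ ‖x‖ → G x = x) : Function.Surjective G := by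
  intro p
  let e : X ≃L[ℝ] EuclideanSpace ℝ (Fin (Module.finrank ℝ X)) := toEuclidean
  let G' : EuclideanSpace ℝ (Fin (Module.finrank ℝ X)) →
      EuclideanSpace ℝ (Fin (Module.finrank ℝ X)) := fun x => e (G (e.symm x + p) - p)
  have hG' : Continuous G' := by fun_prop
  obtain ⟨C, hC, hbd⟩ := (e : X →L[ℝ] EuclideanSpace ℝ (Fin (Module.finrank ℝ X))).bound
  obtain ⟨x, hx⟩ := exists_eq_zero_of_eq_id_off_ball
    (ρ := C * (|ρ| + ‖p‖)) (by positivity) hG' (by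
      intro x hx
      suffices hx0 : ρ ≤ ‖e.symm x + p‖ by simp [G', hid _ hx0]
      by_contra! hx0
      have h1 : ‖e.symm x‖ < |ρ| + ‖p‖ := by
        have := norm_sub_le (e.symm x + p) p
        rw [add_sub_cancel_right] at this
        linarith [le_abs_self ρ]
      have h2 : ‖x‖ ≤ C * ‖e.symm x‖ := by simpa using hbd (e.symm x)
      exact absurd (le_of_mul_le_mul_left (hx.trans h2) hC) (not_le.2 h1))
  exact ⟨e.symm x + p, sub_eq_zero.1 (e.map_eq_zero_iff.1 hx)⟩

/-- A linking principle: a function with a Lipschitz-type gradient `G` satisfying a compactness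
condition has a critical value between the linking levels. -/
theorem exists_critical_of_linking {V U : Type*} [NormedAddCommGroup V] [InnerProductSpace ℝ V]
    [FiniteDimensional ℝ V] [NormedAddCommGroup U] [NormedSpace ℝ U] [FiniteDimensional ℝ U]
    {F : V → ℝ} {G : V → V} (hF : Continuous F) (hG : Continuous G) {C : ℝ} (hC : 0 < C)
    (hdesc : ∀ y b, F (y + b) ≤ F y + inner ℝ (G y) b + C * ‖b‖ ^ 2)
    {ρ : ℝ} (hps : ∀ y, ‖G y‖ ≤ 1 → ‖y‖ ≤ ρ)
    {p : V → U} {N : V → ℝ} (hp : Continuous p) (hN : Continuous N) {j : U × ℝ → V}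
    (hj : Continuous j) (hpj : ∀ z : U × ℝ, p (j z) = z.1)
    (hNj : ∀ z : U × ℝ, 0 ≤ z.2 → N (j z) = z.2) {β M τ α : ℝ} (hβ : 0 < β) (hα : 0 < α)
    (hM : ∀ z : U × ℝ, 0 ≤ z.2 → F (j z) ≤ M)
    (h0 : ∀ z : U × ℝ, z.2 = 0 → F (j z) ≤ 0)
    (hτ : ∀ z : U × ℝ, 0 ≤ z.2 → τ ≤ ‖z‖ → F (j z) ≤ 0)
    (hlink : ∀ y, p y = 0 → N y = α → β ≤ F y) :
    ∃ y, G y = 0 ∧ β ≤ F y ∧ F y ≤ M := by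
  by_contra! hno
  obtain ⟨κ, hκ, hκG⟩ : ∃ κ : ℝ, 0 < κ ∧ ∀ y, β ≤ F y → F y ≤ M → κ ≤ ‖G y‖ := by
    let K : Set V := closedBall 0 ρ ∩ F ⁻¹' Icc β M
    have hK : IsCompact K := (isCompact_closedBall 0 ρ).inter_right (isClosed_Icc.preimage hF)
    rcases K.eq_empty_or_nonempty with hemp | hne
    · refine ⟨1, one_pos, fun y h1 h2 => ?_⟩
      by_contra! h
      have : y ∈ K := ⟨by simpa using hps y h.le, h1, h2⟩
      rw [hemp] at this
      exact this
    · obtain ⟨y0, hy0, hmin⟩ := hK.exists_isMinOn hne hG.norm.continuousOn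
      have hpos : 0 < ‖G y0‖ := by
        refine norm_pos_iff.2 fun h => ?_
        exact absurd hy0.2.2 (not_le.2 (hno y0 h hy0.2.1))
      refine ⟨min ‖G y0‖ 1, lt_min hpos one_pos, fun y h1 h2 => ?_⟩
      rcases le_total ‖G y‖ 1 with h | h
      · have : y ∈ K := ⟨by simpa using hps y h, h1, h2⟩
        exact (min_le_left _ _).trans (hmin this)
      · exact (min_le_right _ _).trans h
  let χ : V → ℝ := fun y => max 0 (min 1 (F y / β))
  have hχc : Continuous χ := by fun_prop
  have hχ0 : ∀ y, 0 ≤ χ y := fun y => le_max_left _ _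
  have hχ1 : ∀ y, χ y ≤ 1 := fun y => max_le zero_le_one (min_le_left _ _)
  have hχβ : ∀ y, β ≤ F y → χ y = 1 := by
    intro y hy
    have : 1 ≤ F y / β := (one_le_div hβ).2 hy
    simp [χ, min_eq_left this]
  have hχneg : ∀ y, F y ≤ 0 → χ y = 0 := by
    intro y hy
    have : F y / β ≤ 0 := div_nonpos_of_nonpos_of_nonneg hy hβ.le
    exact max_eq_left ((min_le_right _ _).trans this)
  let s : ℝ := 1 / (2 * C)
  have hs : 0 < s := by positivity
  have hCs : C * s = 1 / 2 := by simp only [s]; field_simp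
  let D : V → V := fun y => y + (-(s * χ y)) • G y
  have hD : Continuous D := by fun_prop
  have hFD : ∀ y, F (D y) ≤ F y - s * χ y / 2 * ‖G y‖ ^ 2 := by
    intro y
    have h := hdesc y ((-(s * χ y)) • G y)
    rw [inner_smul_right, real_inner_self_eq_norm_sq, norm_smul, norm_neg,
      Real.norm_of_nonneg (mul_nonneg hs.le (hχ0 y))] at h
    refine h.trans ?_
    have e : C * (s * χ y * ‖G y‖) ^ 2 = (C * s) * (χ y * (s * χ y * ‖G y‖ ^ 2)) := by ring
    rw [e, hCs]
    have h1 : χ y * (s * χ y * ‖G y‖ ^ 2) ≤ 1 * (s * χ y * ‖G y‖ ^ 2) :=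
      mul_le_mul_of_nonneg_right (hχ1 y)
        (mul_nonneg (mul_nonneg hs.le (hχ0 y)) (sq_nonneg _))
    linarith
  have hFD' : ∀ y, F (D y) ≤ F y := fun y => (hFD y).trans (sub_le_self _
    (mul_nonneg (div_nonneg (mul_nonneg hs.le (hχ0 y)) two_pos.le) (sq_nonneg _)))
  have hfix : ∀ y, F y ≤ 0 → D y = y := by
    intro y hy
    simp [D, hχneg y hy]
  have hiter : ∀ (m : ℕ) (y : V), F y ≤ M →
      F (D^[m] y) < β ∨ F (D^[m] y) ≤ M - m * (s / 2 * κ ^ 2) := by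
    intro m y hy
    induction m with
    | zero => right; simpa using hy
    | succ m ih =>
      rw [Function.iterate_succ_apply']
      rcases lt_or_ge (F (D^[m] y)) β with h | h
      · exact Or.inl ((hFD' _).trans_lt h)
      · right
        have h2 := ih.resolve_left (not_lt.2 h)
        have h3 : F (D^[m] y) ≤ M := h2.trans (sub_le_self _ (by positivity))
        have h4 := hFD (D^[m] y)
        rw [hχβ _ h, mul_one] at h4
        have h5 : κ ^ 2 ≤ ‖G (D^[m] y)‖ ^ 2 := pow_le_pow_left₀ hκ.le (hκG _ h h3) 2
        have h6 : s / 2 * κ ^ 2 ≤ s / 2 * ‖G (D^[m] y)‖ ^ 2 :=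
          mul_le_mul_of_nonneg_left h5 (by positivity)
        push_cast
        linarith
  obtain ⟨m, hm⟩ : ∃ m : ℕ, M - m * (s / 2 * κ ^ 2) < β := by
    have hpos : 0 < s / 2 * κ ^ 2 := by positivity
    obtain ⟨m, hm⟩ := exists_nat_gt ((M - β) / (s / 2 * κ ^ 2))
    refine ⟨m, ?_⟩
    rw [div_lt_iff₀ hpos] at hm
    linarith
  have hlow : ∀ y, F y ≤ M → F (D^[m] y) < β := fun y hy =>
    (hiter m y hy).elim id fun h => h.trans_lt hm
  have hfixm : ∀ y, F y ≤ 0 → D^[m] y = y := fun y hy => Function.iterate_fixed (hfix y hy) m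
  let Φ : U × ℝ → U × ℝ := fun z =>
    if 0 ≤ z.2 then (p (D^[m] (j z)), N (D^[m] (j z))) else z
  have hΦ : Continuous Φ := by
    have hDm : Continuous (D^[m]) := hD.iterate m
    refine Continuous.if_le (by fun_prop) continuous_id continuous_const continuous_snd ?_
    intro z hz
    rw [hfixm _ (h0 z hz.symm), hpj, hNj z hz.le]
  obtain ⟨z, hz⟩ := surjective_of_eq_id_off_ball (ρ := τ) hΦ (by
    intro z hz
    simp only [Φ]
    split_ifs with h
    · rw [hfixm _ (hτ z h hz), hpj, hNj z h]
    · rfl) ((0 : U), α)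
  simp only [Φ] at hz
  split_ifs at hz with h
  · have h1 := hlink _ (congrArg Prod.fst hz) (congrArg Prod.snd hz)
    exact absurd h1 (not_le.2 (hlow _ (hM z h)))
  · rw [hz] at h
    exact h hα.le

section Rotation

variable {E : Type*} [NormedAddCommGroup E] [InnerProductSpace ℝ E]

/-- The rotation `cos θ + sin θ J` generated by a complex structure `J`. -/
def rot (J : E →L[ℝ] E) (θ : ℝ) : E →L[ℝ] E :=
  cos θ • ContinuousLinearMap.id ℝ E + sin θ • J

theorem rot_apply (J : E →L[ℝ] E) (θ : ℝ) (x : E) : rot J θ x = cos θ • x + sin θ • J x := by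
  simp [rot]

@[fun_prop]
theorem continuous_rot (J : E →L[ℝ] E) : Continuous (rot J) := by
  unfold rot; fun_prop

theorem rot_zero (J : E →L[ℝ] E) (x : E) : rot J 0 x = x := by simp [rot_apply]

variable {J : E →L[ℝ] E}

theorem rot_add (hJ : ∀ x, J (J x) = -x) (a b : ℝ) (x : E) :
    rot J (a + b) x = rot J a (rot J b x) := by
  simp only [rot_apply, cos_add, sin_add, map_add, map_smul, hJ]
  module

theorem inner_J_left (hJ : ∀ x, J (J x) = -x) (hJi : ∀ x y, inner ℝ (J x) (J y) = inner ℝ x y)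
    (x y : E) : inner ℝ (J x) y = -inner ℝ x (J y) := by
  rw [← hJi x (J y), hJ, inner_neg_right, neg_neg]

theorem inner_J_self (hJ : ∀ x, J (J x) = -x) (hJi : ∀ x y, inner ℝ (J x) (J y) = inner ℝ x y)
    (x : E) : inner ℝ (J x) x = 0 := by
  have h := inner_J_left hJ hJi x x
  rw [real_inner_comm (J x) x] at h
  linarith

theorem inner_rot_rot (hJ : ∀ x, J (J x) = -x) (hJi : ∀ x y, inner ℝ (J x) (J y) = inner ℝ x y)
    (a b : ℝ) (x y : E) : inner ℝ (rot J a x) (rot J b y) =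
      cos (a - b) * inner ℝ x y + sin (a - b) * inner ℝ (J x) y := by
  have h := inner_J_left hJ hJi x y
  simp only [rot_apply, inner_add_left, inner_add_right, inner_smul_left, inner_smul_right, hJi,
    cos_sub, sin_sub, conj_trivial]
  rw [show inner ℝ x (J y) = -inner ℝ (J x) y by linarith]
  ring

theorem inner_rot_left (hJ : ∀ x, J (J x) = -x) (hJi : ∀ x y, inner ℝ (J x) (J y) = inner ℝ x y)
    (a : ℝ) (x y : E) : inner ℝ (rot J a x) y = inner ℝ x (rot J (-a) y) := by
  have h1 := inner_rot_rot hJ hJi a 0 x y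
  have h2 := inner_rot_rot hJ hJi 0 (-a) x y
  rw [rot_zero] at h1 h2
  rw [h1, h2]; simp

theorem norm_rot (hJ : ∀ x, J (J x) = -x) (hJi : ∀ x y, inner ℝ (J x) (J y) = inner ℝ x y)
    (a : ℝ) (x : E) : ‖rot J a x‖ = ‖x‖ := by
  have h := inner_rot_rot hJ hJi a a x x
  simp only [sub_self, cos_zero, sin_zero, zero_mul, add_zero, one_mul,
    real_inner_self_eq_norm_sq] at h
  exact (pow_left_inj₀ (norm_nonneg _) (norm_nonneg _) two_ne_zero).1 h

theorem norm_J (hJi : ∀ x y, inner ℝ (J x) (J y) = inner ℝ x y)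
    (x : E) : ‖J x‖ = ‖x‖ := by
  have h := hJi x x
  simp only [real_inner_self_eq_norm_sq] at h
  exact (pow_left_inj₀ (norm_nonneg _) (norm_nonneg _) two_ne_zero).1 h

theorem hasDerivAt_rot (hJ : ∀ x, J (J x) = -x) (θ : ℝ) (x : E) :
    HasDerivAt (fun θ => rot J θ x) (J (rot J θ x)) θ := by
  simp only [rot_apply, map_add, map_smul, hJ]
  refine (((hasDerivAt_cos θ).smul_const x).add ((hasDerivAt_sin θ).smul_const (J x))).congr_deriv ?_
  module

theorem integral_cos_two_pi_int (d : ℤ) :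
    ∫ t in (0 : ℝ)..1, cos (2 * π * d * t) = if d = 0 then 1 else 0 := by
  split_ifs with h
  · simp [h]
  · have hd : (2 * π * d : ℝ) ≠ 0 := by
      have : (d : ℝ) ≠ 0 := by exact_mod_cast h
      have := pi_ne_zero
      positivity
    rw [intervalIntegral.integral_comp_mul_left (fun x => cos x) hd]
    simp only [mul_zero, mul_one, integral_cos, sin_zero, sub_zero]
    rw [show 2 * π * (d : ℝ) = ((2 * d : ℤ) : ℝ) * π by push_cast; ring, sin_int_mul_pi]
    simp

theorem integral_sin_two_pi_int (d : ℤ) : ∫ t in (0 : ℝ)..1, sin (2 * π * d * t) = 0 := by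
  by_cases h : d = 0
  · simp [h]
  · have hd : (2 * π * d : ℝ) ≠ 0 := by
      have : (d : ℝ) ≠ 0 := by exact_mod_cast h
      have := pi_ne_zero
      positivity
    rw [intervalIntegral.integral_comp_mul_left (fun x => sin x) hd]
    simp only [mul_zero, mul_one, integral_sin, cos_zero]
    rw [show 2 * π * (d : ℝ) = (d : ℝ) * (2 * π) by ring, cos_int_mul_two_pi]
    simp

theorem integral_trig_two_pi_int (d : ℤ) (A B : ℝ) :
    ∫ t in (0 : ℝ)..1, (cos (2 * π * d * t) * A + sin (2 * π * d * t) * B) =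
      if d = 0 then A else 0 := by
  rw [intervalIntegral.integral_add (Continuous.intervalIntegrable (by fun_prop) _ _)
    (Continuous.intervalIntegrable (by fun_prop) _ _), intervalIntegral.integral_mul_const,
    intervalIntegral.integral_mul_const, integral_cos_two_pi_int, integral_sin_two_pi_int]
  split_ifs <;> simp

theorem integral_inner_rot_rot (hJ : ∀ x, J (J x) = -x)
    (hJi : ∀ x y, inner ℝ (J x) (J y) = inner ℝ x y) (k l : ℤ) (x y : E) :
    ∫ t in (0 : ℝ)..1, inner ℝ (rot J (2 * π * k * t) x) (rot J (2 * π * l * t) y) =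
      if k = l then inner ℝ x y else 0 := by
  have h := integral_trig_two_pi_int (k - l) (inner ℝ x y) (inner ℝ (J x) y)
  simp only [sub_eq_zero] at h
  rw [← h]
  refine intervalIntegral.integral_congr fun t _ => ?_
  simp only [inner_rot_rot hJ hJi]
  push_cast
  ring_nf

end Rotation

section Galerkin

variable {E : Type*} [NormedAddCommGroup E] [InnerProductSpace ℝ E] {ι : Type*} [Fintype ι]

/-- The trigonometric loop with frequencies `k i` and Fourier coefficients `y i`. -/
def trigLoop (J : E →L[ℝ] E) (k : ι → ℤ) (y : PiLp 2 fun _ : ι => E) (t : ℝ) : E :=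
  ∑ i, rot J (2 * π * k i * t) (y i)

/-- The Fourier coefficients of `w` at the frequencies `k i`. -/
def trigCoeff [CompleteSpace E] (J : E →L[ℝ] E) (k : ι → ℤ) (w : ℝ → E) : PiLp 2 fun _ : ι => E :=
  WithLp.toLp 2 fun i => ∫ t in (0 : ℝ)..1, rot J (-(2 * π * k i * t)) (w t)

variable {J : E →L[ℝ] E} {k : ι → ℤ}

theorem continuous_uncurry_trigLoop :
    Continuous fun p : (PiLp 2 fun _ : ι => E) × ℝ => trigLoop J k p.1 p.2 := by
  unfold trigLoop
  refine continuous_finsetSum _ fun i _ => ?_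
  have h1 : Continuous fun p : (PiLp 2 fun _ : ι => E) × ℝ => rot J (2 * π * k i * p.2) := by
    fun_prop
  have h2 : Continuous fun p : (PiLp 2 fun _ : ι => E) × ℝ => p.1 i := by fun_prop
  exact h1.clm_apply h2

@[fun_prop]
theorem continuous_trigLoop (y : PiLp 2 fun _ : ι => E) : Continuous (trigLoop J k y) := by
  unfold trigLoop
  refine continuous_finsetSum _ fun i _ => ?_
  have h1 : Continuous fun t : ℝ => rot J (2 * π * k i * t) := by fun_prop
  exact h1.clm_apply continuous_const

theorem trigLoop_add (y b : PiLp 2 fun _ : ι => E) (t : ℝ) :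
    trigLoop J k (y + b) t = trigLoop J k y t + trigLoop J k b t := by
  simp [trigLoop, Finset.sum_add_distrib]

theorem trigLoop_one_eq_zero (y : PiLp 2 fun _ : ι => E) :
    trigLoop J k y 1 = trigLoop J k y 0 := by
  simp only [trigLoop]
  refine Finset.sum_congr rfl fun i _ => ?_
  rw [rot_apply, rot_apply]
  have h : 2 * π * (k i : ℝ) * 1 = (k i : ℝ) * (2 * π) := by ring
  have h2 : sin ((k i : ℝ) * (2 * π)) = 0 := by
    rw [show (k i : ℝ) * (2 * π) = ((2 * k i : ℤ) : ℝ) * π by push_cast; ring, sin_int_mul_pi]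
  simp [h, h2, cos_int_mul_two_pi]

theorem integral_inner_trigLoop (hJ : ∀ x, J (J x) = -x)
    (hJi : ∀ x y, inner ℝ (J x) (J y) = inner ℝ x y) (hk : Function.Injective k)
    (y b : PiLp 2 fun _ : ι => E) :
    ∫ t in (0 : ℝ)..1, inner ℝ (trigLoop J k y t) (trigLoop J k b t) = inner ℝ y b := by
  simp only [trigLoop, sum_inner, inner_sum]
  rw [intervalIntegral.integral_finsetSum]
  · simp only [PiLp.inner_apply]
    refine Finset.sum_congr rfl fun i _ => ?_
    rw [intervalIntegral.integral_finsetSum]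
    · rw [Finset.sum_congr rfl fun j _ => integral_inner_rot_rot hJ hJi (k j) (k i) _ _]
      rw [Finset.sum_eq_single i (fun j _ hj => if_neg fun h => hj (hk h)) (by simp), if_pos rfl]
    · intro j _
      refine Continuous.intervalIntegrable ?_ _ _
      fun_prop
  · intro i _
    refine Continuous.intervalIntegrable ?_ _ _
    fun_prop

theorem integral_norm_sq_trigLoop (hJ : ∀ x, J (J x) = -x)
    (hJi : ∀ x y, inner ℝ (J x) (J y) = inner ℝ x y) (hk : Function.Injective k)
    (y : PiLp 2 fun _ : ι => E) :
    ∫ t in (0 : ℝ)..1, ‖trigLoop J k y t‖ ^ 2 = ‖y‖ ^ 2 := by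
  rw [← real_inner_self_eq_norm_sq, ← integral_inner_trigLoop hJ hJi hk y y]
  simp only [real_inner_self_eq_norm_sq]

theorem integral_norm_trigLoop_le (hJ : ∀ x, J (J x) = -x)
    (hJi : ∀ x y, inner ℝ (J x) (J y) = inner ℝ x y) (hk : Function.Injective k)
    (y : PiLp 2 fun _ : ι => E) :
    ∫ t in (0 : ℝ)..1, ‖trigLoop J k y t‖ ≤ ‖y‖ := by
  rcases eq_or_lt_of_le (norm_nonneg y) with h | h
  · have h0 : y = 0 := norm_eq_zero.1 h.symm
    simp [h0, trigLoop]
  · have h1 : ∫ t in (0 : ℝ)..1, ‖trigLoop J k y t‖ ≤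
        ∫ t in (0 : ℝ)..1, (‖trigLoop J k y t‖ ^ 2 * (2 * ‖y‖)⁻¹ + ‖y‖ / 2) := by
      refine intervalIntegral.integral_mono_on zero_le_one
        (Continuous.intervalIntegrable (by fun_prop) _ _)
        (Continuous.intervalIntegrable (by fun_prop) _ _) fun t _ => ?_
      have : ‖trigLoop J k y t‖ ^ 2 * (2 * ‖y‖)⁻¹ + ‖y‖ / 2 - ‖trigLoop J k y t‖ =
          (‖trigLoop J k y t‖ - ‖y‖) ^ 2 / (2 * ‖y‖) := by field_simp; ring
      have : 0 ≤ (‖trigLoop J k y t‖ - ‖y‖) ^ 2 / (2 * ‖y‖) := by positivity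
      linarith
    rw [intervalIntegral.integral_add (Continuous.intervalIntegrable (by fun_prop) _ _)
      (by simp), intervalIntegral.integral_mul_const, integral_norm_sq_trigLoop hJ hJi hk] at h1
    refine h1.trans (le_of_eq ?_)
    simp
    field_simp
    ring

variable [CompleteSpace E]

theorem inner_trigCoeff (hJ : ∀ x, J (J x) = -x)
    (hJi : ∀ x y, inner ℝ (J x) (J y) = inner ℝ x y) {w : ℝ → E} (hw : Continuous w)
    (b : PiLp 2 fun _ : ι => E) :
    inner ℝ (trigCoeff J k w) b = ∫ t in (0 : ℝ)..1, inner ℝ (w t) (trigLoop J k b t) := by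
  simp only [trigLoop, inner_sum, PiLp.inner_apply, trigCoeff]
  rw [intervalIntegral.integral_finsetSum]
  · refine Finset.sum_congr rfl fun i _ => ?_
    rw [real_inner_comm, ← innerSL_apply_apply ℝ, ← ContinuousLinearMap.intervalIntegral_comp_comm]
    · refine intervalIntegral.integral_congr fun t _ => ?_
      simp only [innerSL_apply_apply]
      rw [real_inner_comm, inner_rot_left hJ hJi, neg_neg]
    · refine Continuous.intervalIntegrable ?_ _ _
      exact Continuous.clm_apply (by fun_prop) hw
  · intro i _
    refine Continuous.intervalIntegrable ?_ _ _
    fun_prop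

theorem norm_trigCoeff_le (hJ : ∀ x, J (J x) = -x)
    (hJi : ∀ x y, inner ℝ (J x) (J y) = inner ℝ x y) (hk : Function.Injective k)
    {w : ℝ → E} (hw : Continuous w) {C : ℝ} (hC : 0 ≤ C) (hwC : ∀ t, ‖w t‖ ≤ C) :
    ‖trigCoeff J k w‖ ≤ C := by
  have h1 : ‖trigCoeff J k w‖ ^ 2 ≤ C * ‖trigCoeff J k w‖ := by
    rw [← real_inner_self_eq_norm_sq, inner_trigCoeff hJ hJi hw]
    calc _ ≤ ∫ t in (0 : ℝ)..1, C * ‖trigLoop J k (trigCoeff J k w) t‖ := by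
          refine intervalIntegral.integral_mono_on zero_le_one
            (Continuous.intervalIntegrable (by fun_prop) _ _)
            (Continuous.intervalIntegrable (by fun_prop) _ _) fun t _ => ?_
          refine (real_inner_le_norm _ _).trans ?_
          gcongr
          exact hwC t
      _ ≤ _ := by
          rw [intervalIntegral.integral_const_mul]
          gcongr
          exact integral_norm_trigLoop_le hJ hJi hk _
  rcases eq_or_lt_of_le (norm_nonneg (trigCoeff J k w)) with h | h
  · rw [← h]; exact hC
  · nlinarith

set_option linter.unusedSectionVars false in
theorem trigCoeff_add {v w : ℝ → E} (hv : Continuous v) (hw : Continuous w) :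
    trigCoeff J k (fun t => v t + w t) = trigCoeff J k v + trigCoeff J k w := by
  ext i
  simp only [trigCoeff, PiLp.add_apply, map_add]
  refine intervalIntegral.integral_add ?_ ?_
  · exact (Continuous.clm_apply (by fun_prop) hv).intervalIntegrable _ _
  · exact (Continuous.clm_apply (by fun_prop) hw).intervalIntegrable _ _

theorem trigCoeff_comp_trigLoop (hJ : ∀ x, J (J x) = -x)
    (hJi : ∀ x y, inner ℝ (J x) (J y) = inner ℝ x y) (hk : Function.Injective k)
    (S : E →L[ℝ] E) (hSJ : ∀ x, S (J x) = J (S x)) (y : PiLp 2 fun _ : ι => E) :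
    trigCoeff J k (fun t => S (trigLoop J k y t)) = WithLp.toLp 2 fun i => S (y i) := by
  have h1 : ∀ t, S (trigLoop J k y t) = trigLoop J k (WithLp.toLp 2 fun i => S (y i)) t := by
    intro t
    simp [trigLoop, rot_apply, hSJ]
  refine ext_inner_right ℝ fun b => ?_
  rw [inner_trigCoeff hJ hJi (by fun_prop)]
  simp only [h1]
  exact integral_inner_trigLoop hJ hJi hk _ _

end Galerkin

section FourthPower

variable {ι : Type*} [Fintype ι]

theorem sum_inv_mul_le_two {k : ι → ℤ} (hk : Function.Injective k) (hk1 : ∀ i, 1 ≤ k i) (m : ℤ) :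
    ∑ j, ∑ q, (if k j + k q = m then ((k j : ℝ) * k q)⁻¹ else 0) ≤ 2 := by
  classical
  rcases le_or_gt m 0 with hm | hm
  · refine (Finset.sum_nonpos fun j _ => Finset.sum_nonpos fun q _ => ?_).trans zero_le_two
    have := hk1 j; have := hk1 q
    rw [if_neg (by omega)]
  have hm' : (0 : ℝ) < m := by exact_mod_cast hm
  have h1 : ∀ j, ∑ q, (if k j + k q = m then ((k j : ℝ) * k q)⁻¹ else 0) ≤
      if k j ∈ Finset.Icc 1 (m - 1) then (2 / m : ℝ) else 0 := by
    intro j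
    by_cases hj : ∃ q, k j + k q = m
    · obtain ⟨q, hq⟩ := hj
      rw [Finset.sum_eq_single q (fun q' _ hq' => if_neg fun h => hq' (hk (by omega))) (by simp),
        if_pos hq, if_pos (Finset.mem_Icc.2 ⟨hk1 j, by have := hk1 q; omega⟩)]
      have ha : (1 : ℝ) ≤ k j := by exact_mod_cast hk1 j
      have hb : (1 : ℝ) ≤ k q := by exact_mod_cast hk1 q
      have hab : (k j : ℝ) + k q = m := by exact_mod_cast hq
      rw [inv_eq_one_div, div_le_div_iff₀ (by positivity) hm']
      nlinarith [mul_nonneg (sub_nonneg.2 ha) (sub_nonneg.2 hb)]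
    · push Not at hj
      rw [Finset.sum_eq_zero fun q _ => if_neg (hj q)]
      split_ifs <;> positivity
  refine (Finset.sum_le_sum fun j _ => h1 j).trans ?_
  rw [← Finset.sum_filter, Finset.sum_const, nsmul_eq_mul]
  have hcard : (Finset.univ.filter fun j => k j ∈ Finset.Icc 1 (m - 1)).card ≤
      (Finset.Icc 1 (m - 1)).card :=
    Finset.card_le_card_of_injOn k (fun j hj => (Finset.mem_filter.1 hj).2) hk.injOn
  rw [Int.card_Icc] at hcard
  have h2 : (((Finset.univ.filter fun j => k j ∈ Finset.Icc 1 (m - 1)).card : ℕ) : ℝ) ≤ m := by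
    have : (((Finset.univ.filter fun j => k j ∈ Finset.Icc 1 (m - 1)).card : ℕ) : ℤ) ≤ m := by
      omega
    exact_mod_cast this
  calc _ ≤ (m : ℝ) * (2 / m) := by gcongr
    _ = 2 := by field_simp

theorem sum_resonant_le {k : ι → ℤ} (hk : Function.Injective k) (hk1 : ∀ i, 1 ≤ k i)
    (a : ι → ℝ) :
    ∑ i, ∑ p, ∑ j, ∑ q, (if k j + k q = k i + k p then a i * a p * (a j * a q) else 0) ≤
      2 * (∑ i, k i * a i ^ 2) ^ 2 := by
  have hk0 : ∀ i, (0 : ℝ) < k i := fun i => by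
    have := hk1 i
    exact_mod_cast (by omega : 0 < k i)
  set X : ι → ι → ι → ι → ℝ := fun i p j q =>
    if k j + k q = k i + k p then (a i * a p) ^ 2 * (k i * k p) * ((k j : ℝ) * k q)⁻¹ else 0
    with hX
  have hXsum : ∑ i, ∑ p, ∑ j, ∑ q, X i p j q ≤ 2 * (∑ i, k i * a i ^ 2) ^ 2 := by
    have h1 : ∀ i p, ∑ j, ∑ q, X i p j q ≤ 2 * ((k i * a i ^ 2) * (k p * a p ^ 2)) := by
      intro i p
      have h2 : ∑ j, ∑ q, X i p j q = (a i * a p) ^ 2 * (k i * k p) *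
          ∑ j, ∑ q, (if k j + k q = k i + k p then ((k j : ℝ) * k q)⁻¹ else 0) := by
        simp only [Finset.mul_sum, mul_ite, mul_zero, hX]
      rw [h2]
      have h3 : 0 ≤ (a i * a p) ^ 2 * ((k i : ℝ) * k p) := by
        have := hk0 i; have := hk0 p; positivity
      nlinarith [sum_inv_mul_le_two hk hk1 (k i + k p)]
    refine (Finset.sum_le_sum fun i _ => Finset.sum_le_sum fun p _ => h1 i p).trans (le_of_eq ?_)
    rw [sq, Finset.sum_mul_sum, Finset.mul_sum]
    simp only [Finset.mul_sum]
  have hle : ∀ i p j q, (if k j + k q = k i + k p then a i * a p * (a j * a q) else 0) ≤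
      (X i p j q + X j q i p) / 2 := by
    intro i p j q
    simp only [hX, eq_comm (a := k i + k p)]
    split_ifs
    · have hP : 0 < (k i : ℝ) * k p := mul_pos (hk0 i) (hk0 p)
      have hQ : 0 < (k j : ℝ) * k q := mul_pos (hk0 j) (hk0 q)
      generalize (k i : ℝ) * k p = P at *
      generalize (k j : ℝ) * k q = Q at *
      have : ((a i * a p) ^ 2 * P * Q⁻¹ + (a j * a q) ^ 2 * Q * P⁻¹) / 2 -
          a i * a p * (a j * a q) = (a i * a p * P - a j * a q * Q) ^ 2 / (2 * (P * Q)) := by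
        field_simp; ring
      have : 0 ≤ (a i * a p * P - a j * a q * Q) ^ 2 / (2 * (P * Q)) := by positivity
      linarith
    · simp
  have hswap : ∑ i, ∑ p, ∑ j, ∑ q, X j q i p = ∑ i, ∑ p, ∑ j, ∑ q, X i p j q := by
    have e1 : ∀ f : ι → ι → ι → ι → ℝ, ∑ i, ∑ p, ∑ j, ∑ q, f i p j q =
        ∑ x : ι × ι, ∑ y : ι × ι, f x.1 x.2 y.1 y.2 := by
      intro f
      simp only [Fintype.sum_prod_type]
    rw [e1, e1, Finset.sum_comm]
  calc _ ≤ ∑ i, ∑ p, ∑ j, ∑ q, (X i p j q + X j q i p) / 2 := by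
        gcongr with i _ p _ j _ q _
        exact hle i p j q
    _ = (∑ i, ∑ p, ∑ j, ∑ q, X i p j q + ∑ i, ∑ p, ∑ j, ∑ q, X j q i p) / 2 := by
        simp only [← Finset.sum_div, Finset.sum_add_distrib]
    _ ≤ _ := by rw [hswap]; linarith

theorem integral_trig_mul_trig_le (d d' : ℤ) {A B A' B' c c' : ℝ} (hA : |A| ≤ c) (hB : |B| ≤ c)
    (hA' : |A'| ≤ c') (hB' : |B'| ≤ c') :
    ∫ t in (0 : ℝ)..1, (cos (2 * π * d * t) * A + sin (2 * π * d * t) * B) *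
        (cos (2 * π * d' * t) * A' + sin (2 * π * d' * t) * B') ≤
      (if d = d' then c * c' else 0) + (if d + d' = 0 then c * c' else 0) := by
  have h1 : ∀ t : ℝ, (cos (2 * π * d * t) * A + sin (2 * π * d * t) * B) *
        (cos (2 * π * d' * t) * A' + sin (2 * π * d' * t) * B') =
      (cos (2 * π * ((d - d' : ℤ) : ℝ) * t) * ((A * A' + B * B') / 2) +
        sin (2 * π * ((d - d' : ℤ) : ℝ) * t) * ((B * A' - A * B') / 2)) +
      (cos (2 * π * ((d + d' : ℤ) : ℝ) * t) * ((A * A' - B * B') / 2) +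
        sin (2 * π * ((d + d' : ℤ) : ℝ) * t) * ((B * A' + A * B') / 2)) := by
    intro t
    push_cast
    rw [show 2 * π * ((d : ℝ) - d') * t = 2 * π * d * t - 2 * π * d' * t by ring,
      show 2 * π * ((d : ℝ) + d') * t = 2 * π * d * t + 2 * π * d' * t by ring,
      cos_sub, sin_sub, cos_add, sin_add]
    ring
  have hc : 0 ≤ c := (abs_nonneg _).trans hA
  have hAA : |A * A'| ≤ c * c' := by rw [abs_mul]; gcongr
  have hBB : |B * B'| ≤ c * c' := by rw [abs_mul]; gcongr
  rw [abs_le] at hAA hBB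
  rw [intervalIntegral.integral_congr fun t _ => h1 t, intervalIntegral.integral_add
    (Continuous.intervalIntegrable (by fun_prop) _ _)
    (Continuous.intervalIntegrable (by fun_prop) _ _), integral_trig_two_pi_int,
    integral_trig_two_pi_int]
  simp only [sub_eq_zero]
  refine add_le_add ?_ ?_ <;> split_ifs <;> linarith

variable {E : Type*} [NormedAddCommGroup E] [InnerProductSpace ℝ E] {J : E →L[ℝ] E} {k : ι → ℤ}

theorem integral_norm_pow_four_trigLoop_le_of_pos (hJ : ∀ x, J (J x) = -x)
    (hJi : ∀ x y, inner ℝ (J x) (J y) = inner ℝ x y) (hk : Function.Injective k)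
    (hk1 : ∀ i, 1 ≤ k i) (y : PiLp 2 fun _ : ι => E) :
    ∫ t in (0 : ℝ)..1, ‖trigLoop J k y t‖ ^ 4 ≤ 4 * (∑ i, k i * ‖y i‖ ^ 2) ^ 2 := by
  set T : ι → ι → ℝ → ℝ := fun i j t =>
    cos (2 * π * ((k i - k j : ℤ) : ℝ) * t) * inner ℝ (y i) (y j) +
      sin (2 * π * ((k i - k j : ℤ) : ℝ) * t) * inner ℝ (J (y i)) (y j) with hT
  have hTc : ∀ i j, Continuous (T i j) := fun i j => by simp only [hT]; fun_prop
  have h1 : ∀ t, ‖trigLoop J k y t‖ ^ 4 = ∑ i, ∑ p, ∑ j, ∑ q, T i j t * T p q t := by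
    intro t
    have h2 : ‖trigLoop J k y t‖ ^ 2 = ∑ i, ∑ j, T i j t := by
      rw [← real_inner_self_eq_norm_sq, trigLoop, sum_inner]
      simp only [inner_sum, inner_rot_rot hJ hJi, hT]
      refine Finset.sum_congr rfl fun i _ => Finset.sum_congr rfl fun j _ => ?_
      push_cast
      ring_nf
    rw [show ‖trigLoop J k y t‖ ^ 4 = ‖trigLoop J k y t‖ ^ 2 * ‖trigLoop J k y t‖ ^ 2 by ring, h2,
      Finset.sum_mul_sum]
    simp only [Finset.sum_mul_sum]
  simp only [h1]
  have hIntg : ∀ i p j q, ∫ t in (0 : ℝ)..1, T i j t * T p q t ≤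
      (if k q + k i = k j + k p then ‖y j‖ * ‖y p‖ * (‖y q‖ * ‖y i‖) else 0) +
      (if k j + k q = k i + k p then ‖y i‖ * ‖y p‖ * (‖y j‖ * ‖y q‖) else 0) := by
    intro i p j q
    have hA : ∀ i j, |inner ℝ (y i) (y j)| ≤ ‖y i‖ * ‖y j‖ := fun i j => abs_real_inner_le_norm _ _
    have hB : ∀ i j, |inner ℝ (J (y i)) (y j)| ≤ ‖y i‖ * ‖y j‖ := fun i j => by
      have := abs_real_inner_le_norm (J (y i)) (y j)
      rwa [norm_J hJi] at this
    refine (integral_trig_mul_trig_le (k i - k j) (k p - k q) (hA i j) (hB i j) (hA p q)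
      (hB p q)).trans (le_of_eq ?_)
    congr 1
    · refine if_congr (by constructor <;> intro h <;> omega) (by ring) rfl
    · refine if_congr (by constructor <;> intro h <;> omega) (by ring) rfl
  have hIntg2 : ∫ t in (0 : ℝ)..1, ∑ i, ∑ p, ∑ j, ∑ q, T i j t * T p q t =
      ∑ i, ∑ p, ∑ j, ∑ q, ∫ t in (0 : ℝ)..1, T i j t * T p q t := by
    rw [intervalIntegral.integral_finsetSum fun i _ => Continuous.intervalIntegrable (by fun_prop) _ _]
    refine Finset.sum_congr rfl fun i _ => ?_
    rw [intervalIntegral.integral_finsetSum fun p _ => Continuous.intervalIntegrable (by fun_prop) _ _]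
    refine Finset.sum_congr rfl fun p _ => ?_
    rw [intervalIntegral.integral_finsetSum fun j _ => Continuous.intervalIntegrable (by fun_prop) _ _]
    refine Finset.sum_congr rfl fun j _ => ?_
    rw [intervalIntegral.integral_finsetSum fun q _ => Continuous.intervalIntegrable (by fun_prop) _ _]
  rw [hIntg2]
  have hR := sum_resonant_le hk hk1 fun i => ‖y i‖
  have hR2 : ∑ i, ∑ p, ∑ j, ∑ q,
      (if k q + k i = k j + k p then ‖y j‖ * ‖y p‖ * (‖y q‖ * ‖y i‖) else 0) =
      ∑ i, ∑ p, ∑ j, ∑ q,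
      (if k j + k q = k i + k p then ‖y i‖ * ‖y p‖ * (‖y j‖ * ‖y q‖) else 0) := by
    calc _ = ∑ i, ∑ j, ∑ p, ∑ q,
        (if k q + k i = k j + k p then ‖y j‖ * ‖y p‖ * (‖y q‖ * ‖y i‖) else 0) :=
          Finset.sum_congr rfl fun i _ => Finset.sum_comm
      _ = ∑ j, ∑ i, ∑ p, ∑ q,
        (if k q + k i = k j + k p then ‖y j‖ * ‖y p‖ * (‖y q‖ * ‖y i‖) else 0) := Finset.sum_comm
      _ = ∑ j, ∑ p, ∑ i, ∑ q,
        (if k q + k i = k j + k p then ‖y j‖ * ‖y p‖ * (‖y q‖ * ‖y i‖) else 0) :=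
          Finset.sum_congr rfl fun i _ => Finset.sum_comm
      _ = ∑ j, ∑ p, ∑ q, ∑ i,
        (if k q + k i = k j + k p then ‖y j‖ * ‖y p‖ * (‖y q‖ * ‖y i‖) else 0) :=
          Finset.sum_congr rfl fun i _ => Finset.sum_congr rfl fun j _ => Finset.sum_comm
      _ = _ := rfl
  calc _ ≤ ∑ i, ∑ p, ∑ j, ∑ q,
      ((if k q + k i = k j + k p then ‖y j‖ * ‖y p‖ * (‖y q‖ * ‖y i‖) else 0) +
      (if k j + k q = k i + k p then ‖y i‖ * ‖y p‖ * (‖y j‖ * ‖y q‖) else 0)) := by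
        gcongr with i _ p _ j _ q _
        exact hIntg i p j q
    _ ≤ _ := by
        simp only [Finset.sum_add_distrib] at hR hR2 ⊢
        rw [hR2]
        linarith

theorem sum_eq_sum_subtype_one_le {F : Type*} [AddCommMonoid F] (k : ι → ℤ) (f : ι → F)
    (hf : ∀ i, k i ≤ 0 → f i = 0) : ∑ i, f i = ∑ i : {i // 1 ≤ k i}, f i := by
  rw [← Finset.sum_subtype (Finset.univ.filter fun i => 1 ≤ k i) (by simp) f,
    Finset.sum_filter_of_ne]
  intro i _ hi
  by_contra h
  exact hi (hf i (by omega))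

theorem integral_norm_pow_four_trigLoop_le (hJ : ∀ x, J (J x) = -x)
    (hJi : ∀ x y, inner ℝ (J x) (J y) = inner ℝ x y) (hk : Function.Injective k)
    (y : PiLp 2 fun _ : ι => E) (hy : ∀ i, k i ≤ 0 → y i = 0) :
    ∫ t in (0 : ℝ)..1, ‖trigLoop J k y t‖ ^ 4 ≤ 4 * (∑ i, k i * ‖y i‖ ^ 2) ^ 2 := by
  classical
  have h := integral_norm_pow_four_trigLoop_le_of_pos (J := J) (k := fun i : {i // 1 ≤ k i} => k i)
    hJ hJi (fun i j hij => Subtype.ext (hk hij)) (fun i => i.2) (WithLp.toLp 2 fun i => y i)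
  rw [sum_eq_sum_subtype_one_le k (fun i => (k i : ℝ) * ‖y i‖ ^ 2) fun i hi => by simp [hy i hi]]
  convert h using 5 with t
  exact sum_eq_sum_subtype_one_le k (fun i => rot J (2 * π * k i * t) (y i))
    fun i hi => by simp [hy i hi]

end FourthPower

section GalerkinCritical

variable {E : Type*} [NormedAddCommGroup E] [InnerProductSpace ℝ E] [FiniteDimensional ℝ E]
  {ι : Type*} [Fintype ι] {J : E →L[ℝ] E} {k : ι → ℤ}

/-- The action functional of the Hamiltonian `H` on trigonometric loops. -/
def trigAction (J : E →L[ℝ] E) (k : ι → ℤ) (H : E → ℝ) (y : PiLp 2 fun _ : ι => E) : ℝ :=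
  π * ∑ i, k i * ‖y i‖ ^ 2 - ∫ t in (0 : ℝ)..1, H (trigLoop J k y t)

set_option linter.unusedSectionVars false in
theorem continuous_trigAction {H : E → ℝ} (hH : Continuous H) :
    Continuous (trigAction (E := E) J k H) := by
  have h1 : Continuous fun y : PiLp 2 fun _ : ι => E =>
      ∫ t in (0 : ℝ)..1, H (trigLoop J k y t) :=
    intervalIntegral.continuous_parametric_intervalIntegral_of_continuous'
      (f := fun y t => H (trigLoop J k y t)) (hH.comp continuous_uncurry_trigLoop) _ _
  unfold trigAction
  fun_prop

theorem continuous_trigCoeff_comp {g : E → E} (hg : Continuous g) :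
    Continuous fun y : PiLp 2 fun _ : ι => E => trigCoeff J k fun t => g (trigLoop J k y t) := by
  unfold trigCoeff
  refine (PiLp.continuous_toLp 2 _).comp (continuous_pi fun i => ?_)
  refine intervalIntegral.continuous_parametric_intervalIntegral_of_continuous' ?_ _ _
  have h1 : Continuous fun p : (PiLp 2 fun _ : ι => E) × ℝ => rot J (-(2 * π * k i * p.2)) := by
    fun_prop
  exact h1.clm_apply (hg.comp continuous_uncurry_trigLoop)

theorem trigAction_add_le (hJ : ∀ x, J (J x) = -x)
    (hJi : ∀ x y, inner ℝ (J x) (J y) = inner ℝ x y) (hk : Function.Injective k)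
    {H : E → ℝ} {g : E → E} (hH : Continuous H) (hg : Continuous g) {L : ℝ}
    (hdesc : ∀ z b, H z + inner ℝ (g z) b - L * ‖b‖ ^ 2 ≤ H (z + b)) (y b : PiLp 2 fun _ : ι => E) :
    trigAction J k H (y + b) ≤ trigAction J k H y +
      inner ℝ ((WithLp.toLp 2 fun i => (2 * π * k i) • y i) -
        trigCoeff J k fun t => g (trigLoop J k y t)) b +
      (π * ∑ i, |(k i : ℝ)| + L) * ‖b‖ ^ 2 := by
  have hcont : Continuous fun t => g (trigLoop J k y t) := hg.comp (continuous_trigLoop y)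
  have h1 : (∫ t in (0 : ℝ)..1, H (trigLoop J k y t)) +
      inner ℝ (trigCoeff J k fun t => g (trigLoop J k y t)) b - L * ‖b‖ ^ 2 ≤
      ∫ t in (0 : ℝ)..1, H (trigLoop J k (y + b) t) := by
    rw [inner_trigCoeff hJ hJi hcont, ← integral_norm_sq_trigLoop hJ hJi hk b,
      ← intervalIntegral.integral_const_mul, ← intervalIntegral.integral_add
      (Continuous.intervalIntegrable (by fun_prop) _ _)
      (Continuous.intervalIntegrable (by fun_prop) _ _), ← intervalIntegral.integral_sub
      (Continuous.intervalIntegrable (by fun_prop) _ _)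
      (Continuous.intervalIntegrable (by fun_prop) _ _)]
    refine intervalIntegral.integral_mono_on zero_le_one
      (Continuous.intervalIntegrable (by fun_prop) _ _)
      (Continuous.intervalIntegrable (by fun_prop) _ _) fun t _ => ?_
    rw [trigLoop_add]
    exact hdesc _ _
  have h2 : ∑ i, k i * ‖(y + b) i‖ ^ 2 = ∑ i, k i * ‖y i‖ ^ 2 +
      2 * ∑ i, (k i : ℝ) * inner ℝ (y i) (b i) + ∑ i, k i * ‖b i‖ ^ 2 := by
    rw [Finset.mul_sum, ← Finset.sum_add_distrib, ← Finset.sum_add_distrib]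
    refine Finset.sum_congr rfl fun i _ => ?_
    rw [PiLp.add_apply, norm_add_sq_real]
    ring
  have h3 : ∑ i, k i * ‖b i‖ ^ 2 ≤ (∑ i, |(k i : ℝ)|) * ‖b‖ ^ 2 := by
    rw [Finset.sum_mul]
    refine Finset.sum_le_sum fun i _ => ?_
    have := PiLp.norm_apply_le b i
    gcongr
    exact le_abs_self _
  have h4 : inner ℝ (WithLp.toLp 2 fun i => (2 * π * k i) • y i) b =
      π * (2 * ∑ i, (k i : ℝ) * inner ℝ (y i) (b i)) := by
    rw [PiLp.inner_apply, Finset.mul_sum, Finset.mul_sum]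
    refine Finset.sum_congr rfl fun i _ => ?_
    simp only [inner_smul_left, conj_trivial]
    ring
  rw [inner_sub_left, h4]
  unfold trigAction
  rw [h2]
  nlinarith [mul_le_mul_of_nonneg_left h3 pi_pos.le]

theorem norm_le_of_trigGradient (hJ : ∀ x, J (J x) = -x)
    (hJi : ∀ x y, inner ℝ (J x) (J y) = inner ℝ x y) (hk : Function.Injective k)
    {g : E → E} (hg : Continuous g) {S : E →L[ℝ] E} (hSJ : ∀ x, S (J x) = J (S x))
    {κ C : ℝ} (hC : 0 ≤ C)
    (hnr : ∀ (l : ℤ) x, κ * ‖x‖ ≤ ‖(π * l) • x - S x‖) (hκ : 0 < κ)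
    (hgS : ∀ z, ‖g z - (2 : ℝ) • S z‖ ≤ C) (y : PiLp 2 fun _ : ι => E) :
    2 * κ * ‖y‖ ≤ ‖(WithLp.toLp 2 fun i => (2 * π * k i) • y i) -
        trigCoeff J k fun t => g (trigLoop J k y t)‖ + C := by
  have h1 : trigCoeff J k (fun t => g (trigLoop J k y t)) =
      (WithLp.toLp 2 fun i => (2 : ℝ) • S (y i)) +
      trigCoeff J k (fun t => g (trigLoop J k y t) - (2 : ℝ) • S (trigLoop J k y t)) := by
    have h0 := trigCoeff_comp_trigLoop hJ hJi hk ((2 : ℝ) • S) (by simp [hSJ]) y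
    simp only [smul_apply] at h0
    rw [← h0, ← trigCoeff_add (by fun_prop) (by fun_prop)]
    simp
  have h2 : ‖trigCoeff J k (fun t => g (trigLoop J k y t) - (2 : ℝ) • S (trigLoop J k y t))‖ ≤ C :=
    norm_trigCoeff_le hJ hJi hk (by fun_prop) hC fun t => hgS _
  set w := trigCoeff J k (fun t => g (trigLoop J k y t) - (2 : ℝ) • S (trigLoop J k y t))
  have h3 : 2 * κ * ‖y‖ ≤ ‖(WithLp.toLp 2 fun i => (2 : ℝ) • ((π * k i) • y i - S (y i)) :
      PiLp 2 fun _ : ι => E)‖ := by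
    refine (pow_le_pow_iff_left₀ (by positivity) (norm_nonneg _) two_ne_zero).1 ?_
    rw [mul_pow, PiLp.norm_sq_eq_of_L2, PiLp.norm_sq_eq_of_L2, Finset.mul_sum]
    refine Finset.sum_le_sum fun i _ => ?_
    rw [← mul_pow]
    refine pow_le_pow_left₀ (by positivity) ?_ 2
    rw [PiLp.toLp_apply, norm_smul, Real.norm_of_nonneg zero_le_two, mul_assoc]
    gcongr
    exact hnr _ _
  have h4 : (WithLp.toLp 2 fun i => (2 * π * k i) • y i) -
        trigCoeff J k (fun t => g (trigLoop J k y t)) =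
      (WithLp.toLp 2 fun i => (2 : ℝ) • ((π * k i) • y i - S (y i))) - w := by
    rw [h1]
    ext i
    simp only [PiLp.sub_apply, PiLp.add_apply]
    module
  rw [h4]
  have := norm_sub_norm_le (WithLp.toLp 2 fun i => (2 : ℝ) • ((π * k i) • y i - S (y i)) :
      PiLp 2 fun _ : ι => E) w
  linarith

theorem exists_trigAction_critical (hJ : ∀ x, J (J x) = -x)
    (hJi : ∀ x y, inner ℝ (J x) (J y) = inner ℝ x y) (hk : Function.Injective k)
    {i₁ : ι} (hi₁ : k i₁ = 1) {H : E → ℝ} {g : E → E} (hH : Continuous H) (hg : Continuous g)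
    {S : E →L[ℝ] E} {e : E} {L C₁ C₄ M κ c ϵ : ℝ}
    (hH0 : ∀ z, 0 ≤ H z)
    (hdesc : ∀ z b, H z + inner ℝ (g z) b - L * ‖b‖ ^ 2 ≤ H (z + b)) (hL : 0 ≤ L)
    (h4 : ∀ z, H z ≤ C₄ * ‖z‖ ^ 4) (hC₄ : 0 < C₄)
    (hSJ : ∀ x, S (J x) = J (S x)) (hc : 0 < c) (hSc : ∀ x, c * ‖x‖ ^ 2 ≤ inner ℝ (S x) x)
    (hκ : 0 < κ) (hnr : ∀ (l : ℤ) x, κ * ‖x‖ ≤ ‖(π * l) • x - S x‖)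
    (he : ‖e‖ = 1) (hϵ : 0 < ϵ) (hSe : S e = (π + ϵ) • e) (hC₁ : 0 ≤ C₁)
    (hgS : ∀ z, ‖g z - (2 : ℝ) • S z‖ ≤ C₁) (hHS : ∀ z, inner ℝ (S z) z - M ≤ H z) :
    ∃ y : PiLp 2 fun _ : ι => E,
      (∀ i, (2 * π * k i) • y i = trigCoeff J k (fun t => g (trigLoop J k y t)) i) ∧
      π ^ 2 / (16 * C₄) ≤ trigAction J k H y ∧ trigAction J k H y ≤ M := by
  classical
  have hM : 0 ≤ M := by
    have h1 := hHS 0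
    have h2 := h4 0
    simp at h1 h2
    linarith
  let p : (PiLp 2 fun _ : ι => E) → PiLp 2 fun _ : {i // k i ≤ 0} => E :=
    fun y => WithLp.toLp 2 fun i => y i
  let N : (PiLp 2 fun _ : ι => E) → ℝ := fun y => √(∑ i, max (k i : ℝ) 0 * ‖y i‖ ^ 2)
  let j : (PiLp 2 fun _ : {i // k i ≤ 0} => E) × ℝ → PiLp 2 fun _ : ι => E :=
    fun z => WithLp.toLp 2 fun i => if h : k i ≤ 0 then z.1 ⟨i, h⟩ else
      if i = i₁ then z.2 • e else 0
  have hj0 : ∀ z i (h : k i ≤ 0), j z i = z.1 ⟨i, h⟩ := fun z i h => by simp [j, h]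
  have hj1 : ∀ z, j z i₁ = z.2 • e := fun z => by simp [j, hi₁]
  have hj2 : ∀ z i, ¬ k i ≤ 0 → i ≠ i₁ → j z i = 0 := fun z i h h' => by simp [j, h, h']
  have hpc : Continuous p := (PiLp.continuous_toLp 2 _).comp (by fun_prop)
  have hNc : Continuous N := by fun_prop
  have hjc : Continuous j := by
    refine (PiLp.continuous_toLp 2 _).comp (continuous_pi fun i => ?_)
    split_ifs <;> fun_prop
  have hIntg4 : ∀ y : PiLp 2 fun _ : ι => E,
      0 ≤ ∫ t in (0 : ℝ)..1, H (trigLoop J k y t) := fun y =>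
    intervalIntegral.integral_nonneg zero_le_one fun t _ => hH0 _
  set ρ := min c ϵ with hρ
  have hρ0 : 0 < ρ := lt_min hc hϵ
  have hjn : ∀ z, ‖z‖ ≤ ‖j z‖ := by
    intro z
    refine max_le ?_ ?_
    · refine (pow_le_pow_iff_left₀ (norm_nonneg _) (norm_nonneg _) two_ne_zero).1 ?_
      rw [PiLp.norm_sq_eq_of_L2, PiLp.norm_sq_eq_of_L2]
      calc ∑ i, ‖z.1 i‖ ^ 2 = ∑ i : {i // k i ≤ 0}, ‖j z i‖ ^ 2 :=
            Finset.sum_congr rfl fun i _ => by rw [hj0 z i i.2]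
        _ = ∑ i with k i ≤ 0, ‖j z i‖ ^ 2 :=
            (Finset.sum_subtype (Finset.univ.filter fun i => k i ≤ 0) (by simp)
              fun i => ‖j z i‖ ^ 2).symm
        _ ≤ _ := Finset.sum_le_sum_of_subset_of_nonneg (Finset.filter_subset _ _)
            fun _ _ _ => by positivity
    · have := PiLp.norm_apply_le (j z) i₁
      rwa [hj1, norm_smul, he, mul_one] at this
  have hup : ∀ z, trigAction J k H (j z) ≤ M - ρ * ‖j z‖ ^ 2 := by
    intro z
    have h1 : inner ℝ (WithLp.toLp 2 fun i => S (j z i)) (j z) - M ≤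
        ∫ t in (0 : ℝ)..1, H (trigLoop J k (j z) t) := by
      rw [← trigCoeff_comp_trigLoop hJ hJi hk S hSJ, inner_trigCoeff hJ hJi (by fun_prop)]
      have : M = ∫ t in (0 : ℝ)..1, M := by simp
      rw [this, ← intervalIntegral.integral_sub
        (Continuous.intervalIntegrable (by fun_prop) _ _) (by simp)]
      exact intervalIntegral.integral_mono_on zero_le_one
        (Continuous.intervalIntegrable (by fun_prop) _ _)
        (Continuous.intervalIntegrable (by fun_prop) _ _) fun t _ => hHS _
    rw [PiLp.inner_apply] at h1
    have h2 : π * ∑ i, k i * ‖j z i‖ ^ 2 - ∑ i, inner ℝ (S (j z i)) (j z i) ≤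
        -(ρ * ‖j z‖ ^ 2) := by
      rw [PiLp.norm_sq_eq_of_L2, Finset.mul_sum, Finset.mul_sum, ← Finset.sum_neg_distrib,
        ← Finset.sum_sub_distrib]
      refine Finset.sum_le_sum fun i _ => ?_
      by_cases hi : k i ≤ 0
      · have h3 : ρ * ‖j z i‖ ^ 2 ≤ inner ℝ (S (j z i)) (j z i) :=
          (mul_le_mul_of_nonneg_right (min_le_left _ _) (by positivity)).trans (hSc _)
        have h4 : (k i : ℝ) ≤ 0 := by exact_mod_cast hi
        have h5 : π * (k i * ‖j z i‖ ^ 2) ≤ 0 :=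
          mul_nonpos_of_nonneg_of_nonpos pi_pos.le (mul_nonpos_of_nonpos_of_nonneg h4 (by positivity))
        linarith
      · by_cases hi' : i = i₁
        · rw [hi', hj1, hi₁, map_smul, hSe, norm_smul, he, inner_smul_left, inner_smul_right,
            inner_smul_left, real_inner_self_eq_norm_sq, he]
          simp only [conj_trivial, Real.norm_eq_abs, mul_one, sq_abs, Int.cast_one, one_pow]
          have : ρ ≤ ϵ := min_le_right _ _
          nlinarith [sq_nonneg z.2]
        · rw [hj2 z i hi hi']; simp
    simp only at h1
    unfold trigAction
    linarith
  have hlink : ∀ y : PiLp 2 fun _ : ι => E, p y = 0 → N y = √(π / (8 * C₄)) →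
      π ^ 2 / (16 * C₄) ≤ trigAction J k H y := by
    intro y hy hN
    have hy0 : ∀ i, k i ≤ 0 → y i = 0 := fun i hi => by
      have := congrArg (fun u => u.ofLp ⟨i, hi⟩) hy
      simpa [p] using this
    have h1 : ∑ i, k i * ‖y i‖ ^ 2 = π / (8 * C₄) := by
      have h2 : ∑ i, max (k i : ℝ) 0 * ‖y i‖ ^ 2 = ∑ i, k i * ‖y i‖ ^ 2 := by
        refine Finset.sum_congr rfl fun i _ => ?_
        by_cases hi : k i ≤ 0
        · simp [hy0 i hi]
        · rw [max_eq_left]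
          exact_mod_cast (not_le.1 hi).le
      simp only [N, h2] at hN
      rwa [Real.sqrt_inj, ] at hN
      · rw [← h2]; positivity
      · positivity
    have h2 : ∫ t in (0 : ℝ)..1, H (trigLoop J k y t) ≤ C₄ * (4 * (π / (8 * C₄)) ^ 2) := by
      rw [← h1]
      refine le_trans ?_ (mul_le_mul_of_nonneg_left
        (integral_norm_pow_four_trigLoop_le hJ hJi hk y hy0) hC₄.le)
      rw [← intervalIntegral.integral_const_mul]
      exact intervalIntegral.integral_mono_on zero_le_one
        (Continuous.intervalIntegrable (by fun_prop) _ _)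
        (Continuous.intervalIntegrable (by fun_prop) _ _) fun t _ => h4 _
    unfold trigAction
    rw [h1]
    have h3 : π * (π / (8 * C₄)) - C₄ * (4 * (π / (8 * C₄)) ^ 2) = π ^ 2 / (16 * C₄) := by
      field_simp; ring
    linarith
  obtain ⟨y, hy, hβ, hM'⟩ := exists_critical_of_linking
    (F := trigAction (E := E) J k H)
    (G := fun y => (WithLp.toLp 2 fun i => (2 * π * k i) • y i) -
        trigCoeff J k fun t => g (trigLoop J k y t)) (C := π * ∑ i, |(k i : ℝ)| + L + 1)
    (ρ := (1 + C₁) / (2 * κ)) (p := p) (N := N) (j := j) (M := M) (τ := √(M / ρ))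
    (α := √(π / (8 * C₄))) (β := π ^ 2 / (16 * C₄))
    (continuous_trigAction hH) (by
      refine Continuous.sub ?_ (continuous_trigCoeff_comp hg)
      exact (PiLp.continuous_toLp 2 _).comp (by fun_prop)) (by positivity)
    (fun y b => by
      refine (trigAction_add_le hJ hJi hk hH hg hdesc y b).trans ?_
      nlinarith [sq_nonneg ‖b‖])
    (fun y hy => by
      have := norm_le_of_trigGradient hJ hJi hk hg hSJ hC₁ hnr hκ hgS y
      rw [le_div_iff₀ (by positivity)]
      linarith) hpc hNc hjc
    (fun z => by ext i; simp [p, hj0 z i i.2])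
    (fun z hz => by
      simp only [N]
      rw [Finset.sum_eq_single i₁]
      · simp [hj1, hi₁, norm_smul, he, hz, abs_of_nonneg hz]
      · intro i _ hi
        by_cases h : k i ≤ 0
        · rw [max_eq_right (by exact_mod_cast h), zero_mul]
        · simp [hj2 z i h hi]
      · simp)
    (by positivity) (by positivity)
    (fun z _ => (hup z).trans (by have : 0 ≤ ρ * ‖j z‖ ^ 2 := by positivity
                                  linarith))
    (fun z hz => by
      have h1 : ∑ i, k i * ‖j z i‖ ^ 2 ≤ 0 := by
        refine Finset.sum_nonpos fun i _ => ?_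
        by_cases h : k i ≤ 0
        · exact mul_nonpos_of_nonpos_of_nonneg (by exact_mod_cast h) (by positivity)
        · by_cases h' : i = i₁
          · simp [h', hj1, hz]
          · simp [hj2 z i h h']
      have := hIntg4 (j z)
      have := mul_nonpos_of_nonneg_of_nonpos pi_pos.le h1
      unfold trigAction
      linarith)
    (fun z _ hz => by
      have h1 := hup z
      have h2 : √(M / ρ) ≤ ‖j z‖ := hz.trans (hjn z)
      rw [Real.sqrt_le_left (norm_nonneg _), div_le_iff₀ hρ0] at h2
      linarith)
    hlink
  refine ⟨y, fun i => ?_, hβ, hM'⟩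
  have := congrArg (fun u => u.ofLp i) hy
  simpa [sub_eq_zero] using this

end GalerkinCritical

section Truncation

/-- The squared modulus of the `l`-th Fourier coefficient of the indicator function of `[0, t]`. -/
def indicatorFourierSq (t : ℝ) (l : ℤ) : ℝ :=
  if l = 0 then t ^ 2 else (1 - cos (2 * π * l * t)) / (2 * π ^ 2 * (l : ℝ) ^ 2)

theorem sum_indicatorFourierSq (t : ℝ) (K : ℕ) :
    ∑ l ∈ Finset.Icc (-(K : ℤ)) K, indicatorFourierSq t l =
      t ^ 2 + ∑ n ∈ Finset.range (K + 1), (1 - cos (2 * π * n * t)) / (π ^ 2 * (n : ℝ) ^ 2) := by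
  have heven : Function.Even (indicatorFourierSq t) := by
    intro l
    simp [indicatorFourierSq]
  rw [Finset.sum_Icc_of_even_eq_range heven, Finset.sum_range_succ', Finset.sum_range_succ']
  have h1 : ∀ n : ℕ, (1 - cos (2 * π * ((n + 1 : ℕ) : ℝ) * t)) / (π ^ 2 * ((n + 1 : ℕ) : ℝ) ^ 2) =
      2 * indicatorFourierSq t ((n + 1 : ℕ) : ℤ) := by
    intro n
    rw [indicatorFourierSq, if_neg (by omega)]
    have := pi_ne_zero
    push_cast
    field_simp
  rw [Finset.sum_congr rfl fun n _ => h1 n, ← Finset.mul_sum]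
  simp [indicatorFourierSq]
  ring

/-- A uniform bound for the tail of the Fourier series of indicator functions of intervals. -/
def fourierTail (K : ℕ) : ℝ := ∑' n : ℕ, 2 / π ^ 2 * (1 / ((n + (K + 1) : ℕ) : ℝ) ^ 2)

theorem summable_const_mul_inv_sq : Summable fun n : ℕ => 2 / π ^ 2 * (1 / (n : ℝ) ^ 2) :=
  (Real.summable_one_div_nat_pow.2 one_lt_two).mul_left _

theorem tendsto_fourierTail : Tendsto fourierTail atTop (𝓝 0) :=
  (tendsto_sum_nat_add fun n : ℕ => 2 / π ^ 2 * (1 / (n : ℝ) ^ 2)).comp (tendsto_add_atTop_nat 1)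

theorem fourierTail_pos (K : ℕ) : 0 < fourierTail K := by
  refine Summable.tsum_pos ((summable_nat_add_iff (K + 1)).2 summable_const_mul_inv_sq)
    (fun n => by positivity) 0 ?_
  have : (0 : ℝ) < ((0 + (K + 1) : ℕ) : ℝ) := by positivity
  positivity

theorem sub_sum_indicatorFourierSq_le {t : ℝ} (ht : t ∈ Icc (0 : ℝ) 1) (K : ℕ) :
    t - ∑ l ∈ Finset.Icc (-(K : ℤ)) K, indicatorFourierSq t l ≤ fourierTail K := by
  have h0 := hasSum_one_div_nat_pow_mul_cos one_ne_zero (x := 0) (by simp)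
  have h1 := hasSum_one_div_nat_pow_mul_cos one_ne_zero ht
  have h2 : HasSum (fun n : ℕ => (1 - cos (2 * π * n * t)) / (π ^ 2 * (n : ℝ) ^ 2)) (t - t ^ 2) := by
    convert! (h0.sub h1).mul_left (π ^ 2)⁻¹ using 1
    · ext n
      simp
      ring
    · have hB : ∀ x : ℝ, (Polynomial.map (algebraMap ℚ ℝ) (Polynomial.bernoulli (2 * 1))).eval x =
          x ^ 2 - x + 1 / 6 := by
        intro x
        simp [Polynomial.bernoulli, Finset.sum_range_succ, Nat.choose]
        ring
      rw [hB, hB]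
      simp
      field_simp
      ring
  rw [sum_indicatorFourierSq]
  have h3 := h2.summable.sum_add_tsum_nat_add (K + 1)
  rw [h2.tsum_eq] at h3
  have h4 : ∑' n : ℕ, (1 - cos (2 * π * ((n + (K + 1) : ℕ) : ℝ) * t)) /
      (π ^ 2 * ((n + (K + 1) : ℕ) : ℝ) ^ 2) ≤ fourierTail K := by
    have s1 := (summable_nat_add_iff (K + 1)).2 h2.summable
    have s2 := (summable_nat_add_iff (K + 1)).2 summable_const_mul_inv_sq
    unfold fourierTail
    refine Summable.tsum_le_tsum (fun n => ?_) s1 s2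
    have : (0 : ℝ) < ((n + (K + 1) : ℕ) : ℝ) := by positivity
    rw [div_mul_div_comm, mul_one]
    have := neg_one_le_cos (2 * π * ((n + (K + 1) : ℕ) : ℝ) * t)
    gcongr
    linarith
  linarith

variable {E : Type*} [NormedAddCommGroup E] [InnerProductSpace ℝ E] [FiniteDimensional ℝ E]
  {J : E →L[ℝ] E}

theorem norm_sq_integral_rot (hJ : ∀ x, J (J x) = -x)
    (hJi : ∀ x y, inner ℝ (J x) (J y) = inner ℝ x y) (l : ℤ) (t : ℝ) (v : E) :
    ‖∫ s in (0 : ℝ)..t, rot J (-(2 * π * l * s)) v‖ ^ 2 = indicatorFourierSq t l * ‖v‖ ^ 2 := by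
  have h1 : ∫ s in (0 : ℝ)..t, rot J (-(2 * π * l * s)) v =
      (∫ s in (0 : ℝ)..t, cos (2 * π * l * s)) • v -
        (∫ s in (0 : ℝ)..t, sin (2 * π * l * s)) • J v := by
    rw [← intervalIntegral.integral_smul_const, ← intervalIntegral.integral_smul_const,
      ← intervalIntegral.integral_sub (Continuous.intervalIntegrable (by fun_prop) _ _)
      (Continuous.intervalIntegrable (by fun_prop) _ _)]
    refine intervalIntegral.integral_congr fun s _ => ?_
    simp [rot_apply, sub_eq_add_neg]
  have h2 : ∀ a b : ℝ, ‖a • v - b • J v‖ ^ 2 = (a ^ 2 + b ^ 2) * ‖v‖ ^ 2 := by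
    intro a b
    rw [norm_sub_sq_real, norm_smul, norm_smul, norm_J hJi, inner_smul_left, inner_smul_right,
      real_inner_comm, inner_J_self hJ hJi]
    simp only [mul_pow, Real.norm_eq_abs, sq_abs]
    simp
    ring
  rw [h1, h2, indicatorFourierSq]
  congr 1
  split_ifs with h
  · simp [h]
  · have hl : (l : ℝ) ≠ 0 := by exact_mod_cast h
    have hd : (2 * π * l : ℝ) ≠ 0 := by
      have := pi_ne_zero
      positivity
    rw [intervalIntegral.integral_comp_mul_left (fun x => cos x) hd,
      intervalIntegral.integral_comp_mul_left (fun x => sin x) hd]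
    simp only [mul_zero, integral_cos, sin_zero, sub_zero, integral_sin, cos_zero, smul_eq_mul,
      mul_pow]
    have h3 := sin_sq_add_cos_sq (2 * π * l * t)
    have := pi_ne_zero
    rw [← mul_add, show sin (2 * π * l * t) ^ 2 + (1 - cos (2 * π * l * t)) ^ 2 =
      2 * (1 - cos (2 * π * l * t)) by linear_combination h3]
    field_simp

/-- The error of a Fourier truncation is small after integration over intervals. -/
theorem norm_integral_sub_truncation_le (hJ : ∀ x, J (J x) = -x)
    (hJi : ∀ x y, inner ℝ (J x) (J y) = inner ℝ x y) (K : ℕ) {w : ℝ → E} (hw : Continuous w)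
    {t : ℝ} (ht : t ∈ Icc (0 : ℝ) 1) :
    ‖∫ s in (0 : ℝ)..t, (w s - trigLoop J (fun i : Finset.Icc (-(K : ℤ)) K => (i : ℤ))
      (trigCoeff J (fun i : Finset.Icc (-(K : ℤ)) K => (i : ℤ)) w) s)‖ ^ 2 ≤
      fourierTail K * ∫ s in (0 : ℝ)..1, ‖w s‖ ^ 2 := by
  set k : Finset.Icc (-(K : ℤ)) K → ℤ := fun i => (i : ℤ) with hkdef
  have hk : Function.Injective k := Subtype.val_injective
  set c := trigCoeff J k w with hc
  set v := ∫ s in (0 : ℝ)..t, (w s - trigLoop J k c s) with hv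
  let b : PiLp 2 fun _ : Finset.Icc (-(K : ℤ)) K => E :=
    WithLp.toLp 2 fun i => ∫ s in (0 : ℝ)..t, rot J (-(2 * π * k i * s)) v
  have ii : ∀ {f : ℝ → ℝ} (hf : Continuous f) (p q : ℝ), IntervalIntegrable f volume p q :=
    fun hf p q => hf.intervalIntegrable p q
  have hbT : ∀ y : PiLp 2 fun _ : Finset.Icc (-(K : ℤ)) K => E,
      ∫ s in (0 : ℝ)..t, inner ℝ (trigLoop J k y s) v = inner ℝ y b := by
    intro y
    simp only [trigLoop, sum_inner, PiLp.inner_apply, b]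
    rw [intervalIntegral.integral_finsetSum fun i _ => ii (by fun_prop) _ _]
    refine Finset.sum_congr rfl fun i _ => ?_
    rw [← innerSL_apply_apply ℝ, ← ContinuousLinearMap.intervalIntegral_comp_comm]
    · refine intervalIntegral.integral_congr fun s _ => ?_
      simp only [innerSL_apply_apply]
      rw [inner_rot_left hJ hJi]
    · refine Continuous.intervalIntegrable ?_ _ _
      fun_prop
  have hbn : ‖b‖ ^ 2 = (∑ l ∈ Finset.Icc (-(K : ℤ)) K, indicatorFourierSq t l) * ‖v‖ ^ 2 := by
    rw [PiLp.norm_sq_eq_of_L2, Finset.sum_mul]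
    exact (Finset.sum_congr rfl fun i _ => norm_sq_integral_rot hJ hJi (k i) t v).trans
      (Finset.sum_coe_sort _ fun l => indicatorFourierSq t l * ‖v‖ ^ 2)
  have hv2 : ‖v‖ ^ 2 = (∫ s in (0 : ℝ)..t, inner ℝ (w s) (v - trigLoop J k b s)) +
      ∫ s in t..1, inner ℝ (w s) (-trigLoop J k b s) := by
    have h1 : ‖v‖ ^ 2 = ∫ s in (0 : ℝ)..t, inner ℝ (w s - trigLoop J k c s) v := by
      rw [← real_inner_self_eq_norm_sq]
      conv_lhs => rw [hv, real_inner_comm, ← innerSL_apply_apply ℝ,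
        ← ContinuousLinearMap.intervalIntegral_comp_comm _
          (Continuous.intervalIntegrable (by fun_prop) _ _)]
      refine intervalIntegral.integral_congr fun s _ => ?_
      simp only [innerSL_apply_apply]
      rw [real_inner_comm]
    have h2 : inner ℝ c b = (∫ s in (0 : ℝ)..t, inner ℝ (w s) (trigLoop J k b s)) +
        ∫ s in t..1, inner ℝ (w s) (trigLoop J k b s) := by
      rw [hc, inner_trigCoeff hJ hJi hw, intervalIntegral.integral_add_adjacent_intervals
        (ii (by fun_prop) _ _) (ii (by fun_prop) _ _)]
    rw [h1]
    simp only [inner_sub_left, inner_sub_right, inner_neg_right]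
    rw [intervalIntegral.integral_sub (ii (by fun_prop) _ _) (ii (by fun_prop) _ _),
      intervalIntegral.integral_sub (ii (by fun_prop) _ _) (ii (by fun_prop) _ _),
      intervalIntegral.integral_neg, hbT, h2]
    ring
  have hq : (∫ s in (0 : ℝ)..t, ‖v - trigLoop J k b s‖ ^ 2) +
      ∫ s in t..1, ‖-trigLoop J k b s‖ ^ 2 ≤ fourierTail K * ‖v‖ ^ 2 := by
    have h1 := integral_norm_sq_trigLoop hJ hJi hk b
    rw [← intervalIntegral.integral_add_adjacent_intervals
        (ii (by fun_prop) 0 t) (ii (by fun_prop) t 1)] at h1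
    have h2 : ∫ s in (0 : ℝ)..t, ‖v - trigLoop J k b s‖ ^ 2 =
        t * ‖v‖ ^ 2 - 2 * ‖b‖ ^ 2 + ∫ s in (0 : ℝ)..t, ‖trigLoop J k b s‖ ^ 2 := by
      have h3 := hbT b
      rw [real_inner_self_eq_norm_sq] at h3
      simp only [norm_sub_sq_real]
      rw [intervalIntegral.integral_add (ii (by fun_prop) _ _) (ii (by fun_prop) _ _),
        intervalIntegral.integral_sub (ii (by fun_prop) _ _) (ii (by fun_prop) _ _),
        intervalIntegral.integral_const_mul, ← h3]
      simp [real_inner_comm]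
    simp only [norm_neg]
    have h4 := sub_sum_indicatorFourierSq_le ht K
    have h5 := mul_le_mul_of_nonneg_right h4 (sq_nonneg ‖v‖)
    rw [h2]
    linarith
  have hδ := fourierTail_pos K
  have hpt : ∀ x y : E, inner ℝ x y ≤
      fourierTail K / 2 * ‖x‖ ^ 2 + (2 * fourierTail K)⁻¹ * ‖y‖ ^ 2 := by
    intro x y
    have h1 := real_inner_le_norm x y
    have h2 : fourierTail K / 2 * ‖x‖ ^ 2 + (2 * fourierTail K)⁻¹ * ‖y‖ ^ 2 - ‖x‖ * ‖y‖ =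
        (fourierTail K * ‖x‖ - ‖y‖) ^ 2 / (2 * fourierTail K) := by
      field_simp; ring
    have h3 : 0 ≤ (fourierTail K * ‖x‖ - ‖y‖) ^ 2 / (2 * fourierTail K) := by positivity
    linarith
  have hA : ∀ (p q : ℝ) (_ : p ≤ q) (f : ℝ → E) (_ : Continuous f),
      ∫ s in p..q, inner ℝ (w s) (f s) ≤ fourierTail K / 2 * (∫ s in p..q, ‖w s‖ ^ 2) +
        (2 * fourierTail K)⁻¹ * ∫ s in p..q, ‖f s‖ ^ 2 := by
    intro p q hpq f hf
    rw [← intervalIntegral.integral_const_mul, ← intervalIntegral.integral_const_mul,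
      ← intervalIntegral.integral_add (ii (by fun_prop) _ _) (ii (by fun_prop) _ _)]
    exact intervalIntegral.integral_mono_on hpq (ii (by fun_prop) _ _) (ii (by fun_prop) _ _)
      fun s _ => hpt _ _
  have hA1 := hA 0 t ht.1 (fun s => v - trigLoop J k b s) (by fun_prop)
  have hA2 := hA t 1 ht.2 (fun s => -trigLoop J k b s) (by fun_prop)
  rw [← intervalIntegral.integral_add_adjacent_intervals
        (ii (by fun_prop) 0 t) (ii (by fun_prop) t 1)]
  have h6 := mul_le_mul_of_nonneg_left hq (by positivity : 0 ≤ (2 * fourierTail K)⁻¹)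
  rw [show (2 * fourierTail K)⁻¹ * (fourierTail K * ‖v‖ ^ 2) = ‖v‖ ^ 2 / 2 by field_simp] at h6

  linarith

end Truncation

section ApproximateOrbits

variable {E : Type*} [NormedAddCommGroup E] [NormedSpace ℝ E] [FiniteDimensional ℝ E]

/-- Bounded approximate solutions of an autonomous Lipschitz ODE subconverge to a solution. -/
theorem exists_limit_of_approx_solutions {f : E → E} {L : NNReal} (hf : LipschitzWith L f)
    {x : ℕ → ℝ → E} (hx : ∀ j, Continuous (x j)) {R : ℝ}
    (hR : ∀ j, ∀ t ∈ Icc (0 : ℝ) 1, ‖x j t‖ ≤ R) {ε : ℕ → ℝ} (hε : Tendsto ε atTop (𝓝 0))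
    (hxε : ∀ j, ∀ t ∈ Icc (0 : ℝ) 1, ‖x j t - x j 0 - ∫ s in (0 : ℝ)..t, f (x j s)‖ ≤ ε j) :
    ∃ (σ : ℕ → ℕ) (z : ℝ → E), StrictMono σ ∧
      (∀ t ∈ Icc (0 : ℝ) 1, Tendsto (fun j => x (σ j) t) atTop (𝓝 (z t))) ∧
      ∀ t ∈ Icc (0 : ℝ) 1, HasDerivWithinAt z (f (z t)) (Icc 0 1) t := by
  have h0mem : (0 : ℝ) ∈ Icc (0 : ℝ) 1 := ⟨le_rfl, zero_le_one⟩
  obtain ⟨p, -, σ, hσ, hp⟩ := (isCompact_closedBall (0 : E) R).tendsto_subseq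
    (x := fun j => x j 0) (fun j => by simpa using hR j 0 h0mem)
  have hfc := hf.continuous
  let u : ℕ → ℝ → E := fun j t => x (σ j) 0 + ∫ s in (0 : ℝ)..t, f (x (σ j) s)
  have hfx : ∀ j, Continuous fun s => f (x (σ j) s) := fun j => hfc.comp (hx _)
  have hu' : ∀ j t, HasDerivAt (u j) (f (x (σ j) t)) t := fun j t =>
    ((hfx j).integral_hasStrictDerivAt 0 t).hasDerivAt.const_add _
  have huc : ∀ j, Continuous (u j) := fun j =>
    continuous_iff_continuousAt.2 fun t => (hu' j t).continuousAt
  have hxu : ∀ j, ∀ t ∈ Icc (0 : ℝ) 1, dist (x (σ j) t) (u j t) ≤ ε (σ j) := by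
    intro j t ht
    rw [dist_eq_norm, ← sub_sub]
    exact hxε _ t ht
  have hεσ : Tendsto (fun j => ε (σ j)) atTop (𝓝 0) := hε.comp hσ.tendsto_atTop
  have hε0 : ∀ j, 0 ≤ ε (σ j) := fun j => dist_nonneg.trans (hxu j 0 h0mem)
  have hgron : ∀ i j, ∀ t ∈ Icc (0 : ℝ) 1, dist (u i t) (u j t) ≤
      exp (L + 1) * (dist (x (σ i) 0) (x (σ j) 0) + ε (σ i) + ε (σ j)) := by
    intro i j t ht
    have hf1 : LipschitzWith (L + 1) f := hf.weaken (by simp)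
    have hb : ∀ j, ∀ t ∈ Ico (0 : ℝ) 1,
        dist (f (x (σ j) t)) (f (u j t)) ≤ (L + 1 : NNReal) * ε (σ j) :=
      fun j t ht => (hf1.dist_le_mul _ _).trans
        (mul_le_mul_of_nonneg_left (hxu j t (Ico_subset_Icc_self ht)) NNReal.zero_le_coe)
    refine (dist_le_of_approx_trajectories_ODE (v := fun _ => f) (fun _ => hf1)
      (huc i).continuousOn (fun t _ => (hu' i t).hasDerivWithinAt) (hb i)
      (huc j).continuousOn (fun t _ => (hu' j t).hasDerivWithinAt) (hb j)
      (δ := dist (x (σ i) 0) (x (σ j) 0)) (by simp [u]) t ht).trans ?_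
    have hL : (((L + 1 : NNReal) : ℝ)) ≠ 0 := by positivity
    rw [gronwallBound_of_K_ne_0 hL, ← mul_add, mul_div_cancel_left₀ _ hL]
    have h1 : exp ((L + 1 : NNReal) * (t - 0)) ≤ exp (L + 1) := by
      rw [exp_le_exp]
      have := ht.2
      have : (0 : ℝ) ≤ L := L.2
      push_cast
      nlinarith
    have := hε0 i
    have := hε0 j
    have : 0 ≤ dist (x (σ i) 0) (x (σ j) 0) := dist_nonneg
    nlinarith
  set a : ℕ → ℝ := fun j => dist (x (σ j) 0) p + ε (σ j) with ha
  have ha0 : Tendsto a atTop (𝓝 0) := by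
    have h1 : Tendsto (fun j => dist (x (σ j) 0) p) atTop (𝓝 0) :=
      tendsto_iff_dist_tendsto_zero.1 hp
    simpa using h1.add hεσ
  have hcau : ∀ i j, ∀ t ∈ Icc (0 : ℝ) 1, dist (u i t) (u j t) ≤ exp (L + 1) * (a i + a j) := by
    intro i j t ht
    refine (hgron i j t ht).trans (mul_le_mul_of_nonneg_left ?_ (exp_pos _).le)
    have := dist_triangle_right (x (σ i) 0) (x (σ j) 0) p
    simp only [ha]
    linarith
  have hUC : UniformCauchySeqOn u atTop (Icc 0 1) := by
    rw [Metric.uniformCauchySeqOn_iff]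
    intro η hη
    have h1 : Tendsto (fun j => exp (L + 1) * a j) atTop (𝓝 0) := by
      simpa using ha0.const_mul (exp (L + 1))
    obtain ⟨n, hn⟩ := eventually_atTop.1 (h1.eventually (gt_mem_nhds (half_pos hη)))
    refine ⟨n, fun i hi j hj t ht => (hcau i j t ht).trans_lt ?_⟩
    linarith [hn i hi, hn j hj]
  have hex : ∀ t, ∃ w, t ∈ Icc (0 : ℝ) 1 → Tendsto (fun j => u j t) atTop (𝓝 w) := by
    intro t
    by_cases ht : t ∈ Icc (0 : ℝ) 1
    · obtain ⟨w, hw⟩ := cauchySeq_tendsto_of_complete (hUC.cauchySeq ht)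
      exact ⟨w, fun _ => hw⟩
    · exact ⟨0, fun h => absurd h ht⟩
  choose w hw using hex
  have hwc : ContinuousOn w (Icc 0 1) :=
    (hUC.tendstoUniformlyOn_of_tendsto hw).continuousOn
      (Frequently.of_forall fun j => (huc j).continuousOn)
  have hxw : ∀ t ∈ Icc (0 : ℝ) 1, Tendsto (fun j => x (σ j) t) atTop (𝓝 (w t)) := by
    intro t ht
    refine (tendsto_iff_of_dist ?_).2 (hw t ht)
    exact squeeze_zero (fun _ => dist_nonneg) (fun j => hxu j t ht) hεσ
  let wc : ℝ → E := fun t => w (projIcc 0 1 zero_le_one t)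
  have hwcc : Continuous wc := hwc.comp_continuous
    (continuous_subtype_val.comp continuous_projIcc) fun t => (projIcc 0 1 zero_le_one t).2
  have hwcw : ∀ t ∈ Icc (0 : ℝ) 1, wc t = w t := fun t ht => by
    simp only [wc]
    rw [projIcc_of_mem _ ht]
  let z : ℝ → E := fun t => p + ∫ s in (0 : ℝ)..t, f (wc s)
  have hzw : ∀ t ∈ Icc (0 : ℝ) 1, z t = w t := by
    intro t ht
    refine tendsto_nhds_unique ?_ (hw t ht)
    refine Tendsto.add hp ?_
    refine intervalIntegral.tendsto_integral_filter_of_dominated_convergence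
      (fun _ => ‖f 0‖ + L * R) (Eventually.of_forall fun j => (hfx j).aestronglyMeasurable)
      (Eventually.of_forall fun j => ae_of_all _ fun s hs => ?_) (by simp)
      (ae_of_all _ fun s hs => ?_)
    · rw [uIoc_of_le ht.1] at hs
      have h1 := hf.dist_le_mul (x (σ j) s) 0
      rw [dist_zero_right] at h1
      have h2 := hR (σ j) s ⟨hs.1.le, hs.2.trans ht.2⟩
      have h3 := norm_le_norm_add_norm_sub' (f (x (σ j) s)) (f 0)
      rw [← dist_eq_norm] at h3
      have h4 : (L : ℝ) * ‖x (σ j) s‖ ≤ L * R := mul_le_mul_of_nonneg_left h2 L.2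
      linarith
    · rw [uIoc_of_le ht.1] at hs
      have hs' : s ∈ Icc (0 : ℝ) 1 := ⟨hs.1.le, hs.2.trans ht.2⟩
      rw [hwcw s hs']
      exact (hfc.tendsto _).comp (hxw s hs')
  refine ⟨σ, z, hσ, fun t ht => by rw [hzw t ht]; exact hxw t ht, fun t ht => ?_⟩
  rw [hzw t ht, ← hwcw t ht]
  exact ((hfc.comp hwcc).integral_hasStrictDerivAt 0 t).hasDerivAt.const_add p |>.hasDerivWithinAt

end ApproximateOrbits

section PeriodicOrbit

variable {E : Type*} [NormedAddCommGroup E] [InnerProductSpace ℝ E] {J : E →L[ℝ] E}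

section Loops

variable {ι : Type*} [Fintype ι] {k : ι → ℤ}

theorem hasDerivAt_trigLoop (hJ : ∀ x, J (J x) = -x) (y : PiLp 2 fun _ : ι => E) (t : ℝ) :
    HasDerivAt (trigLoop J k y)
      (J (trigLoop J k (WithLp.toLp 2 fun i => (2 * π * k i) • y i) t)) t := by
  have h : ∀ i, HasDerivAt (fun t => rot J (2 * π * k i * t) (y i))
      (J (rot J (2 * π * k i * t) ((2 * π * k i) • y i))) t := fun i => by
    refine ((hasDerivAt_rot hJ (2 * π * k i * t) (y i)).scomp t
      ((hasDerivAt_id t).const_mul (2 * π * k i))).congr_deriv ?_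
    simp
  refine (HasDerivAt.fun_sum fun i (_ : i ∈ Finset.univ) => h i).congr_deriv ?_
  simp [trigLoop]

variable [CompleteSpace E]

theorem norm_sq_trigCoeff_le (hJ : ∀ x, J (J x) = -x)
    (hJi : ∀ x y, inner ℝ (J x) (J y) = inner ℝ x y) (hk : Function.Injective k)
    {w : ℝ → E} (hw : Continuous w) :
    ‖trigCoeff J k w‖ ^ 2 ≤ ∫ t in (0 : ℝ)..1, ‖w t‖ ^ 2 := by
  have h1 := inner_trigCoeff hJ hJi (k := k) hw (trigCoeff J k w)
  rw [real_inner_self_eq_norm_sq] at h1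
  have h2 : ∫ t in (0 : ℝ)..1, inner ℝ (w t) (trigLoop J k (trigCoeff J k w) t) ≤
      ∫ t in (0 : ℝ)..1, (2⁻¹ * ‖w t‖ ^ 2 + 2⁻¹ * ‖trigLoop J k (trigCoeff J k w) t‖ ^ 2) := by
    refine intervalIntegral.integral_mono_on zero_le_one
      (Continuous.intervalIntegrable (by fun_prop) _ _)
      (Continuous.intervalIntegrable (by fun_prop) _ _) fun t _ => ?_
    nlinarith [real_inner_le_norm (w t) (trigLoop J k (trigCoeff J k w) t),
      sq_nonneg (‖w t‖ - ‖trigLoop J k (trigCoeff J k w) t‖)]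
  rw [intervalIntegral.integral_add (Continuous.intervalIntegrable (by fun_prop) _ _)
    (Continuous.intervalIntegrable (by fun_prop) _ _), intervalIntegral.integral_const_mul,
    intervalIntegral.integral_const_mul, integral_norm_sq_trigLoop hJ hJi hk] at h2
  linarith

theorem norm_trigLoop_le (hJ : ∀ x, J (J x) = -x)
    (hJi : ∀ x y, inner ℝ (J x) (J y) = inner ℝ x y) (hk : Function.Injective k)
    (y : PiLp 2 fun _ : ι => E) {t : ℝ} (ht : t ∈ Icc (0 : ℝ) 1) :
    ‖trigLoop J k y t‖ ≤ ‖y‖ +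
      ‖(WithLp.toLp 2 fun i => (2 * π * k i) • y i : PiLp 2 fun _ : ι => E)‖ := by
  set c : PiLp 2 fun _ : ι => E := WithLp.toLp 2 fun i => (2 * π * k i) • y i
  have h1 : ∀ s ∈ Icc (0 : ℝ) 1, ‖trigLoop J k y t‖ ≤ ‖trigLoop J k y s‖ + ‖c‖ := by
    intro s hs
    have h2 : ∫ u in s..t, J (trigLoop J k c u) = trigLoop J k y t - trigLoop J k y s :=
      intervalIntegral.integral_eq_sub_of_hasDerivAt (fun u _ => hasDerivAt_trigLoop hJ y u)
        (Continuous.intervalIntegrable (by fun_prop) _ _)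
    have h3 : ‖∫ u in s..t, J (trigLoop J k c u)‖ ≤ ∫ u in (0 : ℝ)..1, ‖trigLoop J k c u‖ := by
      refine (intervalIntegral.norm_integral_le_abs_integral_norm).trans ?_
      simp only [norm_J hJi]
      rw [intervalIntegral.abs_integral_eq_abs_integral_uIoc,
        abs_of_nonneg (setIntegral_nonneg measurableSet_uIoc fun _ _ => norm_nonneg _),
        intervalIntegral.integral_of_le zero_le_one]
      refine setIntegral_mono_set ?_ (Eventually.of_forall fun _ => norm_nonneg _)
        (LE.le.eventuallyLE ?_)
      · exact ((continuous_trigLoop c).norm.intervalIntegrable 0 1).1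
      · exact Ioc_subset_Ioc (le_min hs.1 ht.1) (max_le hs.2 ht.2)
    have h4 := h3.trans (integral_norm_trigLoop_le hJ hJi hk c)
    rw [h2] at h4
    have := norm_le_insert' (trigLoop J k y t) (trigLoop J k y s)
    linarith
  have h2 := intervalIntegral.integral_mono_on (μ := volume) zero_le_one
    (f := fun _ => ‖trigLoop J k y t‖) (g := fun s => ‖trigLoop J k y s‖ + ‖c‖)
    (Continuous.intervalIntegrable (by fun_prop) _ _)
    (Continuous.intervalIntegrable (by fun_prop) _ _) h1
  rw [intervalIntegral.integral_add (Continuous.intervalIntegrable (by fun_prop) _ _)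
    (Continuous.intervalIntegrable (by fun_prop) _ _)] at h2
  simp only [intervalIntegral.integral_const, sub_zero, one_smul] at h2
  have := integral_norm_trigLoop_le hJ hJi hk y
  linarith

theorem trigAction_of_critical (hJ : ∀ x, J (J x) = -x)
    {H : E → ℝ} {g : E → E} (hH : Continuous H) (hg : Continuous g) (y : PiLp 2 fun _ : ι => E)
    (hy : ∀ i, (2 * π * k i) • y i = trigCoeff J k (fun t => g (trigLoop J k y t)) i)
    (hJi : ∀ x y, inner ℝ (J x) (J y) = inner ℝ x y) :
    trigAction J k H y = ∫ t in (0 : ℝ)..1,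
      (2⁻¹ * inner ℝ (g (trigLoop J k y t)) (trigLoop J k y t) - H (trigLoop J k y t)) := by
  rw [intervalIntegral.integral_sub (Continuous.intervalIntegrable (by fun_prop) _ _)
    (Continuous.intervalIntegrable (by fun_prop) _ _), intervalIntegral.integral_const_mul,
    ← inner_trigCoeff hJ hJi (by fun_prop), trigAction, PiLp.inner_apply]
  congr 1
  simp only [← hy, inner_smul_left, real_inner_self_eq_norm_sq, Finset.mul_sum]
  refine Finset.sum_congr rfl fun i _ => ?_
  simp
  ring

end Loops

variable [FiniteDimensional ℝ E]

/-- Existence of a `1`-periodic orbit of positive action for a Hamiltonian which is flat near the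
origin and asymptotic to a non-resonant quadratic form whose first frequency exceeds `π`. -/
theorem exists_periodic_orbit (hJ : ∀ x, J (J x) = -x)
    (hJi : ∀ x y, inner ℝ (J x) (J y) = inner ℝ x y) {H : E → ℝ} {g : E → E} (hH : Continuous H)
    {G : NNReal} (hg : LipschitzWith G g)
    {S : E →L[ℝ] E} {e : E} {L C₁ C₄ M κ c ϵ : ℝ}
    (hH0 : ∀ z, 0 ≤ H z)
    (hdesc : ∀ z b, H z + inner ℝ (g z) b - L * ‖b‖ ^ 2 ≤ H (z + b)) (hL : 0 ≤ L)
    (h4 : ∀ z, H z ≤ C₄ * ‖z‖ ^ 4) (hC₄ : 0 < C₄)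
    (hSJ : ∀ x, S (J x) = J (S x)) (hc : 0 < c) (hSc : ∀ x, c * ‖x‖ ^ 2 ≤ inner ℝ (S x) x)
    (hκ : 0 < κ) (hnr : ∀ (l : ℤ) x, κ * ‖x‖ ≤ ‖(π * l) • x - S x‖)
    (he : ‖e‖ = 1) (hϵ : 0 < ϵ) (hSe : S e = (π + ϵ) • e) (hC₁ : 0 ≤ C₁)
    (hgS : ∀ z, ‖g z - (2 : ℝ) • S z‖ ≤ C₁) (hHS : ∀ z, inner ℝ (S z) z - M ≤ H z) :
    ∃ z : ℝ → E, (∀ t ∈ Icc (0 : ℝ) 1, HasDerivWithinAt z (J (g (z t))) (Icc 0 1) t) ∧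
      z 1 = z 0 ∧ 0 < ∫ t in (0 : ℝ)..1, (2⁻¹ * inner ℝ (g (z t)) (z t) - H (z t)) ∧
      ∫ t in (0 : ℝ)..1, (2⁻¹ * inner ℝ (g (z t)) (z t) - H (z t)) ≤ M := by
  have hgc : Continuous g := hg.continuous
  let k : ∀ K : ℕ, Finset.Icc (-((K + 1 : ℕ) : ℤ)) (K + 1 : ℕ) → ℤ := fun K i => (i : ℤ)
  have hk : ∀ K, Function.Injective (k K) := fun K => Subtype.val_injective
  have key := fun K : ℕ => exists_trigAction_critical (k := k K) hJ hJi (hk K)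
    (i₁ := ⟨1, by simp; omega⟩) rfl hH hgc hH0 hdesc hL h4 hC₄ hSJ hc hSc hκ hnr he hϵ hSe hC₁
    hgS hHS
  choose y hy hy1 hy2 using key
  set B := C₁ / (2 * κ) with hB
  set V := 8 * ‖S‖ ^ 2 * B ^ 2 + 2 * C₁ ^ 2 with hV
  let x : ℕ → ℝ → E := fun K => trigLoop J (k K) (y K)
  have hxc : ∀ K, Continuous (x K) := fun K => continuous_trigLoop _
  have hyc : ∀ K, (WithLp.toLp 2 fun i => (2 * π * k K i) • y K i) =
      trigCoeff J (k K) fun t => g (x K t) := fun K => by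
    ext i; exact hy K i
  have hyB : ∀ K, ‖y K‖ ≤ B := fun K => by
    have := norm_le_of_trigGradient hJ hJi (hk K) hgc hSJ hC₁ hnr hκ hgS (y K)
    have h0 := hyc K
    simp only [x] at h0
    rw [h0, sub_self, norm_zero, zero_add] at this
    rw [hB, le_div_iff₀ (by positivity)]
    linarith
  have hB0 : 0 ≤ B := by positivity
  have hV0 : 0 ≤ V := by positivity
  have hw : ∀ K, ∫ t in (0 : ℝ)..1, ‖g (x K t)‖ ^ 2 ≤ V := fun K => by
    have h1 : ∫ t in (0 : ℝ)..1, ‖g (x K t)‖ ^ 2 ≤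
        ∫ t in (0 : ℝ)..1, (8 * ‖S‖ ^ 2 * ‖x K t‖ ^ 2 + 2 * C₁ ^ 2) := by
      refine intervalIntegral.integral_mono_on zero_le_one
        (Continuous.intervalIntegrable (by fun_prop) _ _)
        (Continuous.intervalIntegrable (by fun_prop) _ _) fun t _ => ?_
      have h2 : ‖g (x K t)‖ ≤ 2 * (‖S‖ * ‖x K t‖) + C₁ := by
        have h3 := norm_le_insert' (g (x K t)) ((2 : ℝ) • S (x K t))
        have h4 := hgS (x K t)
        rw [norm_smul, Real.norm_of_nonneg zero_le_two] at h3
        have h5 := S.le_opNorm (x K t)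
        linarith
      have h3 := pow_le_pow_left₀ (norm_nonneg _) h2 2
      nlinarith [sq_nonneg (2 * (‖S‖ * ‖x K t‖) - C₁)]
    rw [intervalIntegral.integral_add (Continuous.intervalIntegrable (by fun_prop) _ _)
      (Continuous.intervalIntegrable (by fun_prop) _ _), intervalIntegral.integral_const_mul,
      integral_norm_sq_trigLoop hJ hJi (hk K)] at h1
    simp only [intervalIntegral.integral_const, sub_zero, one_smul] at h1
    refine h1.trans ?_
    rw [hV]
    gcongr
    exact hyB K
  have hcV : ∀ K, ‖trigCoeff J (k K) fun t => g (x K t)‖ ≤ √V := fun K =>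
    Real.le_sqrt_of_sq_le
      ((norm_sq_trigCoeff_le hJ hJi (hk K) (hgc.comp (hxc K))).trans (hw K))
  have hxR : ∀ K, ∀ t ∈ Icc (0 : ℝ) 1, ‖x K t‖ ≤ B + √V := fun K t ht => by
    have h1 := norm_trigLoop_le hJ hJi (hk K) (y K) ht
    rw [hyc K] at h1
    exact h1.trans (add_le_add (hyB K) (hcV K))
  have hJl : LipschitzWith 1 J := by
    refine LipschitzWith.of_dist_le_mul fun a b => ?_
    rw [dist_eq_norm, dist_eq_norm, ← map_sub, norm_J hJi]
    simp
  obtain ⟨σ, z, hσ, hz, hzd⟩ := exists_limit_of_approx_solutions (hJl.comp hg) hxc hxR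
    (ε := fun K => √(fourierTail (K + 1) * V)) (by
      have h1 : Tendsto (fun K : ℕ => fourierTail (K + 1)) atTop (𝓝 0) :=
        tendsto_fourierTail.comp (tendsto_add_atTop_nat 1)
      simpa using (h1.mul_const V).sqrt) (fun K t ht => by
      refine Real.le_sqrt_of_sq_le ?_
      have h1 := norm_integral_sub_truncation_le hJ hJi (K + 1) (hgc.comp (hxc K)) ht
      have h2 : ∫ s in (0 : ℝ)..t, J (trigLoop J (k K) (trigCoeff J (k K) fun t => g (x K t)) s) =
          x K t - x K 0 :=
        intervalIntegral.integral_eq_sub_of_hasDerivAt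
          (fun u _ => (hasDerivAt_trigLoop hJ (y K) u).congr_deriv (by rw [hyc K]))
          (Continuous.intervalIntegrable (by fun_prop) _ _)
      have h3 : x K t - x K 0 - ∫ s in (0 : ℝ)..t, (J ∘ g) (x K s) =
          - J (∫ s in (0 : ℝ)..t, ((g ∘ x K) s - trigLoop J (k K) (trigCoeff J (k K) (g ∘ x K)) s)) := by
        rw [← h2, ← ContinuousLinearMap.intervalIntegral_comp_comm _
          (Continuous.intervalIntegrable (by fun_prop) _ _), ← intervalIntegral.integral_neg,
          ← intervalIntegral.integral_sub (Continuous.intervalIntegrable (by fun_prop) _ _)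
          (Continuous.intervalIntegrable (by fun_prop) _ _)]
        refine intervalIntegral.integral_congr fun s _ => ?_
        simp [Function.comp_def]
      rw [h3, norm_neg, norm_J hJi]
      refine h1.trans ?_
      exact mul_le_mul_of_nonneg_left (hw K) (fourierTail_pos _).le)
  refine ⟨z, hzd, ?_, ?_⟩
  · refine tendsto_nhds_unique (hz 1 ⟨zero_le_one, le_rfl⟩)
      ((hz 0 ⟨le_rfl, zero_le_one⟩).congr fun j => ?_)
    exact (trigLoop_one_eq_zero _).symm
  · have hA : Continuous fun v : E => 2⁻¹ * inner ℝ (g v) v - H v := by fun_prop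
    obtain ⟨A, hAb⟩ := ((isCompact_closedBall (0 : E) (B + √V)).image hA.norm).bddAbove
    have hlim : Tendsto (fun j => ∫ t in (0 : ℝ)..1,
        (2⁻¹ * inner ℝ (g (x (σ j) t)) (x (σ j) t) - H (x (σ j) t))) atTop
        (𝓝 (∫ t in (0 : ℝ)..1, (2⁻¹ * inner ℝ (g (z t)) (z t) - H (z t)))) := by
      refine intervalIntegral.tendsto_integral_filter_of_dominated_convergence (fun _ => A)
        (Eventually.of_forall fun j => (hA.comp (hxc _)).aestronglyMeasurable)
        (Eventually.of_forall fun j => Eventually.of_forall fun t ht => ?_)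
        (by simp) (Eventually.of_forall fun t ht => ?_)
      · rw [uIoc_of_le zero_le_one] at ht
        exact hAb ⟨x (σ j) t, by simpa using hxR (σ j) t ⟨ht.1.le, ht.2⟩, rfl⟩
      · rw [uIoc_of_le zero_le_one] at ht
        exact (hA.tendsto _).comp (hz t ⟨ht.1.le, ht.2⟩)
    have hact : ∀ j, ∫ t in (0 : ℝ)..1,
        (2⁻¹ * inner ℝ (g (x (σ j) t)) (x (σ j) t) - H (x (σ j) t)) =
        trigAction J (k (σ j)) H (y (σ j)) := fun j =>
      (trigAction_of_critical hJ hH hgc _ (hy (σ j)) hJi).symm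
    simp only [hact] at hlim
    refine ⟨lt_of_lt_of_le (by positivity) (ge_of_tendsto hlim
      (Eventually.of_forall fun j => hy1 (σ j))), le_of_tendsto hlim
      (Eventually.of_forall fun j => hy2 (σ j))⟩

end PeriodicOrbit

section SymplecticLoops

variable {E : Type*} [NormedAddCommGroup E] [InnerProductSpace ℝ E] {J : E →L[ℝ] E}

section Primitive

variable {F : Type*} [NormedAddCommGroup F] [NormedSpace ℝ F]

/-- The pullback under `G` of the primitive `z ↦ ω(z, ·)` of twice the symplectic form. -/
def liouvillePullback (J : E →L[ℝ] E) (G : F → E) (q : F) : F →L[ℝ] ℝ :=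
  (innerSL ℝ (J (G q))) ∘L fderiv ℝ G q

theorem liouvillePullback_apply (G : F → E) (q b : F) :
    liouvillePullback J G q b = inner ℝ (J (G q)) (fderiv ℝ G q b) := by
  simp [liouvillePullback]

theorem differentiableAt_liouvillePullback {G : F → E} (hG : ContDiff ℝ ∞ G) (q : F) :
    DifferentiableAt ℝ (liouvillePullback J G) q := by
  have h1 : DifferentiableAt ℝ (fderiv ℝ G) q :=
    ((hG.fderiv_right (m := 1) (by norm_cast)).differentiable one_ne_zero) q
  have h2 : DifferentiableAt ℝ G q := hG.differentiable (by simp) q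
  unfold liouvillePullback
  refine DifferentiableAt.clm_comp ?_ h1
  exact (innerSL ℝ).differentiableAt.comp q (J.differentiableAt.comp q h2)

theorem fderiv_liouvillePullback {G : F → E} (hG : ContDiff ℝ ∞ G) (q u b : F) :
    fderiv ℝ (liouvillePullback J G) q u b =
      inner ℝ (J (fderiv ℝ G q u)) (fderiv ℝ G q b) +
        inner ℝ (J (G q)) (fderiv ℝ (fderiv ℝ G) q u b) := by
  have h1 : DifferentiableAt ℝ (fderiv ℝ G) q :=
    ((hG.fderiv_right (m := 1) (by norm_cast)).differentiable one_ne_zero) q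
  have h2 : DifferentiableAt ℝ G q := hG.differentiable (by simp) q
  have h0 := differentiableAt_liouvillePullback (J := J) hG q
  have h3 : fderiv ℝ (fun q => liouvillePullback J G q b) q u =
      fderiv ℝ (liouvillePullback J G) q u b := by
    rw [fderiv_clm_apply h0 (differentiableAt_const b)]
    simp
  rw [← h3]
  simp only [liouvillePullback_apply]
  have h4 : HasFDerivAt (fun q => fderiv ℝ G q b)
      ((ContinuousLinearMap.apply ℝ E b) ∘L fderiv ℝ (fderiv ℝ G) q) q :=
    (ContinuousLinearMap.apply ℝ E b).hasFDerivAt.comp q h1.hasFDerivAt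
  have h5 : HasFDerivAt (fun q => J (G q)) (J ∘L fderiv ℝ G q) q :=
    J.hasFDerivAt.comp q h2.hasFDerivAt
  rw [(h5.inner ℝ h4).fderiv]
  simp [fderivInnerCLM_apply, add_comm]

/-- Two maps inducing the same two-form on a normed space differ, on the level of Liouville
forms, by an exact form. -/
theorem exists_primitive_of_pullback_eq {G C : F → E} (hG : ContDiff ℝ ∞ G)
    (hC : ContDiff ℝ ∞ C)
    (hGC : ∀ q u b, inner ℝ (J (fderiv ℝ G q u)) (fderiv ℝ G q b) =
      inner ℝ (J (fderiv ℝ C q u)) (fderiv ℝ C q b)) :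
    ∃ B : F → ℝ, ∀ q, HasFDerivAt B (liouvillePullback J G q - liouvillePullback J C q) q := by
  have hs : ∀ {K : F → E}, ContDiff ℝ ∞ K → ∀ q u b,
      fderiv ℝ (fderiv ℝ K) q u b = fderiv ℝ (fderiv ℝ K) q b u := fun hK q u b =>
    (hK.contDiffAt.isSymmSndFDerivAt (by simp; norm_cast)) u b
  have hd : DifferentiableOn ℝ
      (fun q => liouvillePullback J G q - liouvillePullback J C q) univ := fun q _ =>
    ((differentiableAt_liouvillePullback hG q).fun_sub
      (differentiableAt_liouvillePullback hC q)).differentiableWithinAt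
  obtain ⟨B, hB⟩ := convex_univ.exists_forall_hasFDerivAt_of_fderiv_symmetric isOpen_univ hd
    (fun q _ u b => by
      rw [fderiv_fun_sub (differentiableAt_liouvillePullback hG q)
        (differentiableAt_liouvillePullback hC q)]
      simp only [sub_apply, fderiv_liouvillePullback hG, fderiv_liouvillePullback hC, hGC,
        hs hG q u b, hs hC q u b]
      ring)
  exact ⟨B, fun q => hB q (mem_univ q)⟩

end Primitive

theorem rot_add_two_pi_mul (J : E →L[ℝ] E) (θ : ℝ) (k : ℤ) (x : E) :
    rot J (θ + 2 * π * k) x = rot J θ x := by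
  rw [rot_apply, rot_apply, show θ + 2 * π * k = θ + k * (2 * π) by ring,
    cos_add_int_mul_two_pi, sin_add_int_mul_two_pi]

/-- A symplectic embedding of a neighbourhood of a sphere preserves the actions of the
characteristics of the sphere. -/
theorem integral_action_rot_eq (hJ : ∀ x, J (J x) = -x)
    (hJi : ∀ x y, inner ℝ (J x) (J y) = inner ℝ x y) {N : Set E} (hN : IsOpen N) {φ : E → E}
    (hφ : ContDiffOn ℝ ∞ φ N)
    (hω : ∀ q ∈ N, ∀ v w, inner ℝ (J (fderiv ℝ φ q v)) (fderiv ℝ φ q w) = inner ℝ (J v) w)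
    {p w : E} (hp : sphere (0 : E) ‖p‖ ⊆ N) (hw : ‖w‖ = ‖p‖) (hwp : inner ℝ p w = 0)
    (hwJ : inner ℝ (J p) w = 0) (α : ℝ) (k : ℤ) :
    ∫ θ in α..(α + 2 * π * k),
      inner ℝ (J (φ (rot J θ p))) (fderiv ℝ φ (rot J θ p) (J (rot J θ p))) =
      2 * π * k * ‖p‖ ^ 2 := by
  let C : ℝ × ℝ → E := fun q => cos q.1 • rot J q.2 p + sin q.1 • w
  have hC : ContDiff ℝ ∞ C := by
    simp only [C, rot_apply]
    fun_prop
  have hCN : ∀ q, C q ∈ N := fun q => by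
    refine hp ?_
    have h1 : inner ℝ (rot J q.2 p) w = 0 := by
      simp [rot_apply, inner_add_left, inner_smul_left, hwp, hwJ]
    have h2 : ‖C q‖ ^ 2 = ‖p‖ ^ 2 := by
      simp only [C]
      rw [norm_add_sq_real, norm_smul, norm_smul, inner_smul_left, inner_smul_right, h1,
        norm_rot hJ hJi, hw, mul_pow, mul_pow, Real.norm_eq_abs, Real.norm_eq_abs, sq_abs, sq_abs]
      simp only [mul_zero, add_zero]
      nlinarith [sin_sq_add_cos_sq q.1]
    rw [mem_sphere_zero_iff_norm]
    exact (pow_left_inj₀ (norm_nonneg _) (norm_nonneg _) two_ne_zero).1 h2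
  have hφd : ∀ q ∈ N, DifferentiableAt ℝ φ q := fun q hq =>
    (hφ.contDiffAt (hN.mem_nhds hq)).differentiableAt (by simp)
  have hG : ContDiff ℝ ∞ (φ ∘ C) := contDiff_iff_contDiffAt.2 fun q =>
    (hφ.contDiffAt (hN.mem_nhds (hCN q))).comp q hC.contDiffAt
  have hGd : ∀ q u, fderiv ℝ (φ ∘ C) q u = fderiv ℝ φ (C q) (fderiv ℝ C q u) := fun q u => by
    rw [fderiv_comp q (hφd _ (hCN q)) (hC.differentiable (by simp) q)]
    rfl
  obtain ⟨B, hB⟩ := exists_primitive_of_pullback_eq (J := J) hG hC (fun q u b => by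
    rw [hGd, hGd, hω _ (hCN q)])
  set σ : ℝ × ℝ → ℝ × ℝ →L[ℝ] ℝ := fun q =>
    liouvillePullback J (φ ∘ C) q - liouvillePullback J C q with hσ
  let v : ℝ × ℝ := (0, 2 * π * k)
  have hCv : ∀ q, C (q + v) = C q := fun q => by simp [C, v, rot_add_two_pi_mul]
  have hlv : ∀ K : ℝ × ℝ → E, (∀ q, K (q + v) = K q) → ∀ q,
      liouvillePullback J K (q + v) = liouvillePullback J K q := fun K hK q => by
    unfold liouvillePullback
    rw [hK, ← fderiv_comp_add_right]
    simp only [hK]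
  have hσv : ∀ q, σ (q + v) = σ q := fun q => by
    simp only [hσ]
    rw [hlv _ hCv, hlv _ (fun q => congrArg φ (hCv q))]
  have hD : ∀ q, HasFDerivAt (fun q => B (q + v) - B q) (0 : ℝ × ℝ →L[ℝ] ℝ) q := fun q => by
    refine (((hB (q + v)).comp q ((hasFDerivAt_id q).add_const v)).fun_sub (hB q)).congr_fderiv ?_
    exact sub_eq_zero.2 (hσv q)
  have hDc := is_const_of_fderiv_eq_zero (𝕜 := ℝ)
    (fun q => (hD q).differentiableAt) (fun q => (hD q).fderiv)
  have hline : ∀ τ θ : ℝ, HasDerivAt (fun θ : ℝ => ((τ, θ) : ℝ × ℝ)) (0, 1) θ := fun τ θ =>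
    (hasDerivAt_const θ τ).prodMk (hasDerivAt_id θ)
  have hBθ : ∀ τ θ : ℝ, HasDerivAt (fun θ : ℝ => B (τ, θ)) (σ (τ, θ) (0, 1)) θ := fun τ θ =>
    (hB (τ, θ)).comp_hasDerivAt θ (hline τ θ)
  have hKθ : ∀ (K : ℝ × ℝ → E), ContDiff ℝ ∞ K → ∀ τ θ : ℝ,
      HasDerivAt (fun θ : ℝ => K (τ, θ)) (fderiv ℝ K (τ, θ) (0, 1)) θ := fun K hK τ θ =>
    ((hK.differentiable (by simp) (τ, θ)).hasFDerivAt).comp_hasDerivAt θ (hline τ θ)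
  have hend : ∀ θ, σ (π / 2, θ) (0, 1) = 0 := fun θ => by
    have h1 : ∀ K : ℝ × ℝ → E, ContDiff ℝ ∞ K → (∀ θ, K (π / 2, θ) = K (π / 2, 0)) →
        fderiv ℝ K (π / 2, θ) (0, 1) = 0 := fun K hK h => by
      have h2 := hKθ K hK (π / 2) θ
      simp only [h] at h2
      exact h2.unique (hasDerivAt_const _ _)
    have hC0 : ∀ θ, C (π / 2, θ) = C (π / 2, 0) := fun θ => by simp [C]
    simp only [hσ, sub_apply, liouvillePullback_apply]
    rw [h1 C hC hC0, h1 _ hG fun θ => congrArg φ (hC0 θ)]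
    simp
  have hBc : ∀ θ θ', B (π / 2, θ) = B (π / 2, θ') := fun θ θ' =>
    is_const_of_deriv_eq_zero (f := fun θ => B (π / 2, θ))
      (fun θ => (hBθ _ θ).differentiableAt) (fun θ => by rw [(hBθ _ θ).deriv, hend]) θ θ'
  have hzero : B (0, α + 2 * π * k) - B (0, α) = 0 := by
    have h1 := hDc (0, α) (π / 2, α)
    simp only [v, Prod.mk_add_mk, add_zero] at h1
    rw [h1, hBc (α + 2 * π * k) α, sub_self]
  have hC0 : ∀ θ, C (0, θ) = rot J θ p := fun θ => by simp [C]
  have hCd : ∀ θ, fderiv ℝ C (0, θ) (0, 1) = J (rot J θ p) := fun θ => by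
    have h1 := hKθ C hC 0 θ
    simp only [hC0] at h1
    exact h1.unique (hasDerivAt_rot hJ θ p)
  have hval : ∀ θ, σ (0, θ) (0, 1) =
      inner ℝ (J (φ (rot J θ p))) (fderiv ℝ φ (rot J θ p) (J (rot J θ p))) - ‖p‖ ^ 2 := fun θ => by
    simp only [hσ, sub_apply, liouvillePullback_apply, hGd, hCd, Function.comp_apply, hC0]
    rw [hJi, real_inner_self_eq_norm_sq, norm_rot hJ hJi]
  have hcont : Continuous fun θ : ℝ => σ (0, θ) (0, 1) := by
    simp only [hσ, sub_apply, liouvillePullback_apply]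
    have h1 : ∀ K : ℝ × ℝ → E, ContDiff ℝ ∞ K →
        Continuous fun θ : ℝ => fderiv ℝ K (0, θ) (0, 1) := fun K hK =>
      ((hK.continuous_fderiv (by simp)).comp (by fun_prop)).clm_apply continuous_const
    have h2 := h1 _ hG
    have h3 := h1 _ hC
    have h4 := hC.continuous
    have h5 : Continuous fun θ : ℝ => C (0, θ) := by fun_prop
    have h6 : Continuous fun θ : ℝ => (φ ∘ C) (0, θ) := hG.continuous.comp (by fun_prop)
    exact ((J.continuous.comp h6).inner h2).sub ((J.continuous.comp h5).inner h3)
  have hIntg := intervalIntegral.integral_eq_sub_of_hasDerivAt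
    (fun θ _ => hBθ 0 θ) (hcont.intervalIntegrable α (α + 2 * π * k))
  rw [hzero] at hIntg
  have h6 : ∫ θ in α..(α + 2 * π * k),
      inner ℝ (J (φ (rot J θ p))) (fderiv ℝ φ (rot J θ p) (J (rot J θ p))) =
      ∫ θ in α..(α + 2 * π * k), (σ (0, θ) (0, 1) + ‖p‖ ^ 2) :=
    intervalIntegral.integral_congr fun θ _ => by simp only [hval]; ring
  rw [h6, intervalIntegral.integral_add (hcont.intervalIntegrable _ _)
    (Continuous.intervalIntegrable (by fun_prop) _ _), hIntg]
  simp

end SymplecticLoops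

section CutoffHamiltonian

variable {E : Type*} [NormedAddCommGroup E] [InnerProductSpace ℝ E] [FiniteDimensional ℝ E]
  {J : E →L[ℝ] E}

theorem exists_equiv_of_symplectic (hJ : ∀ x, J (J x) = -x) {D : E →L[ℝ] E}
    (hD : ∀ v w, inner ℝ (J (D v)) (D w) = inner ℝ (J v) w) :
    ∃ A : E ≃L[ℝ] E, (A : E →L[ℝ] E) = D := by
  have hinj : Function.Injective (D : E →ₗ[ℝ] E) := by
    refine (injective_iff_map_eq_zero _).2 fun v hv => ?_
    have hv' : D v = 0 := hv
    have h1 : J v = 0 := by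
      have := hD v (J v)
      rw [hv', map_zero, inner_zero_left] at this
      exact inner_self_eq_zero.1 this.symm
    have h2 := hJ v
    rw [h1, map_zero] at h2
    exact neg_eq_zero.1 h2.symm
  refine ⟨(LinearEquiv.ofInjectiveEndo (D : E →ₗ[ℝ] E) hinj).toContinuousLinearEquiv, ?_⟩
  ext v
  rfl

/-- A symplectic embedding is a diffeomorphism onto an open set. -/
theorem exists_openPartialHomeomorph_of_symplectic (hJ : ∀ x, J (J x) = -x) {N : Set E}
    (hN : IsOpen N) {φ : E → E} (hφ : ContDiffOn ℝ ∞ φ N) (hinj : InjOn φ N)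
    (hω : ∀ q ∈ N, ∀ v w, inner ℝ (J (fderiv ℝ φ q v)) (fderiv ℝ φ q w) = inner ℝ (J v) w) :
    ∃ Φ : OpenPartialHomeomorph E E, Φ.source = N ∧ ⇑Φ = φ ∧
      ∀ z ∈ Φ.target, ContDiffAt ℝ ∞ Φ.symm z := by
  have hd : ∀ q ∈ N, ∃ A : E ≃L[ℝ] E, HasStrictFDerivAt φ (A : E →L[ℝ] E) q := fun q hq => by
    obtain ⟨A, hA⟩ := exists_equiv_of_symplectic hJ (hω q hq)
    refine ⟨A, ?_⟩
    rw [hA]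
    exact (hφ.contDiffAt (hN.mem_nhds hq)).hasStrictFDerivAt (by simp)
  have hopen : IsOpenMap (N.domRestrict φ) := by
    refine isOpenMap_iff_nhds_le.2 fun q => ?_
    obtain ⟨A, hA⟩ := hd q q.2
    have h1 : map (N.domRestrict φ) (𝓝 q) = map φ (𝓝 (q : E)) := by
      rw [show N.domRestrict φ = φ ∘ Subtype.val from rfl, ← Filter.map_map,
        map_nhds_subtype_coe_eq_nhds q.2 (hN.mem_nhds q.2)]
    rw [h1, hA.map_nhds_eq_of_equiv]
    rfl
  let Φ := OpenPartialHomeomorph.ofContinuousOpenRestrict (hinj.toPartialEquiv φ N)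
    hφ.continuousOn hopen hN
  refine ⟨Φ, rfl, rfl, fun z hz => ?_⟩
  have hs : Φ.symm z ∈ N := Φ.map_target hz
  obtain ⟨A, hA⟩ := hd _ hs
  exact Φ.contDiffAt_symm hz hA.hasFDerivAt (hφ.contDiffAt (hN.mem_nhds hs))

set_option linter.unusedSectionVars false in
theorem isPreconnected_annulus (hE : 1 < Module.rank ℝ E) (a b : ℝ) (ha : 0 ≤ a) :
    IsPreconnected {p : E | a < ‖p‖ ∧ ‖p‖ < b} := by
  have h1 : {p : E | a < ‖p‖ ∧ ‖p‖ < b} =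
      (fun q : ℝ × E => q.1 • q.2) '' (Ioo a b ×ˢ sphere (0 : E) 1) := by
    ext p
    constructor
    · rintro ⟨h1, h2⟩
      have h0 : ‖p‖ ≠ 0 := (ha.trans_lt h1).ne'
      refine ⟨(‖p‖, ‖p‖⁻¹ • p), ⟨⟨h1, h2⟩, ?_⟩, ?_⟩
      · simp [norm_smul, h0]
      · simp [smul_smul, h0]
    · rintro ⟨⟨t, u⟩, ⟨⟨h1, h2⟩, h3⟩, rfl⟩
      have h3' : ‖u‖ = 1 := by simpa using h3
      have : ‖t • u‖ = t := by
        rw [norm_smul, h3', mul_one, Real.norm_of_nonneg (ha.trans h1.le)]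
      simp only [mem_ofPred_eq, this]
      exact ⟨h1, h2⟩
  rw [h1]
  refine IsPreconnected.image ?_ _ (by fun_prop)
  exact isPreconnected_Ioo.prod (isConnected_sphere hE 0 zero_le_one).isPreconnected

/-- The Hamiltonian generated on the image of an annulus by a radial cutoff function, extended to
the whole space by constants. -/
theorem exists_cutoff_hamiltonian (hJ : ∀ x, J (J x) = -x) (hE : 1 < Module.rank ℝ E)
    {a b : ℝ} (ha : 0 ≤ a) {φ : E → E}
    (hφ : ContDiffOn ℝ ∞ φ {p : E | a < ‖p‖ ∧ ‖p‖ < b}) (hinj : InjOn φ {p : E | a < ‖p‖ ∧ ‖p‖ < b})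
    (hω : ∀ q ∈ {p : E | a < ‖p‖ ∧ ‖p‖ < b}, ∀ v w,
      inner ℝ (J (fderiv ℝ φ q v)) (fderiv ℝ φ q w) = inner ℝ (J v) w)
    {s₀ s₁ m : ℝ} (hs₀ : π * a ^ 2 < s₀) (hs : s₀ ≤ s₁) (hs₁ : s₁ < π * b ^ 2) (hb : 0 ≤ b)
    {f : ℝ → ℝ} (hf : ContDiff ℝ ∞ f) (hf0 : ∀ s ≤ s₀, f s = 0) (hf1 : ∀ s, s₁ ≤ s → f s = m) :
    ∃ (H : E → ℝ) (g : E → E), (∀ z, HasFDerivAt H (innerSL ℝ (g z)) z) ∧ ContDiff ℝ 1 g ∧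
      IsCompact (φ '' {p : E | s₀ ≤ π * ‖p‖ ^ 2 ∧ π * ‖p‖ ^ 2 ≤ s₁}) ∧
      (∀ p, a < ‖p‖ → ‖p‖ < b → H (φ p) = f (π * ‖p‖ ^ 2) ∧
        g (φ p) = -J (fderiv ℝ φ p ((2 * π * deriv f (π * ‖p‖ ^ 2)) • J p))) ∧
      ∀ z ∉ φ '' {p : E | s₀ ≤ π * ‖p‖ ^ 2 ∧ π * ‖p‖ ^ 2 ≤ s₁}, g z = 0 ∧ (H z = 0 ∨ H z = m) := by
  classical
  set A : Set E := {p : E | a < ‖p‖ ∧ ‖p‖ < b} with hAdef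
  set K : Set E := {p : E | s₀ ≤ π * ‖p‖ ^ 2 ∧ π * ‖p‖ ^ 2 ≤ s₁} with hKdef
  have hA : IsOpen A := (isOpen_lt continuous_const continuous_norm).inter
    (isOpen_lt continuous_norm continuous_const)
  have hKA : K ⊆ A := fun p hp => by
    have h1 : π * a ^ 2 < π * ‖p‖ ^ 2 := hs₀.trans_le hp.1
    have h2 : π * ‖p‖ ^ 2 < π * b ^ 2 := hp.2.trans_lt hs₁
    exact ⟨lt_of_pow_lt_pow_left₀ 2 (norm_nonneg _) (lt_of_mul_lt_mul_left h1 pi_pos.le),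
      lt_of_pow_lt_pow_left₀ 2 hb (lt_of_mul_lt_mul_left h2 pi_pos.le)⟩
  have hKc : IsCompact K := by
    refine (isCompact_closedBall (0 : E) b).of_isClosed_subset ?_ fun p hp => ?_
    · have hcn : Continuous fun p : E => π * ‖p‖ ^ 2 := by fun_prop
      exact (isClosed_le continuous_const hcn).inter (isClosed_le hcn continuous_const)
    · simpa using (hKA hp).2.le
  have hφKc : IsCompact (φ '' K) := hKc.image_of_continuousOn (hφ.continuousOn.mono hKA)
  obtain ⟨Φ, hΦs, hΦ, hΦsymm⟩ := exists_openPartialHomeomorph_of_symplectic hJ hA hφ hinj hω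
  have hT : Φ.target = φ '' A := by rw [← hΦs, ← hΦ, Φ.image_source_eq_target]
  have hTo : IsOpen (φ '' A) := hT ▸ Φ.open_target
  have hsymm : ∀ p ∈ A, Φ.symm (φ p) = p := fun p hp => by
    rw [← hΦ]; exact Φ.left_inv (hΦs ▸ hp)
  have hd0 : ∀ s, s < s₀ ∨ s₁ < s → deriv f s = 0 := by
    rintro s (h | h)
    · have : f =ᶠ[𝓝 s] fun _ => 0 := by
        filter_upwards [Iio_mem_nhds h] with t ht using hf0 t (le_of_lt ht)
      rw [this.deriv_eq, deriv_const]
    · have : f =ᶠ[𝓝 s] fun _ => m := by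
        filter_upwards [Ioi_mem_nhds h] with t ht using hf1 t (le_of_lt ht)
      rw [this.deriv_eq, deriv_const]
  let X : E → E := fun p => (2 * π * deriv f (π * ‖p‖ ^ 2)) • J p
  have hX0 : ∀ p ∉ K, X p = 0 := fun p hp => by
    have : π * ‖p‖ ^ 2 < s₀ ∨ s₁ < π * ‖p‖ ^ 2 := by
      by_contra! h
      exact hp h
    simp [X, hd0 _ this]
  let g₀ : E → E := fun p => -J (fderiv ℝ φ p (X p))
  let g : E → E := fun z => if z ∈ φ '' A then g₀ (Φ.symm z) else 0
  have hg : ∀ p ∈ A, g (φ p) = g₀ p := fun p hp => by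
    simp only [g, if_pos (mem_image_of_mem φ hp), hsymm p hp]
  have hgK : ∀ z ∉ φ '' K, g z = 0 := fun z hz => by
    by_cases h : z ∈ φ '' A
    · obtain ⟨p, hp, rfl⟩ := h
      have hpK : p ∉ K := fun h => hz (mem_image_of_mem φ h)
      rw [hg p hp]
      simp [g₀, hX0 p hpK]
    · simp only [g, if_neg h]
  have hXs : ContDiff ℝ 1 X := by
    have h1 : ContDiff ℝ 1 (deriv f) := ContDiff.iterate_deriv' 1 1 (hf.of_le (by norm_cast))
    have h2 : ContDiff ℝ 1 fun p : E => π * ‖p‖ ^ 2 := contDiff_const.mul (contDiff_norm_sq ℝ)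
    exact ((contDiff_const.mul (h1.comp h2)).smul J.contDiff)
  have hgs : ContDiff ℝ 1 g := contDiff_iff_contDiffAt.2 fun z => by
    by_cases h : z ∈ φ '' K
    · have hzA : z ∈ φ '' A := image_mono hKA h
      have h1 : g =ᶠ[𝓝 z] g₀ ∘ Φ.symm := by
        filter_upwards [hTo.mem_nhds hzA] with y hy
        simp only [g, if_pos hy, Function.comp_apply]
      refine ContDiffAt.congr_of_eventuallyEq ?_ h1
      obtain ⟨p, hp, rfl⟩ := hzA
      have h2 : ContDiffAt ℝ 1 (fderiv ℝ φ) p :=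
        (hφ.contDiffAt (hA.mem_nhds hp)).fderiv_right (m := 1) (by norm_cast)
      refine ContDiffAt.comp _ ?_
        ((hΦsymm _ (hT ▸ mem_image_of_mem φ hp)).of_le (by norm_cast))
      rw [hsymm p hp]
      exact (J.contDiff.contDiffAt.comp p (h2.clm_apply hXs.contDiffAt)).neg
    · have h1 : g =ᶠ[𝓝 z] fun _ => 0 := by
        filter_upwards [hφKc.isClosed.isOpen_compl.mem_nhds h] with y hy using hgK y hy
      exact contDiffAt_const.congr_of_eventuallyEq h1
  let h : E → ℝ := fun p => f (π * ‖p‖ ^ 2)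
  have hhs : ContDiff ℝ ∞ h := hf.comp (contDiff_const.mul (contDiff_norm_sq ℝ))
  have hhd : ∀ p, HasFDerivAt h ((2 * π * deriv f (π * ‖p‖ ^ 2)) • innerSL ℝ p) p := fun p => by
    have h1 : HasFDerivAt (fun p : E => π * ‖p‖ ^ 2) (π • (2 • innerSL ℝ p)) p :=
      (hasStrictFDerivAt_norm_sq p).hasFDerivAt.const_mul π
    refine (((hf.differentiable (by simp) _).hasDerivAt).comp_hasFDerivAt p h1).congr_fderiv ?_
    ext v
    simp
    ring
  have hφd : ∀ p ∈ A, HasFDerivAt φ (fderiv ℝ φ p) p := fun p hp =>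
    ((hφ.contDiffAt (hA.mem_nhds hp)).differentiableAt (by simp)).hasFDerivAt
  have hpull : ∀ p ∈ A, (innerSL ℝ (g (φ p))) ∘L fderiv ℝ φ p = fderiv ℝ h p := fun p hp => by
    rw [(hhd p).fderiv, hg p hp]
    ext v
    simp only [g₀, X, ContinuousLinearMap.comp_apply, innerSL_apply_apply, inner_neg_left,
      smul_apply, map_smul, inner_smul_left]
    rw [hω p hp, hJ, inner_neg_left]
    simp
  have hgψ : ∀ z ∈ φ '' A, HasFDerivAt (h ∘ Φ.symm) (innerSL ℝ (g z)) z := by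
    rintro z ⟨p, hp, rfl⟩
    have hz : φ p ∈ Φ.target := hT ▸ mem_image_of_mem φ hp
    have h1 : HasFDerivAt Φ.symm (fderiv ℝ Φ.symm (φ p)) (φ p) :=
      ((hΦsymm _ hz).differentiableAt (by simp)).hasFDerivAt
    have h2 : fderiv ℝ φ p ∘L fderiv ℝ Φ.symm (φ p) = ContinuousLinearMap.id ℝ E := by
      have h3 : HasFDerivAt (φ ∘ Φ.symm) (fderiv ℝ φ p ∘L fderiv ℝ Φ.symm (φ p)) (φ p) := by
        refine HasFDerivAt.comp _ ?_ h1
        rw [hsymm p hp]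
        exact hφd p hp
      refine h3.unique ((hasFDerivAt_id _).congr_of_eventuallyEq ?_)
      filter_upwards [Φ.open_target.mem_nhds hz] with y hy
      rw [Function.comp_apply, ← hΦ, Φ.right_inv hy, id]
    have h4 : HasFDerivAt (h ∘ Φ.symm) (fderiv ℝ h p ∘L fderiv ℝ Φ.symm (φ p)) (φ p) := by
      refine HasFDerivAt.comp _ ?_ h1
      rw [hsymm p hp]
      exact (hhs.differentiable (by simp) p).hasFDerivAt
    refine h4.congr_fderiv ?_
    rw [← hpull p hp, ContinuousLinearMap.comp_assoc, h2, ContinuousLinearMap.comp_id]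
  have hsym : ∀ z u v, fderiv ℝ (fun z => innerSL ℝ (g z)) z u v =
      fderiv ℝ (fun z => innerSL ℝ (g z)) z v u := fun z u v => by
    by_cases hz : z ∈ φ '' K
    · have hzA : z ∈ φ '' A := image_mono hKA hz
      have h1 : (fun z => innerSL ℝ (g z)) =ᶠ[𝓝 z] fderiv ℝ (h ∘ Φ.symm) := by
        filter_upwards [hTo.mem_nhds hzA] with y hy using (hgψ y hy).fderiv.symm
      rw [h1.fderiv_eq]
      exact ((hhs.contDiffAt.comp z (hΦsymm z (hT ▸ hzA))).isSymmSndFDerivAt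
        (by simp; norm_cast)) u v
    · have h1 : (fun z => innerSL ℝ (g z)) =ᶠ[𝓝 z] fun _ => 0 := by
        filter_upwards [hφKc.isClosed.isOpen_compl.mem_nhds hz] with y hy
        rw [hgK y hy, map_zero]
      rw [h1.fderiv_eq]
      simp
  obtain ⟨H, hH⟩ := convex_univ.exists_forall_hasFDerivAt_of_fderiv_symmetric isOpen_univ
    (((innerSL ℝ).differentiable.comp (hgs.differentiable one_ne_zero)).differentiableOn)
    (fun z _ u v => hsym z u v)
  have hHd : ∀ z, HasFDerivAt H (innerSL ℝ (g z)) z := fun z => hH z (mem_univ z)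
  obtain ⟨c, hc⟩ : ∃ c, ∀ p ∈ A, H (φ p) = h p + c := by
    have h1 : ∀ p ∈ A, HasFDerivAt (fun p => H (φ p) - h p) (0 : E →L[ℝ] ℝ) p := fun p hp => by
      refine (((hHd (φ p)).comp p (hφd p hp)).fun_sub
        (hhs.differentiable (by simp) p).hasFDerivAt).congr_fderiv ?_
      rw [hpull p hp, sub_self]
    obtain ⟨c, hc⟩ := hA.exists_is_const_of_fderiv_eq_zero (isPreconnected_annulus hE a b ha)
      (fun p hp => (h1 p hp).differentiableAt.differentiableWithinAt)
      (fun p hp => (h1 p hp).fderiv)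
    exact ⟨c, fun p hp => by linarith [hc p hp]⟩
  refine ⟨fun z => H z - c, g, fun z => (hHd z).sub_const c, hgs, hφKc, fun p hp hp' => ?_,
    fun z hz => ⟨hgK z hz, ?_⟩⟩
  · have hpA : p ∈ A := ⟨hp, hp'⟩
    exact ⟨by simp only [hc p hpA]; ring, hg p hpA⟩
  · obtain ⟨k₀, hk₀⟩ : K.Nonempty := by
      have : Nontrivial E := rank_pos_iff_nontrivial.1 (zero_lt_one.trans hE)
      have h0 : 0 ≤ s₀ / π := div_nonneg ((by positivity : 0 ≤ π * a ^ 2).trans hs₀.le) pi_pos.le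
      obtain ⟨p, hp⟩ := exists_norm_eq E (sqrt_nonneg (s₀ / π))
      have h1 : π * ‖p‖ ^ 2 = s₀ := by
        rw [hp, sq_sqrt h0]
        field_simp
      exact ⟨p, h1.ge, h1 ▸ hs⟩
    let l : ℝ → E := fun t => z + t • (φ k₀ - z)
    have hl : Continuous l := by fun_prop
    set T := Icc (0 : ℝ) 1 ∩ l ⁻¹' (φ '' K) with hTdef
    have hTc : IsCompact T := isCompact_Icc.inter_right (hφKc.isClosed.preimage hl)
    have hTn : T.Nonempty := ⟨1, ⟨zero_le_one, le_rfl⟩, by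
      simpa [l] using mem_image_of_mem φ hk₀⟩
    obtain ⟨τ, hτT, hτ⟩ := hTc.exists_isLeast hTn
    have hτ0 : 0 < τ := by
      refine lt_of_le_of_ne hτT.1.1 fun h0 => hz ?_
      have := hτT.2
      rw [mem_preimage, ← h0] at this
      simpa [l] using this
    have hbef : ∀ t ∈ Ico 0 τ, l t ∉ φ '' K := fun t ht h =>
      absurd (hτ ⟨⟨ht.1, ht.2.le.trans hτT.1.2⟩, h⟩) (not_le.2 ht.2)
    obtain ⟨k, hk, hkτ⟩ := hτT.2
    have hconst : H z = H (φ k) := by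
      have h1 : ∀ t, HasDerivAt (fun t => H (l t)) (inner ℝ (g (l t)) (φ k₀ - z)) t := fun t => by
        have h2 : HasDerivAt l (φ k₀ - z) t := by
          exact (((hasDerivAt_id t).smul_const (φ k₀ - z)).const_add z).congr_deriv (one_smul _ _)
        exact (hHd (l t)).comp_hasDerivAt t h2
      have h2 := constant_of_has_deriv_right_zero (f := fun t => H (l t)) (a := 0) (b := τ)
        (fun t _ => (h1 t).continuousAt.continuousWithinAt)
        (fun t ht => by
          have := (h1 t).hasDerivWithinAt (s := Ici t)
          rwa [hgK _ (hbef t ht), inner_zero_left] at this) τ ⟨hτ0.le, le_rfl⟩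
      rw [hkτ, h2]
      simp [l]
    have hkA := hKA hk
    simp only [hconst, hc k hkA, h, add_sub_cancel_right]
    rcases le_or_gt (π * ‖k‖ ^ 2) s₀ with h1 | h1
    · exact Or.inl (hf0 _ h1)
    rcases le_or_gt s₁ (π * ‖k‖ ^ 2) with h2 | h2
    · exact Or.inr (hf1 _ h2)
    exfalso
    have hcn : Continuous fun p : E => π * ‖p‖ ^ 2 := by fun_prop
    have hKo : IsOpen {p : E | s₀ < π * ‖p‖ ^ 2 ∧ π * ‖p‖ ^ 2 < s₁} :=
      (isOpen_lt continuous_const hcn).inter (isOpen_lt hcn continuous_const)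
    have hsub : {p : E | s₀ < π * ‖p‖ ^ 2 ∧ π * ‖p‖ ^ 2 < s₁} ⊆ K := fun p hp =>
      ⟨hp.1.le, hp.2.le⟩
    have hnh : φ '' K ∈ 𝓝 (l τ) := by
      rw [← hkτ, ← hΦ]
      refine mem_of_superset ((Φ.isOpen_image_of_subset_source hKo
        (hΦs ▸ hsub.trans hKA)).mem_nhds (mem_image_of_mem _ ⟨h1, h2⟩)) (image_mono hsub)
    have h3 : ∀ᶠ t in 𝓝[<] τ, l t ∈ φ '' K :=
      (hl.tendsto τ).eventually hnh |>.filter_mono nhdsWithin_le_nhds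
    obtain ⟨t, ht1, ht2⟩ := (h3.and (Ioo_mem_nhdsLT hτ0)).exists
    exact hbef t ⟨ht2.1.le, ht2.2⟩ ht1

end CutoffHamiltonian

section SymplecticLinear

variable {E : Type*} [NormedAddCommGroup E] [InnerProductSpace ℝ E] [FiniteDimensional ℝ E]
  {J : E →L[ℝ] E}

theorem abs_det_of_symplectic (hJ : ∀ x, J (J x) = -x) {D : E →L[ℝ] E}
    (hD : ∀ v w, inner ℝ (J (D v)) (D w) = inner ℝ (J v) w) : |D.det| = 1 := by
  let β := stdOrthonormalBasis ℝ E
  have hdet : LinearMap.det (LinearMap.adjoint (D : E →ₗ[ℝ] E)) = D.det := by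
    rw [← LinearMap.det_toMatrix β.toBasis, LinearMap.toMatrix_adjoint,
      Matrix.det_conjTranspose, LinearMap.det_toMatrix]
    rfl
  have hcomp : LinearMap.adjoint (D : E →ₗ[ℝ] E) ∘ₗ ((J : E →ₗ[ℝ] E) ∘ₗ (D : E →ₗ[ℝ] E)) =
      (J : E →ₗ[ℝ] E) := by
    ext v
    refine ext_inner_right ℝ fun w => ?_
    simp only [LinearMap.comp_apply, LinearMap.adjoint_inner_left]
    exact hD v w
  have hJ0 : LinearMap.det (J : E →ₗ[ℝ] E) ≠ 0 := by
    intro h0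
    have h2 : (J : E →ₗ[ℝ] E) ∘ₗ (J : E →ₗ[ℝ] E) = (-1 : ℝ) • LinearMap.id := by
      ext v
      simp [hJ]
    have h3 := congrArg LinearMap.det h2
    rw [LinearMap.det_comp, h0, LinearMap.det_smul] at h3
    simp at h3
    exact pow_ne_zero _ (by norm_num) h3.symm
  have h := congrArg LinearMap.det hcomp
  rw [LinearMap.det_comp, LinearMap.det_comp, hdet] at h
  have h4 : D.det * D.det = 1 := by
    have : LinearMap.det (J : E →ₗ[ℝ] E) * (D.det * D.det - 1) = 0 := by
      have h5 : LinearMap.det (D : E →ₗ[ℝ] E) = D.det := rfl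
      rw [h5] at h
      linarith
    have := (mul_eq_zero.1 this).resolve_left hJ0
    linarith
  have h6 : |D.det| * |D.det| = 1 := by rw [← abs_mul, h4, abs_one]
  nlinarith [abs_nonneg D.det]

theorem exists_orthogonal_pair (hE : 2 < Module.finrank ℝ E) (p q : E) (r : ℝ) (hr : 0 ≤ r) :
    ∃ w : E, ‖w‖ = r ∧ inner ℝ p w = 0 ∧ inner ℝ q w = 0 := by
  have h1 : Module.finrank ℝ (Submodule.span ℝ {p, q}) ≤ 2 := by
    classical
    have := finrank_span_le_card (R := ℝ) ({p, q} : Set E)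
    refine this.trans ?_
    rw [Set.toFinset_insert, Set.toFinset_singleton]
    exact Finset.card_le_two
  have h2 := (Submodule.span ℝ {p, q}).finrank_add_finrank_orthogonal
  have h3 : 0 < Module.finrank ℝ (Submodule.span ℝ {p, q})ᗮ := by omega
  obtain ⟨⟨u, hu⟩, hu0⟩ := (Module.finrank_pos_iff_exists_ne_zero (R := ℝ)).1 h3
  have hu0' : u ≠ 0 := fun h => hu0 (Subtype.ext h)
  have hpu : inner ℝ p u = 0 := hu p (Submodule.subset_span (by simp))
  have hqu : inner ℝ q u = 0 := hu q (Submodule.subset_span (by simp))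
  refine ⟨(r / ‖u‖) • u, ?_, ?_, ?_⟩
  · rw [norm_smul, norm_div, norm_norm, norm_of_nonneg hr,
      div_mul_cancel₀ _ (norm_ne_zero_iff.2 hu0')]
  · rw [inner_smul_right, hpu, mul_zero]
  · rw [inner_smul_right, hqu, mul_zero]

end SymplecticLinear

section VolumeIdentity

variable {E : Type*} [NormedAddCommGroup E] [InnerProductSpace ℝ E] [FiniteDimensional ℝ E]
  [MeasurableSpace E] [BorelSpace E] {J : E →L[ℝ] E}

/-- Integration by parts against the Euler vector field. -/
theorem finrank_mul_integral_eq_neg_integral_inner {F : E → ℝ} {G : E → E}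
    (hF : ∀ z, HasFDerivAt F (innerSL ℝ (G z)) z) (hG : Continuous G)
    (hFs : HasCompactSupport F) :
    Module.finrank ℝ E * ∫ z, F z = -∫ z, inner ℝ (G z) z := by
  have hFc : Continuous F := continuous_iff_continuousAt.2 fun z => (hF z).continuousAt
  have hfd : fderiv ℝ F = fun z => innerSL ℝ (G z) := funext fun z => (hF z).fderiv
  have hGs : HasCompactSupport G := by
    have h1 := hFs.fderiv (𝕜 := ℝ)
    rw [hfd] at h1
    refine h1.mono fun z hz => ?_
    simp only [Function.mem_support] at hz ⊢
    intro h
    exact hz ((innerSL ℝ).map_eq_zero_iff (by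
      intro x y hxy
      refine ext_inner_right ℝ fun v => ?_
      simpa using congrArg (fun L : E →L[ℝ] ℝ => L v) hxy) |>.1 h)
  let β := stdOrthonormalBasis ℝ E
  have hi1 : ∀ i, Integrable (fun z => inner ℝ (G z) (β i) * inner ℝ (β i) z) := fun i => by
    refine Continuous.integrable_of_hasCompactSupport (by fun_prop) (hGs.mono fun z hz => ?_)
    simp only [Function.mem_support] at hz ⊢
    rintro h
    simp [h] at hz
  have key : ∀ i, ∫ z, F z = -∫ z, inner ℝ (G z) (β i) * inner ℝ (β i) z := fun i => by
    have hg : ∀ z, HasFDerivAt (fun z : E => inner ℝ (β i) z) (innerSL ℝ (β i)) z := fun z =>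
      (innerSL ℝ (β i)).hasFDerivAt
    have h := integral_mul_fderiv_eq_neg_fderiv_mul_of_integrable (μ := (volume : Measure E))
      (f := F) (g := fun z : E => (inner ℝ (β i) z : ℝ)) (v := β i) ?_ ?_ ?_
      (fun z _ => (hF z).differentiableAt) (fun z _ => (hg z).differentiableAt)
    · simp only [(hF _).fderiv, (hg _).fderiv, innerSL_apply_apply] at h
      simpa [β.orthonormal.1 i] using h
    · simpa [(hF _).fderiv] using hi1 i
    · simpa [(hg _).fderiv, β.orthonormal.1 i] using hFc.integrable_of_hasCompactSupport hFs
    · refine Continuous.integrable_of_hasCompactSupport (by fun_prop) (hFs.mul_right)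
  calc (Module.finrank ℝ E : ℝ) * ∫ z, F z = ∑ _i : Fin (Module.finrank ℝ E), ∫ z, F z := by simp
    _ = ∑ i, -∫ z, inner ℝ (G z) (β i) * inner ℝ (β i) z :=
      Finset.sum_congr rfl fun i _ => key i
    _ = -∫ z, inner ℝ (G z) z := by
      rw [Finset.sum_neg_distrib, ← integral_finsetSum _ fun i _ => hi1 i]
      simp only [β.sum_inner_mul_inner]

theorem integral_comp_rot (hJ : ∀ x, J (J x) = -x)
    (hJi : ∀ x y, inner ℝ (J x) (J y) = inner ℝ x y) (F : E → ℝ) (θ : ℝ) :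
    ∫ p, F (rot J θ p) = ∫ p, F p := by
  let R : E →ₗᵢ[ℝ] E := ⟨(rot J θ : E →ₗ[ℝ] E), fun x => norm_rot hJ hJi θ x⟩
  let R' : E ≃ₗᵢ[ℝ] E := R.toLinearIsometryEquiv rfl
  exact (R'.measurePreserving).integral_comp R'.toHomeomorph.measurableEmbedding F

theorem integral_integral_rot (hJ : ∀ x, J (J x) = -x)
    (hJi : ∀ x y, inner ℝ (J x) (J y) = inner ℝ x y) {F : E → ℝ} (hF : Continuous F)
    (hFs : HasCompactSupport F) (T : ℝ) (hT : 0 ≤ T) :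
    ∫ p, (∫ θ in 0..T, F (rot J θ p)) = T * ∫ p, F p := by
  have hc : Continuous fun q : ℝ × E => rot J q.1 q.2 := by
    have := continuous_rot J
    fun_prop
  have hIntg : Integrable (Function.uncurry fun θ p => F (rot J θ p))
      ((volume.restrict (Set.uIoc 0 T)).prod volume) := by
    obtain ⟨ρ, hρ⟩ := hFs.isBounded.subset_closedBall (0 : E)
    have hi : IntegrableOn (fun q : ℝ × E => F (rot J q.1 q.2))
        (Icc 0 T ×ˢ closedBall (0 : E) ρ) (volume.prod volume) :=
      (hF.comp hc).continuousOn.integrableOn_compact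
        (isCompact_Icc.prod (isCompact_closedBall _ _))
    have hi2 : IntegrableOn (fun q : ℝ × E => F (rot J q.1 q.2))
        (Icc 0 T ×ˢ univ) (volume.prod volume) := by
      refine hi.of_forall_sdiff_eq_zero (measurableSet_Icc.prod MeasurableSet.univ) ?_
      rintro ⟨θ, p⟩ ⟨⟨h1, -⟩, h2⟩
      refine Function.notMem_support.1 fun h3 => h2 ⟨h1, ?_⟩
      have h4 := hρ (subset_tsupport _ h3)
      rw [mem_closedBall_zero_iff, norm_rot hJ hJi] at h4
      simpa using h4
    rw [IntegrableOn, ← Measure.prod_restrict, Measure.restrict_univ] at hi2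
    refine hi2.mono_measure (Measure.prod_mono ?_ le_rfl)
    rw [uIoc_of_le hT]
    exact Measure.restrict_mono Ioc_subset_Icc_self le_rfl
  rw [← intervalIntegral_integral_swap hIntg]
  simp [integral_comp_rot hJ hJi]

/-- The integral of the transplanted Hamiltonian agrees with that of the radial model. -/
theorem integral_cutoff_hamiltonian (hJ : ∀ x, J (J x) = -x)
    (hJi : ∀ x y, inner ℝ (J x) (J y) = inner ℝ x y) (hE : 2 < Module.finrank ℝ E)
    {a b : ℝ} {φ : E → E}
    (hφ : ContDiffOn ℝ ∞ φ {p : E | a < ‖p‖ ∧ ‖p‖ < b}) (hinj : InjOn φ {p : E | a < ‖p‖ ∧ ‖p‖ < b})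
    (hω : ∀ q ∈ {p : E | a < ‖p‖ ∧ ‖p‖ < b}, ∀ v w,
      inner ℝ (J (fderiv ℝ φ q v)) (fderiv ℝ φ q w) = inner ℝ (J v) w)
    {s₀ s₁ m : ℝ} (hs₀ : π * a ^ 2 < s₀) (hs₁ : s₁ < π * b ^ 2) (hb : 0 ≤ b)
    {f : ℝ → ℝ} (hf : ContDiff ℝ ∞ f) (hf0 : ∀ s ≤ s₀, f s = 0) (hf1 : ∀ s, s₁ ≤ s → f s = m)
    {H : E → ℝ} {g : E → E} (hH : ∀ z, HasFDerivAt H (innerSL ℝ (g z)) z) (hg : Continuous g)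
    (hgφ : ∀ p, a < ‖p‖ → ‖p‖ < b →
      g (φ p) = -J (fderiv ℝ φ p ((2 * π * deriv f (π * ‖p‖ ^ 2)) • J p)))
    (hg0 : ∀ z ∉ φ '' {p : E | s₀ ≤ π * ‖p‖ ^ 2 ∧ π * ‖p‖ ^ 2 ≤ s₁}, g z = 0)
    {C : ℝ} (hC : HasCompactSupport fun z => C - H z) :
    ∫ z, (C - H z) = ∫ p : E, (m - f (π * ‖p‖ ^ 2)) := by
  classical
  set A : Set E := {p : E | a < ‖p‖ ∧ ‖p‖ < b} with hAdef
  set K : Set E := {p : E | s₀ ≤ π * ‖p‖ ^ 2 ∧ π * ‖p‖ ^ 2 ≤ s₁} with hKdef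
  have hA : IsOpen A := (isOpen_lt continuous_const continuous_norm).inter
    (isOpen_lt continuous_norm continuous_const)
  have hcn : Continuous fun p : E => π * ‖p‖ ^ 2 := by fun_prop
  have hKA : K ⊆ A := fun p hp => by
    have h1 : π * a ^ 2 < π * ‖p‖ ^ 2 := hs₀.trans_le hp.1
    have h2 : π * ‖p‖ ^ 2 < π * b ^ 2 := hp.2.trans_lt hs₁
    exact ⟨lt_of_pow_lt_pow_left₀ 2 (norm_nonneg _) (lt_of_mul_lt_mul_left h1 pi_pos.le),
      lt_of_pow_lt_pow_left₀ 2 hb (lt_of_mul_lt_mul_left h2 pi_pos.le)⟩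
  have hKcl : IsClosed K := (isClosed_le continuous_const hcn).inter
    (isClosed_le hcn continuous_const)
  have hKc : IsCompact K := by
    refine (isCompact_closedBall (0 : E) b).of_isClosed_subset hKcl fun p hp => ?_
    simpa using (hKA hp).2.le
  have hdf : Continuous (deriv f) := hf.continuous_deriv (by simp)
  have hdf0 : ∀ p ∉ K, deriv f (π * ‖p‖ ^ 2) = 0 := fun p hp => by
    rw [hKdef, mem_ofPred_eq, not_and_or, not_le, not_le] at hp
    rcases hp with h | h
    · exact (Filter.EventuallyEq.deriv_eq (by
        filter_upwards [Iio_mem_nhds h] with s hs using hf0 s (le_of_lt hs))).trans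
        (deriv_const _ 0)
    · exact (Filter.EventuallyEq.deriv_eq (by
        filter_upwards [Ioi_mem_nhds h] with s hs using hf1 s (le_of_lt hs))).trans
        (deriv_const _ m)
  set α : E → ℝ := fun p => 2 * π * deriv f (π * ‖p‖ ^ 2) *
    inner ℝ (J (φ p)) (fderiv ℝ φ p (J p)) with hα
  have hα0 : ∀ p ∉ K, α p = 0 := fun p hp => by simp [hα, hdf0 p hp]
  have hαc : Continuous α := by
    refine continuous_iff_continuousAt.2 fun p => ?_
    by_cases hp : p ∈ A
    · have h1 : ContinuousAt φ p := hφ.continuousOn.continuousAt (hA.mem_nhds hp)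
      have h2 : ContinuousAt (fderiv ℝ φ) p :=
        (hφ.continuousOn_fderiv_of_isOpen hA (by simp)).continuousAt (hA.mem_nhds hp)
      have h3 : ContinuousAt (fun p : E => deriv f (π * ‖p‖ ^ 2)) p :=
        (hdf.comp hcn).continuousAt
      simp only [hα]
      fun_prop
    · have : α =ᶠ[𝓝 p] fun _ => 0 := by
        filter_upwards [hKcl.isOpen_compl.mem_nhds fun h => hp (hKA h)] with q hq using hα0 q hq
      exact continuousAt_const.congr this.symm
  have hαs : HasCompactSupport α := HasCompactSupport.intro hKc hα0
  -- the transplanted side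
  have h1 : Module.finrank ℝ E * ∫ z, (C - H z) = ∫ p, α p := by
    have hd : ∀ z, HasFDerivAt (fun z => C - H z) (innerSL ℝ (-g z)) z := fun z => by
      have := (hH z).const_sub C
      rwa [← map_neg] at this
    rw [finrank_mul_integral_eq_neg_integral_inner hd hg.neg hC]
    have h2 : ∫ z, inner ℝ (-g z) z = ∫ z in φ '' A, inner ℝ (-g z) z := by
      refine (setIntegral_eq_integral_of_forall_compl_eq_zero fun z hz => ?_).symm
      rw [hg0 z fun h => hz (image_mono hKA h), neg_zero, inner_zero_left]
    rw [h2, integral_image_eq_integral_abs_det_fderiv_smul volume hA.measurableSet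
      (f' := fderiv ℝ φ) (fun p hp => ((hφ.contDiffAt (hA.mem_nhds hp)).differentiableAt
        (by simp)).hasFDerivAt.hasFDerivWithinAt) hinj, ← integral_neg,
      ← setIntegral_eq_integral_of_forall_compl_eq_zero
        fun p (hp : p ∉ A) => hα0 p fun h => hp (hKA h)]
    refine setIntegral_congr_fun hA.measurableSet fun p hp => ?_
    simp only [abs_det_of_symplectic hJ (hω p hp), one_smul, hgφ p hp.1 hp.2, neg_neg, hα,
      map_smul, inner_smul_left]
    have h3 : inner ℝ (J (fderiv ℝ φ p (J p))) (φ p) =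
        -inner ℝ (J (φ p)) (fderiv ℝ φ p (J p)) := by
      rw [inner_J_left hJ hJi, real_inner_comm]
    rw [h3]
    simp
  -- the radial side
  have hfs : HasCompactSupport fun p : E => m - f (π * ‖p‖ ^ 2) := by
    refine HasCompactSupport.intro (isCompact_closedBall (0 : E) b) fun p hp => ?_
    rw [mem_closedBall_zero_iff, not_le] at hp
    rw [hf1 _ (hs₁.le.trans (by gcongr)), sub_self]
  have h2 : Module.finrank ℝ E * ∫ p : E, (m - f (π * ‖p‖ ^ 2)) =
      ∫ p : E, 2 * π * deriv f (π * ‖p‖ ^ 2) * ‖p‖ ^ 2 := by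
    have hd : ∀ p : E, HasFDerivAt (fun p : E => m - f (π * ‖p‖ ^ 2))
        (innerSL ℝ (-((2 * π * deriv f (π * ‖p‖ ^ 2)) • p))) p := fun p => by
      have h3 : HasFDerivAt (fun p : E => π * ‖p‖ ^ 2) (π • (2 • innerSL ℝ p)) p :=
        ((hasStrictFDerivAt_norm_sq p).hasFDerivAt).const_mul π
      have h4 := ((hf.differentiable (by simp)) (π * ‖p‖ ^ 2)).hasDerivAt.comp_hasFDerivAt p h3
      refine (h4.const_sub m).congr_fderiv ?_
      ext v
      simp
      ring
    rw [finrank_mul_integral_eq_neg_integral_inner hd (by fun_prop) hfs, ← integral_neg]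
    refine integral_congr_ae (Filter.Eventually.of_forall fun p => ?_)
    simp [inner_smul_left]
  have h3 : 2 * π * ∫ p, α p = 2 * π * ∫ p : E, 2 * π * deriv f (π * ‖p‖ ^ 2) * ‖p‖ ^ 2 := by
    rw [← integral_integral_rot hJ hJi hαc hαs (2 * π) two_pi_pos.le, ← integral_const_mul]
    refine integral_congr_ae (Filter.Eventually.of_forall fun p => ?_)
    simp only [hα, norm_rot hJ hJi, intervalIntegral.integral_const_mul]
    by_cases hp : p ∈ K
    · obtain ⟨w, hw, hwp, hwJ⟩ := exists_orthogonal_pair hE p (J p) ‖p‖ (norm_nonneg _)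
      have h4 := integral_action_rot_eq hJ hJi hA hφ hω (p := p) (w := w) (fun q hq => by
        rw [mem_sphere_zero_iff_norm] at hq
        simpa [hAdef, hq] using hKA hp) hw hwp hwJ 0 1
      simp only [Int.cast_one, mul_one, zero_add] at h4
      rw [h4]
      ring
    · rw [hdf0 p hp]
      simp
  have h4 := mul_left_cancel₀ two_pi_pos.ne' h3
  rw [← h1, ← h2] at h4
  exact mul_left_cancel₀ (by positivity) h4

end VolumeIdentity

section Dichotomy

variable {E : Type*} [NormedAddCommGroup E] [InnerProductSpace ℝ E] [FiniteDimensional ℝ E]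
  [MeasurableSpace E] [BorelSpace E] {J : E →L[ℝ] E}

/-- The Hamiltonian transplanted by an embedding of an annulus which avoids an inner region `I` and
an outer region `O` is constant on both regions.  Its value is maximal on `O`, and if it does not
vanish on `I`, then the region between `I` and `O` has at least the volume of the inner ball. -/
theorem exists_cutoff_hamiltonian_dichotomy (hJ : ∀ x, J (J x) = -x)
    (hJi : ∀ x y, inner ℝ (J x) (J y) = inner ℝ x y) (hE : 2 < Module.finrank ℝ E)
    {a b r₀ r₁ : ℝ} (ha : 0 ≤ a) (har : a < r₀) (hr : r₀ ≤ r₁) (hrb : r₁ < b) {φ : E → E}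
    (hφ : ContDiffOn ℝ ∞ φ {p : E | a < ‖p‖ ∧ ‖p‖ < b}) (hinj : InjOn φ {p : E | a < ‖p‖ ∧ ‖p‖ < b})
    (hω : ∀ q ∈ {p : E | a < ‖p‖ ∧ ‖p‖ < b}, ∀ v w,
      inner ℝ (J (fderiv ℝ φ q v)) (fderiv ℝ φ q w) = inner ℝ (J v) w)
    {I O : Set E} (hI : IsPreconnected I) (hIm : MeasurableSet I)
    (hO : IsPreconnected O) (hOb : IsBounded Oᶜ)
    (hφI : ∀ p, a < ‖p‖ → ‖p‖ < b → φ p ∉ I) (hφO : ∀ p, a < ‖p‖ → ‖p‖ < b → φ p ∉ O)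
    {f : ℝ → ℝ} {m : ℝ} (hm : 0 < m) (hf : ContDiff ℝ ∞ f) (hf0 : ∀ s ≤ π * r₀ ^ 2, f s = 0)
    (hf1 : ∀ s, π * r₁ ^ 2 ≤ s → f s = m) (hfr : ∀ s, f s ∈ Icc 0 m) :
    volume.real (ball (0 : E) r₀) ≤ volume.real (I ∪ O)ᶜ ∨
    volume.real I ≤ volume.real (ball (0 : E) r₁) ∧
    ∃ (H : E → ℝ) (g : E → E), (∀ z, HasFDerivAt H (innerSL ℝ (g z)) z) ∧ ContDiff ℝ 1 g ∧
      IsCompact (φ '' {p : E | π * r₀ ^ 2 ≤ π * ‖p‖ ^ 2 ∧ π * ‖p‖ ^ 2 ≤ π * r₁ ^ 2}) ∧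
      (∀ p, a < ‖p‖ → ‖p‖ < b → H (φ p) = f (π * ‖p‖ ^ 2) ∧
        g (φ p) = -J (fderiv ℝ φ p ((2 * π * deriv f (π * ‖p‖ ^ 2)) • J p))) ∧
      (∀ z ∉ φ '' {p : E | π * r₀ ^ 2 ≤ π * ‖p‖ ^ 2 ∧ π * ‖p‖ ^ 2 ≤ π * r₁ ^ 2},
        g z = 0 ∧ (H z = 0 ∨ H z = m)) ∧
      (∀ z, H z ∈ Icc 0 m) ∧ (∀ z ∈ O, H z = m) ∧ ∀ z ∈ I, H z = 0 := by
  have hr0 : 0 < r₀ := ha.trans_lt har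
  have hr1 : 0 < r₁ := hr0.trans_le hr
  have hb : 0 ≤ b := (hr1.trans hrb).le
  have hs0 : π * a ^ 2 < π * r₀ ^ 2 := by gcongr
  have hs1 : π * r₁ ^ 2 < π * b ^ 2 := by gcongr
  have hs : π * r₀ ^ 2 ≤ π * r₁ ^ 2 := by gcongr
  have hE1 : 1 < Module.rank ℝ E := by
    rw [← Module.finrank_eq_rank]
    exact_mod_cast (by omega : 1 < Module.finrank ℝ E)
  obtain ⟨H, g, hH, hg, hK, hHφ, hH0⟩ := exists_cutoff_hamiltonian hJ hE1 ha hφ hinj hω hs0 hs hs1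
    hb hf hf0 hf1
  set K : Set E := {p : E | π * r₀ ^ 2 ≤ π * ‖p‖ ^ 2 ∧ π * ‖p‖ ^ 2 ≤ π * r₁ ^ 2} with hKdef
  have hKA : ∀ p ∈ K, a < ‖p‖ ∧ ‖p‖ < b := fun p hp => by
    have h1 : π * a ^ 2 < π * ‖p‖ ^ 2 := hs0.trans_le hp.1
    have h2 : π * ‖p‖ ^ 2 < π * b ^ 2 := hp.2.trans_lt hs1
    exact ⟨lt_of_pow_lt_pow_left₀ 2 (norm_nonneg _) (lt_of_mul_lt_mul_left h1 pi_pos.le),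
      lt_of_pow_lt_pow_left₀ 2 hb (lt_of_mul_lt_mul_left h2 pi_pos.le)⟩
  have hHc : Continuous H := continuous_iff_continuousAt.2 fun z => (hH z).continuousAt
  have hrange : ∀ z, H z ∈ Icc 0 m := fun z => by
    by_cases hz : z ∈ φ '' K
    · obtain ⟨p, hp, rfl⟩ := hz
      rw [(hHφ p (hKA p hp).1 (hKA p hp).2).1]
      exact hfr _
    · rcases (hH0 z hz).2 with h | h <;> rw [h] <;> simp [hm.le]
  have hconst : ∀ S : Set E, IsPreconnected S → (∀ p, a < ‖p‖ → ‖p‖ < b → φ p ∉ S) →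
      (∀ z ∈ S, H z = 0) ∨ ∀ z ∈ S, H z = m := fun S hS hφS => by
    have hmaps : MapsTo H S ({0, m} : Set ℝ) := fun z hz => by
      refine (hH0 z ?_).2
      rintro ⟨p, hp, rfl⟩
      exact hφS p (hKA p hp).1 (hKA p hp).2 hz
    rcases S.eq_empty_or_nonempty with rfl | ⟨z₀, hz₀⟩
    · simp
    · have h : ∀ z ∈ S, H z = H z₀ := fun z hz =>
        hS.constant_of_mapsTo (Set.toFinite _).isDiscrete hHc.continuousOn hmaps hz hz₀
      rcases hmaps hz₀ with h0 | h0
      · exact Or.inl fun z hz => (h z hz).trans h0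
      · exact Or.inr fun z hz => (h z hz).trans h0
  -- the radial integral
  have hcf : Continuous fun p : E => m - f (π * ‖p‖ ^ 2) := by
    have := hf.continuous
    fun_prop
  have hfs : HasCompactSupport fun p : E => m - f (π * ‖p‖ ^ 2) := by
    refine HasCompactSupport.intro (isCompact_closedBall (0 : E) b) fun p hp => ?_
    rw [mem_closedBall_zero_iff, not_le] at hp
    rw [hf1 _ (hs1.le.trans (by gcongr)), sub_self]
  have hfi := hcf.integrable_of_hasCompactSupport (μ := volume) hfs
  have hlow : m * volume.real (ball (0 : E) r₀) ≤ ∫ p : E, (m - f (π * ‖p‖ ^ 2)) := by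
    have h1 : ∫ p in ball (0 : E) r₀, (m - f (π * ‖p‖ ^ 2)) = m * volume.real (ball (0 : E) r₀) := by
      rw [setIntegral_congr_fun (g := fun _ => m) measurableSet_ball, setIntegral_const, smul_eq_mul,
        mul_comm]
      intro p hp
      rw [mem_ball_zero_iff] at hp
      simp only
      rw [hf0 _ (by gcongr), sub_zero]
    rw [← h1]
    exact setIntegral_le_integral hfi (Filter.Eventually.of_forall fun p => sub_nonneg.2 (hfr _).2)
  have hupp : ∫ p : E, (m - f (π * ‖p‖ ^ 2)) ≤ m * volume.real (ball (0 : E) r₁) := by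
    rw [← setIntegral_eq_integral_of_forall_compl_eq_zero (s := ball (0 : E) r₁)]
    · rw [mul_comm, ← smul_eq_mul, ← setIntegral_const]
      refine setIntegral_mono hfi.integrableOn ?_ fun p => ?_
      · exact integrableOn_const measure_ball_lt_top.ne
      · simpa using (hfr _).1
    · intro p hp
      rw [mem_ball_zero_iff, not_lt] at hp
      rw [hf1 _ (by gcongr), sub_self]
  have hident : ∀ C : ℝ, (∀ z ∈ O, H z = C) → Integrable (fun z => C - H z) ∧
      ∫ z, (C - H z) = ∫ p : E, (m - f (π * ‖p‖ ^ 2)) := fun C hC => by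
    have hs : HasCompactSupport fun z => C - H z := by
      refine HasCompactSupport.of_support_subset_isCompact hOb.isCompact_closure ?_
      refine Subset.trans (fun z hz => ?_) subset_closure
      exact fun hzO => hz (by simp [hC z hzO])
    exact ⟨(continuous_const.sub hHc).integrable_of_hasCompactSupport hs,
      integral_cutoff_hamiltonian hJ hJi hE hφ hinj hω hs0 hs1 hb hf hf0 hf1 hH hg.continuous
        (fun p h1 h2 => (hHφ p h1 h2).2) (fun z hz => (hH0 z hz).1) hs⟩
  have hpos : 0 < m * volume.real (ball (0 : E) r₀) :=
    mul_pos hm (ENNReal.toReal_pos (measure_ball_pos _ _ hr0).ne' measure_ball_lt_top.ne)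
  have hOval : ∀ z ∈ O, H z = m := (hconst O hO hφO).resolve_left fun h0 => by
    have h1 := (hident 0 h0).2
    have h2 : ∫ z, (0 - H z) ≤ 0 := integral_nonpos fun z => by simpa using (hrange z).1
    linarith
  obtain ⟨hIntg, hval⟩ := hident m hOval
  have hnn : ∀ z, 0 ≤ m - H z := fun z => sub_nonneg.2 (hrange z).2
  rcases hconst I hI hφI with hI0 | hI1
  · refine Or.inr ⟨?_, H, g, hH, hg, hK, hHφ, hH0, hrange, hOval, hI0⟩
    have h1 : ∫ z in I, (m - H z) = m * volume.real I := by
      rw [setIntegral_congr_fun (g := fun _ => m) hIm, setIntegral_const, smul_eq_mul, mul_comm]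
      intro z hz
      simp [hI0 z hz]
    have h2 := setIntegral_le_integral (s := I) hIntg (Filter.Eventually.of_forall hnn)
    exact le_of_mul_le_mul_left (by linarith) hm
  · refine Or.inl ?_
    have hfin : volume (I ∪ O)ᶜ ≠ ⊤ := (hOb.subset (by simp)).measure_lt_top.ne
    have h1 : ∫ z, (m - H z) ≤ m * volume.real (I ∪ O)ᶜ := by
      rw [← setIntegral_eq_integral_of_forall_compl_eq_zero (s := (I ∪ O)ᶜ)]
      · rw [mul_comm, ← smul_eq_mul, ← setIntegral_const]
        refine setIntegral_mono hIntg.integrableOn (integrableOn_const hfin) fun z => ?_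
        simpa using (hrange z).1
      · intro z hz
        rw [notMem_compl_iff] at hz
        rcases hz with hz | hz
        · simp [hI1 z hz]
        · simp [hOval z hz]
    exact le_of_mul_le_mul_left (by linarith) hm

end Dichotomy

section Profile

theorem hasDerivAt_expNegInvGlue (x : ℝ) :
    HasDerivAt expNegInvGlue (x⁻¹ ^ 2 * expNegInvGlue x) x := by
  simpa using expNegInvGlue.hasDerivAt_polynomial_eval_inv_mul 1 x

theorem hasDerivAt_smoothTransition (x : ℝ) :
    HasDerivAt smoothTransition
      ((x⁻¹ ^ 2 + (1 - x)⁻¹ ^ 2) * (expNegInvGlue x * expNegInvGlue (1 - x)) /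
        (expNegInvGlue x + expNegInvGlue (1 - x)) ^ 2) x := by
  have h1 := hasDerivAt_expNegInvGlue x
  have h2 : HasDerivAt (fun x => expNegInvGlue (1 - x))
      (-((1 - x)⁻¹ ^ 2 * expNegInvGlue (1 - x))) x := by
    have := HasDerivAt.comp_const_sub 1 x (hasDerivAt_expNegInvGlue (1 - x))
    exact this
  refine (h1.fun_div (h1.fun_add h2) (smoothTransition.pos_denom x).ne').congr_deriv ?_
  congr 1
  ring

theorem deriv_smoothTransition_nonneg (x : ℝ) : 0 ≤ deriv smoothTransition x := by
  rw [(hasDerivAt_smoothTransition x).deriv]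
  have := expNegInvGlue.nonneg x
  have := expNegInvGlue.nonneg (1 - x)
  positivity

theorem exists_le_deriv_smoothTransition {δ : ℝ} (hδ : 0 < δ) :
    ∃ η > 0, ∀ x, deriv smoothTransition x ≤ η → smoothTransition x < δ ∨
      1 - δ < smoothTransition x := by
  have hc : Continuous smoothTransition := smoothTransition.continuous
  have hdc : Continuous (deriv smoothTransition) :=
    (smoothTransition.contDiff (n := 1)).continuous_deriv le_rfl
  set S : Set ℝ := Icc 0 1 ∩ {x | δ ≤ smoothTransition x ∧ smoothTransition x ≤ 1 - δ} with hS
  have hSc : IsCompact S := isCompact_Icc.inter_right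
    ((isClosed_le continuous_const hc).inter (isClosed_le hc continuous_const))
  have hmem : ∀ x, δ ≤ smoothTransition x → smoothTransition x ≤ 1 - δ → x ∈ Ioo 0 1 :=
    fun x h1 h2 => by
      constructor
      · by_contra! h
        rw [smoothTransition.zero_of_nonpos h] at h1
        linarith
      · by_contra! h
        rw [smoothTransition.one_of_one_le h] at h2
        linarith
  have hpos : ∀ x ∈ S, 0 < deriv smoothTransition x := fun x hx => by
    have h := hmem x hx.2.1 hx.2.2
    rw [(hasDerivAt_smoothTransition x).deriv]
    have := expNegInvGlue.pos_of_pos h.1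
    have := expNegInvGlue.pos_of_pos (sub_pos.2 h.2)
    have := h.1
    positivity
  rcases S.eq_empty_or_nonempty with h0 | hne
  · refine ⟨1, one_pos, fun x _ => ?_⟩
    by_contra! h
    have : x ∈ S := ⟨Ioo_subset_Icc_self (hmem x h.1 h.2), h⟩
    simp [h0] at this
  · obtain ⟨x₀, hx₀, hmin⟩ := hSc.exists_isMinOn hne hdc.continuousOn
    refine ⟨deriv smoothTransition x₀ / 2, half_pos (hpos x₀ hx₀), fun x hx => ?_⟩
    by_contra! h
    have h1 : x ∈ S := ⟨Ioo_subset_Icc_self (hmem x h.1 h.2), h⟩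
    have h2 : deriv smoothTransition x₀ ≤ deriv smoothTransition x := hmin h1
    have := hpos x₀ hx₀
    linarith

/-- Steep smooth profiles: the slope is one only near the two ends of the transition. -/
theorem exists_steep_profile {m δ : ℝ} (hm : 0 < m) (hδ : 0 < δ) :
    ∃ Δ > 0, ∀ s₀ s₁ : ℝ, s₀ < s₁ → s₁ - s₀ ≤ Δ → ∃ f : ℝ → ℝ, ContDiff ℝ ∞ f ∧
      (∀ s ≤ s₀, f s = 0) ∧ (∀ s, s₁ ≤ s → f s = m) ∧ (∀ s, f s ∈ Icc 0 m) ∧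
      (∀ s, 0 ≤ deriv f s) ∧ ∀ s, deriv f s = 1 → f s < δ ∨ m - δ < f s := by
  obtain ⟨η, hη, h⟩ := exists_le_deriv_smoothTransition (div_pos hδ hm)
  refine ⟨η * m, by positivity, fun s₀ s₁ hs hΔ => ?_⟩
  have hd : 0 < s₁ - s₀ := sub_pos.2 hs
  have hderiv : ∀ s, deriv (fun s => m * smoothTransition ((s - s₀) / (s₁ - s₀))) s =
      m * (deriv smoothTransition ((s - s₀) / (s₁ - s₀)) / (s₁ - s₀)) := fun s => by
    have h1 : HasDerivAt (fun s => (s - s₀) / (s₁ - s₀)) (1 / (s₁ - s₀)) s :=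
      ((hasDerivAt_id s).sub_const s₀).div_const _
    have h2 := (hasDerivAt_smoothTransition ((s - s₀) / (s₁ - s₀))).differentiableAt.hasDerivAt.comp
      s h1
    have h3 := (h2.const_mul m).deriv
    rw [mul_one_div] at h3
    exact h3
  refine ⟨fun s => m * smoothTransition ((s - s₀) / (s₁ - s₀)), ?_, ?_, ?_, ?_, ?_, ?_⟩
  · exact contDiff_const.mul (smoothTransition.contDiff.comp (by fun_prop))
  · intro s hs'
    simp only
    rw [smoothTransition.zero_of_nonpos (div_nonpos_of_nonpos_of_nonneg (by linarith) hd.le),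
      mul_zero]
  · intro s hs'
    simp only
    rw [smoothTransition.one_of_one_le (by rw [one_le_div hd]; linarith), mul_one]
  · intro s
    exact ⟨mul_nonneg hm.le (smoothTransition.nonneg _),
      mul_le_of_le_one_right hm.le (smoothTransition.le_one _)⟩
  · intro s
    rw [hderiv]
    exact mul_nonneg hm.le (div_nonneg (deriv_smoothTransition_nonneg _) hd.le)
  · intro s hs'
    rw [hderiv, ← mul_div_assoc, div_eq_one_iff_eq hd.ne'] at hs'
    rcases h ((s - s₀) / (s₁ - s₀)) (by nlinarith) with h1 | h1
    · left
      rwa [lt_div_iff₀ hm, mul_comm] at h1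
    · right
      rw [sub_lt_comm, lt_div_iff₀ hm] at h1
      simp only
      linarith

end Profile

section QuadraticExtension

/-- A convex-type cutoff: the function is constant below `M` and grows with slope one above `m`. -/
theorem exists_slope_one_extension {M m : ℝ} (hM : 0 ≤ M) (hMm : M < m) :
    ∃ χ γ : ℝ → ℝ, ContDiff ℝ ∞ χ ∧ (∀ s, HasDerivAt γ (χ s) s) ∧ (∀ s, χ s ∈ Icc 0 1) ∧
      (∀ s ≤ M, χ s = 0 ∧ γ s = m) ∧ (∀ s, m ≤ s → χ s = 1) ∧ (∀ s, m ≤ γ s) ∧ (∀ s, s ≤ γ s) ∧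
      ∀ s, 0 ≤ s → γ s ≤ m + s := by
  have hd : 0 < m - M := sub_pos.2 hMm
  let χ : ℝ → ℝ := fun s => smoothTransition ((s - M) / (m - M))
  have hχ : ContDiff ℝ ∞ χ := smoothTransition.contDiff.comp (by fun_prop)
  have hχi : ∀ a b, IntervalIntegrable χ volume a b := fun a b =>
    hχ.continuous.intervalIntegrable a b
  have hχ0 : ∀ s ≤ M, χ s = 0 := fun s hs =>
    smoothTransition.zero_of_nonpos (div_nonpos_of_nonpos_of_nonneg (by linarith) hd.le)
  have hχ1 : ∀ s, m ≤ s → χ s = 1 := fun s hs =>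
    smoothTransition.one_of_one_le (by rw [one_le_div hd]; linarith)
  have hχr : ∀ s, χ s ∈ Icc 0 1 := fun s => ⟨smoothTransition.nonneg _, smoothTransition.le_one _⟩
  have hγ0 : ∀ s ≤ M, ∫ x in M..s, χ x = 0 := fun s hs => by
    rw [intervalIntegral.integral_congr (g := fun _ => 0)]
    · simp
    · intro x hx
      rw [uIcc_of_ge hs] at hx
      exact hχ0 x hx.2
  have hγnn : ∀ s, 0 ≤ ∫ x in M..s, χ x := fun s => by
    rcases le_total s M with h | h
    · rw [hγ0 s h]
    · exact intervalIntegral.integral_nonneg h fun x _ => (hχr x).1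
  refine ⟨χ, fun s => m + ∫ x in M..s, χ x, hχ, fun s => ?_, hχr, fun s hs => ⟨hχ0 s hs, ?_⟩,
    hχ1, fun s => ?_, fun s => ?_, fun s hs => ?_⟩
  · exact (intervalIntegral.integral_hasDerivAt_right (hχi M s)
      (hχ.continuous.stronglyMeasurableAtFilter _ _) hχ.continuous.continuousAt).const_add m
  · simp [hγ0 s hs]
  · simpa using hγnn s
  · simp only
    rcases le_total s m with h | h
    · linarith [hγnn s]
    · have h1 : ∫ x in m..s, χ x = s - m := by
        rw [intervalIntegral.integral_congr (g := fun _ => 1)]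
        · simp
        · intro x hx
          rw [uIcc_of_le h] at hx
          exact hχ1 x hx.1
      have h2 := intervalIntegral.integral_add_adjacent_intervals (hχi M m) (hχi m s)
      linarith [hγnn m]
  · simp only
    rcases le_total s M with h | h
    · rw [hγ0 s h]
      linarith
    · have h1 : ∫ x in M..s, χ x ≤ ∫ x in M..s, (1 : ℝ) :=
        intervalIntegral.integral_mono_on h (hχi M s) (by simp) fun x _ => (hχr x).2
      simp only [intervalIntegral.integral_const, smul_eq_mul, mul_one] at h1
      linarith

variable {E : Type*} [NormedAddCommGroup E] [InnerProductSpace ℝ E] {J : E →L[ℝ] E}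

/-- The descent inequality for a function with Lipschitz gradient. -/
theorem le_of_lipschitz_gradient {H : E → ℝ} {g : E → E} {G : NNReal}
    (hH : ∀ z, HasFDerivAt H (innerSL ℝ (g z)) z) (hg : LipschitzWith G g) (z b : E) :
    H z + inner ℝ (g z) b - G * ‖b‖ ^ 2 ≤ H (z + b) := by
  have h := (convex_closedBall z ‖b‖).norm_image_sub_le_of_norm_hasFDerivWithin_le' (𝕜 := ℝ)
    (f := H) (f' := fun w => innerSL ℝ (g w)) (φ := innerSL ℝ (g z)) (C := G * ‖b‖) (x := z)
    (y := z + b) (fun w _ => (hH w).hasFDerivWithinAt) (fun w hw => ?_) (by simp) (by simp)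
  · rw [add_sub_cancel_left, innerSL_apply_apply, norm_eq_abs] at h
    have := neg_le_of_abs_le h
    nlinarith
  · rw [← map_sub, innerSL_apply_norm]
    refine (hg.norm_sub_le w z).trans ?_
    gcongr
    rwa [← mem_closedBall_iff_norm]

/-- The quadratic form generator `σ + π P`, with `P` the orthogonal projection to the complex line
spanned by `e`. -/
def lineGenerator (J : E →L[ℝ] E) (e : E) (σ : ℝ) : E →L[ℝ] E :=
  σ • ContinuousLinearMap.id ℝ E +
    π • ((innerSL ℝ e).smulRight e + (innerSL ℝ (J e)).smulRight (J e))

theorem lineGenerator_apply (e : E) (σ : ℝ) (x : E) : lineGenerator J e σ x =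
    σ • x + π • ((inner ℝ e x : ℝ) • e + (inner ℝ (J e) x : ℝ) • J e) := by
  simp [lineGenerator]

theorem inner_lineGenerator_left (e : E) (σ : ℝ) (x y : E) :
    inner ℝ (lineGenerator J e σ x) y =
      σ * inner ℝ x y + π * (inner ℝ e x * inner ℝ e y + inner ℝ (J e) x * inner ℝ (J e) y) := by
  simp [lineGenerator_apply, inner_add_left, inner_smul_left]
  ring

theorem lineGenerator_J (hJ : ∀ x, J (J x) = -x)
    (hJi : ∀ x y, inner ℝ (J x) (J y) = inner ℝ x y) (e : E) (σ : ℝ) (x : E) :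
    lineGenerator J e σ (J x) = J (lineGenerator J e σ x) := by
  have h1 : inner ℝ e (J x) = -inner ℝ (J e) x := by rw [inner_J_left hJ hJi, neg_neg]
  simp only [lineGenerator_apply, map_add, map_smul, hJ, hJi, h1]
  module

theorem lineGenerator_self (hJ : ∀ x, J (J x) = -x)
    (hJi : ∀ x y, inner ℝ (J x) (J y) = inner ℝ x y) {e : E} (he : ‖e‖ = 1) (σ : ℝ) :
    lineGenerator J e σ e = (π + σ) • e := by
  have h1 : inner ℝ (J e) e = 0 := by
    rw [inner_J_self hJ hJi]
  simp only [lineGenerator_apply, h1, real_inner_self_eq_norm_sq, he]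
  module

theorem sq_inner_add_sq_inner_J_le (hJ : ∀ x, J (J x) = -x)
    (hJi : ∀ x y, inner ℝ (J x) (J y) = inner ℝ x y) {e : E} (he : ‖e‖ = 1) (x : E) :
    inner ℝ e x ^ 2 + inner ℝ (J e) x ^ 2 ≤ ‖x‖ ^ 2 := by
  have h1 : inner ℝ (J e) e = 0 := by rw [inner_J_self hJ hJi]
  have h2 : inner ℝ e (J e) = 0 := by rw [real_inner_comm, h1]
  have h3 : inner ℝ (J e) (J e) = 1 := by rw [hJi, real_inner_self_eq_norm_sq, he, one_pow]
  have h4 : inner ℝ e e = 1 := by rw [real_inner_self_eq_norm_sq, he, one_pow]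
  have h := real_inner_self_nonneg
    (x := x - ((inner ℝ e x : ℝ) • e + (inner ℝ (J e) x : ℝ) • J e))
  simp only [inner_sub_left, inner_sub_right, inner_add_left, inner_add_right, inner_smul_left,
    inner_smul_right, h1, h2, h3, h4, real_inner_self_eq_norm_sq x, real_inner_comm e x,
    real_inner_comm (J e) x, conj_trivial] at h
  nlinarith

theorem le_norm_lineGenerator (hJ : ∀ x, J (J x) = -x)
    (hJi : ∀ x y, inner ℝ (J x) (J y) = inner ℝ x y) {e : E} (he : ‖e‖ = 1) {σ : ℝ}
    (hσ : 0 < σ) (hσπ : σ ≤ π / 2) (l : ℤ) (x : E) :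
    σ * ‖x‖ ≤ ‖(π * l) • x - lineGenerator J e σ x‖ := by
  have h1 : inner ℝ (J e) e = 0 := by rw [inner_J_self hJ hJi]
  have h2 : inner ℝ e (J e) = 0 := by rw [real_inner_comm, h1]
  have h3 : inner ℝ (J e) (J e) = 1 := by rw [hJi, real_inner_self_eq_norm_sq, he, one_pow]
  have h4 : inner ℝ e e = 1 := by rw [real_inner_self_eq_norm_sq, he, one_pow]
  have hb := sq_inner_add_sq_inner_J_le hJ hJi he x
  have hgap : ∀ l : ℤ, σ ^ 2 ≤ (π * l - σ) ^ 2 := fun l => by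
    rcases le_or_gt l 0 with h | h
    · have : (l : ℝ) ≤ 0 := by exact_mod_cast h
      nlinarith [pi_pos, mul_nonneg pi_pos.le (neg_nonneg.2 this)]
    · have : (1 : ℝ) ≤ l := by exact_mod_cast h
      have h5 : σ ≤ π * l - σ := by nlinarith [pi_pos]
      gcongr
  have g1 := hgap l
  have g2 := hgap (l - 1)
  push_cast at g2
  have h : ‖(π * l) • x - lineGenerator J e σ x‖ ^ 2 =
      (π * l - σ) ^ 2 * (‖x‖ ^ 2 - (inner ℝ e x ^ 2 + inner ℝ (J e) x ^ 2)) +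
      (π * (l - 1) - σ) ^ 2 * (inner ℝ e x ^ 2 + inner ℝ (J e) x ^ 2) := by
    rw [← real_inner_self_eq_norm_sq]
    simp only [lineGenerator_apply, inner_sub_left, inner_sub_right, inner_add_left,
      inner_add_right, inner_smul_left, inner_smul_right, h1, h2, h3, h4,
      real_inner_self_eq_norm_sq x, real_inner_comm e x, real_inner_comm (J e) x, conj_trivial]
    ring
  refine (pow_le_pow_iff_left₀ (by positivity) (norm_nonneg _) two_ne_zero).1 ?_
  rw [h]
  nlinarith [mul_le_mul_of_nonneg_right g1 (sub_nonneg.2 hb), mul_le_mul_of_nonneg_right g2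
    (add_nonneg (sq_nonneg (inner ℝ e x)) (sq_nonneg (inner ℝ (J e) x)))]

end QuadraticExtension

section ExtendedOrbit

variable {E : Type*} [NormedAddCommGroup E] [InnerProductSpace ℝ E] [FiniteDimensional ℝ E]
  {J : E →L[ℝ] E}

/-- A Hamiltonian which is constant outside a region that is thin in one complex direction can be
extended quadratically so that the extension has a periodic orbit of small positive action. -/
theorem exists_periodic_orbit_extension (hJ : ∀ x, J (J x) = -x)
    (hJi : ∀ x y, inner ℝ (J x) (J y) = inner ℝ x y) {e : E} (he : ‖e‖ = 1) {σ : ℝ}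
    (hσ : 0 < σ) (hσπ : σ ≤ π / 2) {M m : ℝ} (hM : 0 < M) (hMm : M < m)
    {H : E → ℝ} {g : E → E} (hH : ∀ z, HasFDerivAt H (innerSL ℝ (g z)) z) (hg : ContDiff ℝ 1 g)
    (hgs : HasCompactSupport g) (hHr : ∀ z, H z ∈ Icc 0 m) (hH0 : ∀ᶠ z in 𝓝 0, H z = 0)
    {O : Set E} (hO : ∀ z ∈ O, H z = m)
    (hOM : ∀ z ∉ O, σ * ‖z‖ ^ 2 + π * (inner ℝ e z ^ 2 + inner ℝ (J e) z ^ 2) ≤ M) :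
    ∃ (H' : E → ℝ) (g' : E → E), (∃ G, LipschitzWith G g') ∧
      (∀ z ∉ O, g' z = g z ∧ H' z = H z) ∧
      (∀ z, g z = 0 → (H z = 0 ∨ H z = m) → 2⁻¹ * inner ℝ (g' z) z ≤ H' z) ∧
      ∃ z : ℝ → E, (∀ t ∈ Icc (0 : ℝ) 1, HasDerivWithinAt z (J (g' (z t))) (Icc 0 1) t) ∧
        z 1 = z 0 ∧ 0 < ∫ t in (0 : ℝ)..1, (2⁻¹ * inner ℝ (g' (z t)) (z t) - H' (z t)) ∧
        ∫ t in (0 : ℝ)..1, (2⁻¹ * inner ℝ (g' (z t)) (z t) - H' (z t)) ≤ M := by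
  obtain ⟨χ, γ, hχ, hγ, hχr, hlow, hχ1, hγm, hγs, hγup⟩ := exists_slope_one_extension hM.le hMm
  have hm : 0 < m := hM.trans hMm
  set S : E →L[ℝ] E := lineGenerator J e σ with hS
  set Q : E → ℝ := fun z => inner ℝ (S z) z with hQ
  have hQe : ∀ z, Q z = σ * ‖z‖ ^ 2 + π * (inner ℝ e z ^ 2 + inner ℝ (J e) z ^ 2) := fun z => by
    simp only [hQ, hS, inner_lineGenerator_left, real_inner_self_eq_norm_sq]
    ring
  have hQlow : ∀ z, σ * ‖z‖ ^ 2 ≤ Q z := fun z => by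
    rw [hQe]
    have : 0 ≤ π * (inner ℝ e z ^ 2 + inner ℝ (J e) z ^ 2) := by positivity
    linarith
  have hQ0 : ∀ z, 0 ≤ Q z := fun z => le_trans (by positivity) (hQlow z)
  have hQup : ∀ z, Q z ≤ (σ + π) * ‖z‖ ^ 2 := fun z => by
    rw [hQe]
    have := mul_le_mul_of_nonneg_left (sq_inner_add_sq_inner_J_le hJ hJi he z) pi_pos.le
    linarith
  have hQd : ∀ z, HasFDerivAt Q (innerSL ℝ ((2 : ℝ) • S z)) z := fun z => by
    refine ((S.hasFDerivAt (x := z)).inner ℝ (hasFDerivAt_id z)).congr_fderiv ?_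
    ext v
    have h1 : inner ℝ (S v) z = inner ℝ (S z) v := by
      simp only [hS, inner_lineGenerator_left, real_inner_comm v z]
      ring
    simp [h1]
    ring
  have hQc : ContDiff ℝ 1 Q := S.contDiff.inner ℝ contDiff_id
  set H' : E → ℝ := fun z => H z + γ (Q z) - m with hH'
  set g' : E → E := fun z => g z + χ (Q z) • (2 : ℝ) • S z with hg'
  have hH'd : ∀ z, HasFDerivAt H' (innerSL ℝ (g' z)) z := fun z => by
    have h1 := ((hH z).add ((hγ (Q z)).comp_hasFDerivAt z (hQd z))).sub_const m
    refine h1.congr_fderiv ?_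
    simp only [hg', map_add, map_smul]
  -- the bounded part of the gradient
  set k : E → E := fun z => g z - (1 - χ (Q z)) • (2 : ℝ) • S z with hk
  have hgk : ∀ z, g' z = k z + (2 : ℝ) • S z := fun z => by
    simp only [hg', hk]
    module
  have hkc : ContDiff ℝ 1 k := by
    have h1 : ContDiff ℝ 1 fun z => χ (Q z) := (hχ.of_le (by norm_cast)).comp hQc
    have h2 : ContDiff ℝ 1 fun z => S z := S.contDiff
    exact hg.sub ((contDiff_const.sub h1).smul (contDiff_const.smul h2))
  have hks : HasCompactSupport k := by
    refine hgs.sub (HasCompactSupport.intro (isCompact_closedBall (0 : E) (√(m / σ))) fun z hz => ?_)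
    rw [mem_closedBall_zero_iff, not_le] at hz
    have h1 : m ≤ σ * ‖z‖ ^ 2 := by
      rw [← div_le_iff₀' hσ, ← Real.sqrt_le_left (norm_nonneg z)]
      exact hz.le
    rw [hχ1 _ (h1.trans (hQlow z)), sub_self, zero_smul]
  obtain ⟨G₀, hG₀⟩ := hkc.lipschitzWith_of_hasCompactSupport hks one_ne_zero
  obtain ⟨C₁, hC₁⟩ := hkc.continuous.bounded_above_of_compact_support hks
  have hSl : LipschitzWith ‖(2 : ℝ) • S‖₊ fun z => (2 : ℝ) • S z := ((2 : ℝ) • S).lipschitz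
  have hg'l : LipschitzWith (G₀ + ‖(2 : ℝ) • S‖₊) g' := by
    have := hG₀.add hSl
    rwa [← show g' = fun z => k z + (2 : ℝ) • S z from funext hgk] at this
  have hH'nn : ∀ z, 0 ≤ H' z := fun z => by
    have := (hHr z).1
    have := hγm (Q z)
    simp only [hH']
    linarith
  have hH'c : Continuous H' := continuous_iff_continuousAt.2 fun z => (hH'd z).continuousAt
  have hQO : ∀ z ∉ O, Q z ≤ M := fun z hz => by rw [hQe]; exact hOM z hz
  have hQM : ∀ z, Q z ≤ M → g' z = g z ∧ H' z = H z := fun z hz => by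
    simp [hg', hH', hlow _ hz]
  obtain ⟨d, hd, hdH⟩ := Metric.eventually_nhds_iff_ball.1 hH0
  have hH'0 : ∃ d > 0, ∀ z : E, ‖z‖ < d → H' z = 0 := by
    refine ⟨min d √(M / (σ + π)), lt_min hd (Real.sqrt_pos.2 (by positivity)), fun z hz => ?_⟩
    rw [lt_min_iff] at hz
    have h1 : (σ + π) * ‖z‖ ^ 2 ≤ M := by
      rw [← le_div_iff₀' (by positivity)]
      exact (Real.le_sqrt (norm_nonneg z) (by positivity)).1 hz.2.le
    rw [(hQM z ((hQup z).trans h1)).2, hdH z (by simpa using hz.1)]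
  obtain ⟨d', hd', hd'H⟩ := hH'0
  have h4 : ∀ z, H' z ≤ (m / d' ^ 4 + (σ + π) / d' ^ 2) * ‖z‖ ^ 4 := fun z => by
    rcases lt_or_ge ‖z‖ d' with h | h
    · rw [hd'H z h]
      positivity
    · have h1 : 1 ≤ ‖z‖ / d' := by rwa [one_le_div hd']
      have h2 : H' z ≤ m + (σ + π) * ‖z‖ ^ 2 := by
        have := (hHr z).2
        have := hγup _ (hQ0 z)
        have := hQup z
        simp only [hH']
        linarith
      have h3 : 1 ≤ (‖z‖ / d') ^ 4 := one_le_pow₀ h1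
      have h5 : 1 ≤ (‖z‖ / d') ^ 2 := one_le_pow₀ h1
      have h6 : (m / d' ^ 4 + (σ + π) / d' ^ 2) * ‖z‖ ^ 4 =
          m * (‖z‖ / d') ^ 4 + (σ + π) * ‖z‖ ^ 2 * (‖z‖ / d') ^ 2 := by
        field_simp
      rw [h6]
      refine h2.trans (add_le_add (le_mul_of_one_le_right hm.le h3)
        (le_mul_of_one_le_right (by positivity) h5))
  refine ⟨H', g', ⟨_, hg'l⟩, fun z hz => hQM z (hQO z hz), fun z hz hHz => ?_, ?_⟩
  · have h1 : 2⁻¹ * inner ℝ (g' z) z = χ (Q z) * Q z := by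
      simp only [hg', hz, zero_add, inner_smul_left, hQ, conj_trivial]
      ring
    rw [h1]
    rcases hHz with h0 | h0
    · have h2 : z ∉ O := fun h => hm.ne' ((hO z h).symm.trans h0)
      rw [(hlow _ (hQO z h2)).1, zero_mul]
      exact hH'nn z
    · simp only [hH', h0, add_sub_cancel_left]
      have := mul_le_of_le_one_left (hQ0 z) (hχr (Q z)).2
      linarith [hγs (Q z)]
  · refine exists_periodic_orbit hJ hJi hH'c hg'l (S := S) (e := e) (L := (G₀ + ‖(2 : ℝ) • S‖₊ : NNReal))
      (c := σ) (κ := σ) (ϵ := σ) (C₁ := max C₁ 0) hH'nn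
      (le_of_lipschitz_gradient hH'd hg'l) (NNReal.coe_nonneg _) h4
      (by positivity) (lineGenerator_J hJ hJi e σ) hσ hQlow hσ (le_norm_lineGenerator hJ hJi he hσ hσπ)
      he hσ (lineGenerator_self hJ hJi he σ) (le_max_right _ _) (fun z => ?_) fun z => ?_
    · rw [hgk, add_sub_cancel_right]
      exact (hC₁ z).trans (le_max_left _ _)
    · by_cases hz : z ∈ O
      · simp only [hH', hO z hz, add_sub_cancel_left]
        have := hγs (Q z)
        simp only [hQ] at this ⊢
        linarith
      · have := hQO z hz
        have := hH'nn z
        simp only [hQ] at *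
        linarith

end ExtendedOrbit

section ActionWindow

theorem eqOn_Icc_of_hasDerivWithinAt_autonomous {F : Type*} [NormedAddCommGroup F]
    [NormedSpace ℝ F] {X : F → F} {G : NNReal} (hX : LipschitzWith G X) {z w : ℝ → F} {a b t₀ : ℝ}
    (hz : ∀ t ∈ Icc a b, HasDerivWithinAt z (X (z t)) (Icc a b) t)
    (hw : ∀ t ∈ Icc a b, HasDerivWithinAt w (X (w t)) (Icc a b) t) (ht₀ : t₀ ∈ Icc a b)
    (h : z t₀ = w t₀) : EqOn z w (Icc a b) := by
  have hr : ∀ u : ℝ → F, (∀ t ∈ Icc a b, HasDerivWithinAt u (X (u t)) (Icc a b) t) →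
      ContinuousOn u (Icc t₀ b) ∧ ContinuousOn u (Icc a t₀) ∧
      (∀ t ∈ Ico t₀ b, HasDerivWithinAt u (X (u t)) (Ici t) t) ∧
      ∀ t ∈ Ioc a t₀, HasDerivWithinAt u (X (u t)) (Iic t) t := fun u hu => by
    have hc : ContinuousOn u (Icc a b) := fun t ht => (hu t ht).continuousWithinAt
    refine ⟨hc.mono (Icc_subset_Icc_left ht₀.1), hc.mono (Icc_subset_Icc_right ht₀.2),
      fun t ht => ?_, fun t ht => ?_⟩
    · exact (hu t ⟨ht₀.1.trans ht.1, ht.2.le⟩).mono_of_mem_nhdsWithin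
        (Icc_mem_nhdsGE_of_mem ⟨ht₀.1.trans ht.1, ht.2⟩)
    · exact (hu t ⟨ht.1.le, ht.2.trans ht₀.2⟩).mono_of_mem_nhdsWithin
        (Icc_mem_nhdsLE_of_mem ⟨ht.1, ht.2.trans ht₀.2⟩)
  obtain ⟨z1, z2, z3, z4⟩ := hr z hz
  obtain ⟨w1, w2, w3, w4⟩ := hr w hw
  have hR : EqOn z w (Icc t₀ b) := ODE_solution_unique_of_mem_Icc_right (v := fun _ => X)
    (s := fun _ => univ) (fun _ _ => hX.lipschitzOnWith) z1 z3 (fun _ _ => mem_univ _) w1 w3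
    (fun _ _ => mem_univ _) h
  have hL : EqOn z w (Icc a t₀) := ODE_solution_unique_of_mem_Icc_left (v := fun _ => X)
    (s := fun _ => univ) (fun _ _ => hX.lipschitzOnWith) z2 z4 (fun _ _ => mem_univ _) w2 w4
    (fun _ _ => mem_univ _) h
  intro t ht
  rcases le_total t₀ t with h1 | h1
  · exact hR ⟨h1, ht.2⟩
  · exact hL ⟨ht.1, h1⟩

variable {E : Type*} [NormedAddCommGroup E] [InnerProductSpace ℝ E] {J : E →L[ℝ] E}

theorem exists_int_of_rot_eq_self (hJ : ∀ x, J (J x) = -x)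
    (hJi : ∀ x y, inner ℝ (J x) (J y) = inner ℝ x y) {θ : ℝ} {x : E} (hx : x ≠ 0)
    (h : rot J (2 * π * θ) x = x) : ∃ k : ℤ, θ = k := by
  have h1 : inner ℝ (rot J (2 * π * θ) x) x = ‖x‖ ^ 2 := by rw [h, real_inner_self_eq_norm_sq]
  rw [rot_apply, inner_add_left, inner_smul_left, inner_smul_left, inner_J_self hJ hJi, mul_zero,
    add_zero, real_inner_self_eq_norm_sq, conj_trivial] at h1
  have hx' : ‖x‖ ^ 2 ≠ 0 := by simpa using hx
  have h2 : cos (2 * π * θ) = 1 := by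
    refine mul_right_cancel₀ hx' ?_
    rw [h1, one_mul]
  obtain ⟨k, hk⟩ := (Real.cos_eq_one_iff _).1 h2
  refine ⟨k, ?_⟩
  have := pi_pos
  field_simp at hk
  linarith

variable [FiniteDimensional ℝ E]

/-- A periodic orbit through the transplanted annulus is a multiple cover of the image of a Hopf
circle, and its action is the intercept of the corresponding tangent to the profile. -/
theorem exists_action_eq_of_mem_image (hJ : ∀ x, J (J x) = -x)
    (hJi : ∀ x y, inner ℝ (J x) (J y) = inner ℝ x y) (hE : 2 < Module.finrank ℝ E)
    {a b : ℝ} {φ : E → E}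
    (hφ : ContDiffOn ℝ ∞ φ {p : E | a < ‖p‖ ∧ ‖p‖ < b}) (hinj : InjOn φ {p : E | a < ‖p‖ ∧ ‖p‖ < b})
    (hω : ∀ q ∈ {p : E | a < ‖p‖ ∧ ‖p‖ < b}, ∀ v w,
      inner ℝ (J (fderiv ℝ φ q v)) (fderiv ℝ φ q w) = inner ℝ (J v) w)
    {f : ℝ → ℝ} {H : E → ℝ} {g : E → E} {G : NNReal} (hg : LipschitzWith G g)
    (hHφ : ∀ p, a < ‖p‖ → ‖p‖ < b → H (φ p) = f (π * ‖p‖ ^ 2) ∧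
        g (φ p) = -J (fderiv ℝ φ p ((2 * π * deriv f (π * ‖p‖ ^ 2)) • J p)))
    {z : ℝ → E} (hz : ∀ t ∈ Icc (0 : ℝ) 1, HasDerivWithinAt z (J (g (z t))) (Icc 0 1) t)
    (hz1 : z 1 = z 0) {t₀ : ℝ} (ht₀ : t₀ ∈ Icc (0 : ℝ) 1) {p₀ : E} (hp₀ : a < ‖p₀‖)
    (hp₀' : ‖p₀‖ < b) (hp : p₀ ≠ 0) (hzp : z t₀ = φ p₀) :
    ∃ k : ℤ, deriv f (π * ‖p₀‖ ^ 2) = k ∧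
      ∫ t in (0 : ℝ)..1, (2⁻¹ * inner ℝ (g (z t)) (z t) - H (z t)) =
        k * (π * ‖p₀‖ ^ 2) - f (π * ‖p₀‖ ^ 2) := by
  set A : Set E := {p : E | a < ‖p‖ ∧ ‖p‖ < b} with hAdef
  have hA : IsOpen A := (isOpen_lt continuous_const continuous_norm).inter
    (isOpen_lt continuous_norm continuous_const)
  set c : ℝ := deriv f (π * ‖p₀‖ ^ 2) with hc
  have hrA : ∀ θ, rot J θ p₀ ∈ A := fun θ => by
    simp only [hAdef, mem_ofPred_eq, norm_rot hJ hJi]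
    exact ⟨hp₀, hp₀'⟩
  set θ : ℝ → ℝ := fun t => 2 * π * c * t + -(2 * π * c * t₀) with hθ
  set ζ : ℝ → E := fun t => φ (rot J (θ t) p₀) with hζ
  have hgr : ∀ t, g (ζ t) = -J (fderiv ℝ φ (rot J (θ t) p₀) ((2 * π * c) • J (rot J (θ t) p₀))) :=
    fun t => by
      have := (hHφ _ (hrA (θ t)).1 (hrA (θ t)).2).2
      rwa [norm_rot hJ hJi] at this
  have hHr : ∀ t, H (ζ t) = f (π * ‖p₀‖ ^ 2) := fun t => by
    have := (hHφ _ (hrA (θ t)).1 (hrA (θ t)).2).1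
    rwa [norm_rot hJ hJi] at this
  have hζd : ∀ t, HasDerivAt ζ (J (g (ζ t))) t := fun t => by
    have h1 : HasDerivAt θ (2 * π * c) t := by
      have := ((hasDerivAt_id t).const_mul (2 * π * c)).add_const (-(2 * π * c * t₀))
      rwa [mul_one] at this
    have h2 : HasDerivAt (fun t => rot J (θ t) p₀) ((2 * π * c) • J (rot J (θ t) p₀)) t :=
      (hasDerivAt_rot hJ (θ t) p₀).scomp t h1
    have h3 : HasFDerivAt φ (fderiv ℝ φ (rot J (θ t) p₀)) (rot J (θ t) p₀) :=
      ((hφ.contDiffAt (hA.mem_nhds (hrA _))).differentiableAt (by simp)).hasFDerivAt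
    refine (h3.comp_hasDerivAt t h2).congr_deriv ?_
    rw [hgr, map_neg, hJ, neg_neg]
  have hJl : LipschitzWith (‖J‖₊ * G) fun z => J (g z) := J.lipschitz.comp hg
  have heq : EqOn z ζ (Icc 0 1) := eqOn_Icc_of_hasDerivWithinAt_autonomous hJl hz
    (fun t _ => (hζd t).hasDerivWithinAt) ht₀ (by simp [hzp, hζ, hθ, rot_zero])
  -- periodicity forces an integral slope
  have h1 : rot J (θ 1) p₀ = rot J (θ 0) p₀ := by
    refine hinj (hrA _) (hrA _) ?_
    have e1 := heq (right_mem_Icc.2 zero_le_one)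
    have e0 := heq (left_mem_Icc.2 zero_le_one)
    exact e1.symm.trans (hz1.trans e0)
  have h2 : θ 1 = 2 * π * c + θ 0 := by simp only [hθ]; ring
  obtain ⟨k, hk⟩ := exists_int_of_rot_eq_self hJ hJi (θ := c) (x := rot J (θ 0) p₀)
    (fun h => hp (by rw [← norm_eq_zero, norm_rot hJ hJi, norm_eq_zero] at h; exact h)) (by
      rw [h2, rot_add hJ] at h1
      exact h1)
  refine ⟨k, hk, ?_⟩
  set L : ℝ → ℝ := fun s => inner ℝ (J (φ (rot J s p₀))) (fderiv ℝ φ (rot J s p₀) (J (rot J s p₀)))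
    with hL
  have hIntg : ∫ t in (0 : ℝ)..1, (2⁻¹ * inner ℝ (g (z t)) (z t) - H (z t)) =
      ∫ t in (0 : ℝ)..1, (2⁻¹ * (2 * π * c) * L (2 * π * c * t + -(2 * π * c * t₀)) -
        f (π * ‖p₀‖ ^ 2)) := by
    refine intervalIntegral.integral_congr fun t ht => ?_
    rw [uIcc_of_le zero_le_one] at ht
    simp only [heq ht, hHr, hgr, map_smul, inner_neg_left, inner_smul_left, conj_trivial]
    have h3 : inner ℝ (J (fderiv ℝ φ (rot J (θ t) p₀) (J (rot J (θ t) p₀)))) (ζ t) = -L (θ t) := by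
      rw [inner_J_left hJ hJi, real_inner_comm]
    rw [h3]
    ring
  obtain ⟨w, hw, hwp, hwJ⟩ := exists_orthogonal_pair hE p₀ (J p₀) ‖p₀‖ (norm_nonneg _)
  have hloop := integral_action_rot_eq hJ hJi hA hφ hω (p := p₀) (w := w) (fun q hq => by
    rw [mem_sphere_zero_iff_norm] at hq
    simpa [hAdef, hq] using And.intro hp₀ hp₀') hw hwp hwJ (-(2 * π * c * t₀)) k
  have hLc : Continuous fun t => L (2 * π * c * t + -(2 * π * c * t₀)) := by
    have hrc : Continuous fun s => rot J s p₀ := by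
      have := continuous_rot J
      fun_prop
    have c1 : Continuous fun s => φ (rot J s p₀) := hφ.continuousOn.comp_continuous hrc hrA
    have c2 : Continuous fun s => fderiv ℝ φ (rot J s p₀) :=
      (hφ.continuousOn_fderiv_of_isOpen hA (by simp)).comp_continuous hrc hrA
    have c3 : Continuous L := (J.continuous.comp c1).inner (c2.clm_apply (J.continuous.comp hrc))
    fun_prop
  rw [hIntg, intervalIntegral.integral_sub (by
    exact (continuous_const.mul hLc).intervalIntegrable _ _) (by simp),
    intervalIntegral.integral_const_mul, mul_assoc, intervalIntegral.mul_integral_comp_mul_add]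
  have e1 : 2 * π * c * 0 + -(2 * π * c * t₀) = -(2 * π * c * t₀) := by ring
  have e2 : 2 * π * c * 1 + -(2 * π * c * t₀) = -(2 * π * c * t₀) + 2 * π * k := by rw [hk]; ring
  rw [e1, e2, hloop]
  simp
  ring

/-- The transplanted Hamiltonian of a large annulus cannot vanish near the origin when the region
inside `O` is thin in one complex direction. -/
theorem not_eventually_eq_zero_of_thin (hJ : ∀ x, J (J x) = -x)
    (hJi : ∀ x y, inner ℝ (J x) (J y) = inner ℝ x y) (hE : 2 < Module.finrank ℝ E)
    {a b r₀ r₁ : ℝ} (ha : 0 ≤ a) (har : a < r₀) (hr : r₀ ≤ r₁) (hrb : r₁ < b) {φ : E → E}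
    (hφ : ContDiffOn ℝ ∞ φ {p : E | a < ‖p‖ ∧ ‖p‖ < b}) (hinj : InjOn φ {p : E | a < ‖p‖ ∧ ‖p‖ < b})
    (hω : ∀ q ∈ {p : E | a < ‖p‖ ∧ ‖p‖ < b}, ∀ v w,
      inner ℝ (J (fderiv ℝ φ q v)) (fderiv ℝ φ q w) = inner ℝ (J v) w)
    {O : Set E} (hφO : ∀ p, a < ‖p‖ → ‖p‖ < b → φ p ∉ O)
    {f : ℝ → ℝ} {m δ M σ : ℝ} (hfr : ∀ s, f s ∈ Icc 0 m) (hfd : ∀ s, 0 ≤ deriv f s)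
    (hf1 : ∀ s, deriv f s = 1 → f s < δ ∨ m - δ < f s)
    (hm : m = π * r₁ ^ 2 + δ) (hM : 0 < M) (hMδ : M + δ < 2 * (π * r₀ ^ 2) - π * r₁ ^ 2)
    (hδ : 0 < δ) {e : E} (he : ‖e‖ = 1) (hσ : 0 < σ) (hσπ : σ ≤ π / 2)
    (hOM : ∀ z ∉ O, σ * ‖z‖ ^ 2 + π * (inner ℝ e z ^ 2 + inner ℝ (J e) z ^ 2) ≤ M)
    {H : E → ℝ} {g : E → E} (hH : ∀ z, HasFDerivAt H (innerSL ℝ (g z)) z) (hg : ContDiff ℝ 1 g)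
    (hK : IsCompact (φ '' {p : E | π * r₀ ^ 2 ≤ π * ‖p‖ ^ 2 ∧ π * ‖p‖ ^ 2 ≤ π * r₁ ^ 2}))
    (hHφ : ∀ p, a < ‖p‖ → ‖p‖ < b → H (φ p) = f (π * ‖p‖ ^ 2) ∧
        g (φ p) = -J (fderiv ℝ φ p ((2 * π * deriv f (π * ‖p‖ ^ 2)) • J p)))
    (hH0 : ∀ z ∉ φ '' {p : E | π * r₀ ^ 2 ≤ π * ‖p‖ ^ 2 ∧ π * ‖p‖ ^ 2 ≤ π * r₁ ^ 2},
        g z = 0 ∧ (H z = 0 ∨ H z = m))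
    (hHr : ∀ z, H z ∈ Icc 0 m) (hHO : ∀ z ∈ O, H z = m) : ¬ ∀ᶠ z in 𝓝 0, H z = 0 := by
  intro hnear
  have hr0 : 0 < r₀ := ha.trans_lt har
  have hs : π * r₀ ^ 2 ≤ π * r₁ ^ 2 := by gcongr
  set K : Set E := {p : E | π * r₀ ^ 2 ≤ π * ‖p‖ ^ 2 ∧ π * ‖p‖ ^ 2 ≤ π * r₁ ^ 2} with hKdef
  have hKA : ∀ p ∈ K, a < ‖p‖ ∧ ‖p‖ < b := fun p hp => by
    have h1 : r₀ ^ 2 ≤ ‖p‖ ^ 2 := le_of_mul_le_mul_left hp.1 pi_pos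
    have h2 : ‖p‖ ^ 2 ≤ r₁ ^ 2 := le_of_mul_le_mul_left hp.2 pi_pos
    exact ⟨har.trans_le (le_of_sq_le_sq h1 (norm_nonneg _)),
      (le_of_sq_le_sq h2 (hr0.le.trans hr)).trans_lt hrb⟩
  obtain ⟨H', g', ⟨G, hG⟩, hOeq, hact, z, hz, hz1, hpos, hleM⟩ :=
    exists_periodic_orbit_extension hJ hJi he hσ hσπ hM (by linarith : M < m) hH hg
      (HasCompactSupport.intro hK fun z hz => (hH0 z hz).1) hHr hnear hHO hOM
  by_cases hmeet : ∃ t₀ ∈ Icc (0 : ℝ) 1, z t₀ ∈ φ '' K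
  · obtain ⟨t₀, ht₀, p₀, hp₀, hzp⟩ := hmeet
    have hpA := hKA p₀ hp₀
    have hHφ' : ∀ p, a < ‖p‖ → ‖p‖ < b → H' (φ p) = f (π * ‖p‖ ^ 2) ∧
        g' (φ p) = -J (fderiv ℝ φ p ((2 * π * deriv f (π * ‖p‖ ^ 2)) • J p)) :=
      fun p h1 h2 => by
        obtain ⟨e1, e2⟩ := hOeq _ (hφO p h1 h2)
        rw [e1, e2]
        exact hHφ p h1 h2
    obtain ⟨k, hk, hval⟩ := exists_action_eq_of_mem_image hJ hJi hE hφ hinj hω hG hHφ' hz hz1 ht₀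
      hpA.1 hpA.2 (norm_pos_iff.1 (ha.trans_lt hpA.1)) hzp.symm
    rw [hval] at hpos hleM
    have hfm := hfr (π * ‖p₀‖ ^ 2)
    have hk0 : 0 ≤ k := by
      have := hfd (π * ‖p₀‖ ^ 2)
      rw [hk] at this
      exact_mod_cast this
    obtain ⟨hp1, hp2⟩ := hp₀
    have hs0 : 0 < π * r₀ ^ 2 := by positivity
    rcases (by omega : k = 0 ∨ k = 1 ∨ 2 ≤ k) with rfl | rfl | h2
    · rw [Int.cast_zero, zero_mul] at hpos
      linarith [hfm.1]
    · rw [Int.cast_one, one_mul] at hpos hleM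
      rcases hf1 _ (by rw [hk, Int.cast_one]) with h | h <;> linarith
    · have h3 : (2 : ℝ) ≤ k := by exact_mod_cast h2
      have h4 := mul_le_mul h3 hp1 hs0.le (by linarith)
      linarith [hfm.2]
  · push Not at hmeet
    rw [← neg_neg (∫ t in (0 : ℝ)..1, _), ← intervalIntegral.integral_neg] at hpos
    refine absurd hpos (not_lt.2 (neg_nonpos.2
      (intervalIntegral.integral_nonneg zero_le_one fun t ht => ?_)))
    obtain ⟨h1, h2⟩ := hH0 _ (hmeet t ht)
    linarith [hact _ h1 h2]

end ActionWindow

section SphereEmbedding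

variable {E : Type*} [NormedAddCommGroup E] [InnerProductSpace ℝ E] [FiniteDimensional ℝ E]

/-- An open neighbourhood of a sphere contains an open annulus around it. -/
theorem exists_annulus_subset {N : Set E} (hN : IsOpen N) {r : ℝ} (hr : 0 < r)
    (hS : sphere (0 : E) r ⊆ N) :
    ∃ a b, 0 ≤ a ∧ a < r ∧ r < b ∧ {p : E | a < ‖p‖ ∧ ‖p‖ < b} ⊆ N := by
  obtain ⟨η, hη, hsub⟩ := (isCompact_sphere (0 : E) r).exists_thickening_subset_open hN hS
  refine ⟨max 0 (r - η), r + η, le_max_left _ _, max_lt hr (by linarith), by linarith,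
    fun p hp => hsub ?_⟩
  have h0 : 0 < ‖p‖ := (le_max_left _ _).trans_lt hp.1
  have h1 : r - η < ‖p‖ := (le_max_right _ _).trans_lt hp.1
  refine mem_thickening_iff.2 ⟨(r / ‖p‖) • p, ?_, ?_⟩
  · rw [mem_sphere_zero_iff_norm, norm_smul, norm_div, norm_norm, Real.norm_of_nonneg hr.le]
    field_simp
  · have h2 : p - (r / ‖p‖) • p = (1 - r / ‖p‖) • p := by rw [sub_smul, one_smul]
    have h3 : (1 - r / ‖p‖) * ‖p‖ = ‖p‖ - r := by field_simp
    rw [dist_eq_norm, h2, norm_smul, Real.norm_eq_abs, ← abs_of_pos h0, ← abs_mul, abs_of_pos h0,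
      h3, abs_lt]
    constructor <;> linarith [hp.2]

variable [MeasurableSpace E] [BorelSpace E]

theorem volume_real_ball_eq [Nontrivial E] {r : ℝ} (hr : 0 ≤ r) :
    volume.real (ball (0 : E) r) = r ^ Module.finrank ℝ E * volume.real (ball (0 : E) 1) := by
  rw [measureReal_def, Measure.addHaar_ball volume _ hr, ENNReal.toReal_mul,
    ENNReal.toReal_ofReal (by positivity), measureReal_def]

theorem volume_real_ball_lt (hE : 0 < Module.finrank ℝ E) {r s : ℝ} (hr : 0 ≤ r) (hrs : r < s) :
    volume.real (ball (0 : E) r) < volume.real (ball (0 : E) s) := by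
  have h1 : 0 < volume.real (ball (0 : E) 1) :=
    ENNReal.toReal_pos (measure_ball_pos volume _ one_pos).ne' measure_ball_lt_top.ne
  have : Nontrivial E := Module.nontrivial_of_finrank_pos hE
  rw [volume_real_ball_eq hr, volume_real_ball_eq (hr.trans hrs.le)]
  gcongr

variable {J : E →L[ℝ] E}

/-- A symplectically embedded sphere of smaller volume than the inner region bounds a ball of
smaller volume than the region between the inner and the outer one. -/
theorem volume_ball_lt_of_volume_ball_lt (hJ : ∀ x, J (J x) = -x)
    (hJi : ∀ x y, inner ℝ (J x) (J y) = inner ℝ x y) (hE : 2 < Module.finrank ℝ E)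
    {N : Set E} (hN : IsOpen N) {r : ℝ} (hr : 0 < r) (hS : sphere (0 : E) r ⊆ N) {φ : E → E}
    (hφ : ContDiffOn ℝ ∞ φ N) (hinj : InjOn φ N)
    (hω : ∀ q ∈ N, ∀ v w, inner ℝ (J (fderiv ℝ φ q v)) (fderiv ℝ φ q w) = inner ℝ (J v) w)
    {I O : Set E} (hI : IsPreconnected I) (hIm : MeasurableSet I)
    (hO : IsPreconnected O) (hOb : IsBounded Oᶜ) (hφI : ∀ p ∈ N, φ p ∉ I)
    (hφO : ∀ p ∈ N, φ p ∉ O) (hvol : volume.real (ball (0 : E) r) < volume.real I) :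
    volume.real (ball (0 : E) r) < volume.real (I ∪ O)ᶜ := by
  have : Nontrivial E := Module.nontrivial_of_finrank_pos (zero_lt_two.trans hE)
  obtain ⟨a, b, ha, har, hrb, hA⟩ := exists_annulus_subset hN hr hS
  have hcont : ContinuousAt (fun s : ℝ => s ^ Module.finrank ℝ E * volume.real (ball (0 : E) 1)) r :=
    by fun_prop
  rw [volume_real_ball_eq hr.le] at hvol
  obtain ⟨r₁, ⟨hr₁, hr₁b⟩, hr₁I⟩ := (Filter.Eventually.and (p := fun s => s ∈ Ioo r b)
    (Ioo_mem_nhdsGT hrb) ((hcont.eventually_lt_const hvol).filter_mono nhdsWithin_le_nhds)).exists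
  rw [← volume_real_ball_eq (hr.le.trans hr₁.le)] at hr₁I
  obtain ⟨r₀, hrr₀, hr₀⟩ := exists_between hr₁
  have hr₀0 : 0 < r₀ := hr.trans hrr₀
  have hs : π * r₀ ^ 2 < π * r₁ ^ 2 := by gcongr
  obtain ⟨f, hf, hf0, hf1, hfr⟩ : ∃ f : ℝ → ℝ, ContDiff ℝ ∞ f ∧ (∀ s ≤ π * r₀ ^ 2, f s = 0) ∧
      (∀ s, π * r₁ ^ 2 ≤ s → f s = 1) ∧ ∀ s, f s ∈ Icc 0 1 := by
    refine ⟨fun s => smoothTransition ((s - π * r₀ ^ 2) / (π * r₁ ^ 2 - π * r₀ ^ 2)),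
      smoothTransition.contDiff.comp (by fun_prop), fun s h => smoothTransition.zero_of_nonpos ?_,
      fun s h => smoothTransition.one_of_one_le ?_,
      fun s => ⟨smoothTransition.nonneg _, smoothTransition.le_one _⟩⟩
    · exact div_nonpos_of_nonpos_of_nonneg (by linarith) (by linarith)
    · rw [le_div_iff₀ (by linarith)]
      linarith
  rcases exists_cutoff_hamiltonian_dichotomy hJ hJi hE ha (har.trans hrr₀) hr₀.le hr₁b
    (hφ.mono hA) (hinj.mono hA) (fun q hq => hω q (hA hq)) hI hIm hO hOb
    (fun p h1 h2 => hφI p (hA ⟨h1, h2⟩)) (fun p h1 h2 => hφO p (hA ⟨h1, h2⟩)) one_pos hf hf0 hf1 hfr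
    with h | ⟨h, -⟩
  · exact (volume_real_ball_lt (by omega) hr.le hrr₀).trans_le h
  · exact absurd hr₁I (not_lt.2 h)

/-- A symplectically embedded sphere, in a bounded region which is thinner than the sphere in one
complex direction and which has an inner boundary, bounds a ball of smaller volume than the
region. -/
theorem volume_ball_lt_of_thin (hJ : ∀ x, J (J x) = -x)
    (hJi : ∀ x y, inner ℝ (J x) (J y) = inner ℝ x y) (hE : 2 < Module.finrank ℝ E)
    {N : Set E} (hN : IsOpen N) {r : ℝ} (hr : 0 < r) (hS : sphere (0 : E) r ⊆ N) {φ : E → E}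
    (hφ : ContDiffOn ℝ ∞ φ N) (hinj : InjOn φ N)
    (hω : ∀ q ∈ N, ∀ v w, inner ℝ (J (fderiv ℝ φ q v)) (fderiv ℝ φ q w) = inner ℝ (J v) w)
    {I O : Set E} (hI : IsPreconnected I) (hIm : MeasurableSet I) (hI0 : I ∈ 𝓝 0)
    (hO : IsPreconnected O) (hOb : IsBounded Oᶜ) (hφI : ∀ p ∈ N, φ p ∉ I)
    (hφO : ∀ p ∈ N, φ p ∉ O) {e : E} (he : ‖e‖ = 1) {R : ℝ} (hR : 0 < R) (hRr : R < r)
    (hOR : ∀ z ∉ O, inner ℝ e z ^ 2 + inner ℝ (J e) z ^ 2 ≤ R ^ 2) :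
    volume.real (ball (0 : E) r) < volume.real (I ∪ O)ᶜ := by
  obtain ⟨a, b, ha, har, hrb, hA⟩ := exists_annulus_subset hN hr hS
  obtain ⟨ρ, hρ0, hρ⟩ := hOb.exists_pos_norm_le
  obtain ⟨δ, hδ⟩ : ∃ δ, δ = (π * r ^ 2 - π * R ^ 2) / 4 := ⟨_, rfl⟩
  have hδ0 : 0 < δ := by
    have : π * R ^ 2 < π * r ^ 2 := by gcongr
    rw [hδ]
    linarith
  obtain ⟨σ, hσ⟩ : ∃ σ, σ = min (π / 2) (δ / ρ ^ 2) := ⟨_, rfl⟩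
  have hσ0 : 0 < σ := by rw [hσ]; exact lt_min (by positivity) (by positivity)
  have hσρ : σ * ρ ^ 2 ≤ δ := by
    rw [← le_div_iff₀ (by positivity), hσ]
    exact min_le_right _ _
  have hOM : ∀ z ∉ O, σ * ‖z‖ ^ 2 + π * (inner ℝ e z ^ 2 + inner ℝ (J e) z ^ 2) ≤
      δ + π * R ^ 2 := fun z hz => by
    have h1 : ‖z‖ ≤ ρ := hρ z hz
    have h2 : σ * ‖z‖ ^ 2 ≤ σ * ρ ^ 2 := by gcongr
    have h3 := mul_le_mul_of_nonneg_left (hOR z hz) pi_pos.le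
    linarith
  have hcont : ContinuousAt (fun s : ℝ => π * s ^ 2) r := by fun_prop
  obtain ⟨r₁, ⟨hr₁, hr₁b⟩, hr₁δ⟩ := (Filter.Eventually.and (p := fun s => s ∈ Ioo r b)
    (Ioo_mem_nhdsGT hrb) ((hcont.eventually_lt_const (by linarith : π * r ^ 2 < π * r ^ 2 + δ)).filter_mono
      nhdsWithin_le_nhds)).exists
  obtain ⟨m, hm⟩ : ∃ m, m = π * r₁ ^ 2 + δ := ⟨_, rfl⟩
  have hm0 : 0 < m := by rw [hm]; positivity
  obtain ⟨Δ, hΔ, hprof⟩ := exists_steep_profile hm0 hδ0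
  have hcont₁ : ContinuousAt (fun s : ℝ => π * s ^ 2) r₁ := by fun_prop
  obtain ⟨r₀, ⟨hrr₀, hr₀⟩, hr₀Δ⟩ := (Filter.Eventually.and (p := fun s => s ∈ Ioo r r₁)
    (Ioo_mem_nhdsLT hr₁) ((hcont₁.eventually_const_lt (by linarith : π * r₁ ^ 2 - Δ < π * r₁ ^ 2)).filter_mono
      nhdsWithin_le_nhds)).exists
  have hr₀0 : 0 < r₀ := hr.trans hrr₀
  have hs : π * r₀ ^ 2 < π * r₁ ^ 2 := by gcongr
  have hs' : π * r ^ 2 < π * r₀ ^ 2 := by gcongr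
  obtain ⟨f, hf, hf0, hf1, hfr, hfd, hfs⟩ := hprof _ _ hs (by linarith)
  rcases exists_cutoff_hamiltonian_dichotomy hJ hJi hE ha (har.trans hrr₀) hr₀.le hr₁b
    (hφ.mono hA) (hinj.mono hA) (fun q hq => hω q (hA hq)) hI hIm hO hOb
    (fun p h1 h2 => hφI p (hA ⟨h1, h2⟩)) (fun p h1 h2 => hφO p (hA ⟨h1, h2⟩)) hm0 hf hf0 hf1 hfr
    with h | ⟨-, H, g, hH, hg, hK, hHφ, hH0, hHr, hHO, hHI⟩
  · exact (volume_real_ball_lt (by omega) hr.le hrr₀).trans_le h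
  · refine absurd (Filter.mem_of_superset hI0 hHI) (not_eventually_eq_zero_of_thin hJ hJi hE ha
      (har.trans hrr₀) hr₀.le hr₁b (hφ.mono hA) (hinj.mono hA) (fun q hq => hω q (hA hq))
      (fun p h1 h2 => hφO p (hA ⟨h1, h2⟩)) hfr hfd hfs hm (by positivity) ?_ hδ0 he hσ0
      (by rw [hσ]; exact min_le_left _ _) hOM hH hg hK hHφ hH0 hHr hHO)
    linarith

end SphereEmbedding

section StandardSymplecticSpace

/-- The pairs of conjugate coordinates exhaust all coordinates. -/
def coordEquiv (n : ℕ) : Fin n × Fin 2 ≃ Fin (2 * n) :=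
  finProdFinEquiv.trans (finCongr (mul_comm n 2))

theorem coordEquiv_zero {n : ℕ} (i : Fin n) :
    coordEquiv n (i, 0) = ⟨2 * i.1, by have := i.isLt; omega⟩ := by
  ext
  simp [coordEquiv]

theorem coordEquiv_one {n : ℕ} (i : Fin n) :
    coordEquiv n (i, 1) = ⟨2 * i.1 + 1, by have := i.isLt; omega⟩ := by
  ext
  simp [coordEquiv, add_comm]

theorem sum_coord (n : ℕ) (F : Fin (2 * n) → ℝ) :
    ∑ j, F j = ∑ i : Fin n, (F ⟨2 * i.1, by have := i.isLt; omega⟩ +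
      F ⟨2 * i.1 + 1, by have := i.isLt; omega⟩) := by
  rw [← (coordEquiv n).sum_comp, Fintype.sum_prod_type]
  simp only [Fin.sum_univ_two, coordEquiv_zero, coordEquiv_one]

theorem prod_coord (n : ℕ) (F : Fin (2 * n) → ℝ) :
    ∏ j, F j = ∏ i : Fin n, (F ⟨2 * i.1, by have := i.isLt; omega⟩ *
      F ⟨2 * i.1 + 1, by have := i.isLt; omega⟩) := by
  rw [← (coordEquiv n).prod_comp, Fintype.prod_prod_type]
  simp only [Fin.prod_univ_two, coordEquiv_zero, coordEquiv_one]

/-- The standard complex structure, which sends `(x, y)` to `(-y, x)` in each pair of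
coordinates. -/
def stdJ (n : ℕ) : R2n n →L[ℝ] R2n n :=
  LinearMap.toContinuousLinearMap
    { toFun := fun z => WithLp.toLp 2 fun j =>
        if j.1 % 2 = 0 then -z ((coordEquiv n) (((coordEquiv n).symm j).1, 1))
        else z ((coordEquiv n) (((coordEquiv n).symm j).1, 0))
      map_add' := fun x y => by
        ext j
        simp only [PiLp.add_apply]
        split_ifs <;> ring
      map_smul' := fun c x => by
        ext j
        simp only [PiLp.smul_apply, smul_eq_mul, RingHom.id_apply]
        split_ifs <;> ring }

theorem stdJ_even {n : ℕ} (z : R2n n) (i : Fin n) :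
    stdJ n z ⟨2 * i.1, by have := i.isLt; omega⟩ =
      -z ⟨2 * i.1 + 1, by have := i.isLt; omega⟩ := by
  rw [← coordEquiv_one, ← coordEquiv_zero]
  have h : (coordEquiv n (i, 0)).1 % 2 = 0 := by rw [coordEquiv_zero]; simp
  simp [stdJ, h]

theorem stdJ_odd {n : ℕ} (z : R2n n) (i : Fin n) :
    stdJ n z ⟨2 * i.1 + 1, by have := i.isLt; omega⟩ =
      z ⟨2 * i.1, by have := i.isLt; omega⟩ := by
  rw [← coordEquiv_one, ← coordEquiv_zero]
  have h : (coordEquiv n (i, 1)).1 % 2 = 1 := by rw [coordEquiv_one]; simp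
  simp [stdJ, h]

theorem stdJ_stdJ {n : ℕ} (z : R2n n) : stdJ n (stdJ n z) = -z := by
  ext j
  obtain ⟨⟨i, k⟩, rfl⟩ := (coordEquiv n).surjective j
  fin_cases k
  · simp only [Fin.zero_eta, coordEquiv_zero, stdJ_even, stdJ_odd, PiLp.neg_apply]
  · simp only [Fin.mk_one, coordEquiv_one, stdJ_even, stdJ_odd, PiLp.neg_apply]

theorem inner_coord {n : ℕ} (x y : R2n n) : inner ℝ x y = ∑ i : Fin n,
    (x ⟨2 * i.1, by have := i.isLt; omega⟩ * y ⟨2 * i.1, by have := i.isLt; omega⟩ +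
      x ⟨2 * i.1 + 1, by have := i.isLt; omega⟩ * y ⟨2 * i.1 + 1, by have := i.isLt; omega⟩) := by
  rw [← sum_coord n fun j => x j * y j, PiLp.inner_apply]
  exact Finset.sum_congr rfl fun j _ => by simp [mul_comm]

theorem inner_stdJ_stdJ {n : ℕ} (x y : R2n n) : inner ℝ (stdJ n x) (stdJ n y) = inner ℝ x y := by
  simp only [inner_coord, stdJ_even, stdJ_odd]
  exact Finset.sum_congr rfl fun i _ => by ring

theorem sympForm_eq_inner {n : ℕ} (x y : R2n n) : sympForm n x y = inner ℝ (stdJ n x) y := by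
  simp only [inner_coord, stdJ_even, stdJ_odd, sympForm]
  exact Finset.sum_congr rfl fun i _ => by ring

/-- The diagonal map which scales each complex coordinate. -/
def diagScale (n : ℕ) (c : Fin n → ℝ) : R2n n →ₗ[ℝ] R2n n :=
  Matrix.toLpLin 2 2 (Matrix.diagonal fun j => c ((coordEquiv n).symm j).1)

theorem diagScale_apply {n : ℕ} (c : Fin n → ℝ) (z : R2n n) (j : Fin (2 * n)) :
    diagScale n c z j = c ((coordEquiv n).symm j).1 * z j := by
  simp [diagScale, Matrix.ofLp_toLpLin, Matrix.mulVec_diagonal]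

theorem det_diagScale {n : ℕ} (c : Fin n → ℝ) :
    LinearMap.det (diagScale n c) = (∏ i, c i) ^ 2 := by
  rw [diagScale, LinearMap.det_toLpLin, Matrix.det_diagonal, prod_coord, ← Finset.prod_pow]
  refine Finset.prod_congr rfl fun i _ => ?_
  rw [← coordEquiv_one, ← coordEquiv_zero, Equiv.symm_apply_apply, Equiv.symm_apply_apply, sq]

theorem diagScale_diagScale_inv {n : ℕ} {c : Fin n → ℝ} (hc : ∀ i, 0 < c i) (z : R2n n) :
    diagScale n c (diagScale n (fun i => (c i)⁻¹) z) = z := by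
  ext j
  rw [diagScale_apply, diagScale_apply, mul_inv_cancel_left₀ (hc _).ne']

theorem diagScale_inv_diagScale {n : ℕ} {c : Fin n → ℝ} (hc : ∀ i, 0 < c i) (z : R2n n) :
    diagScale n (fun i => (c i)⁻¹) (diagScale n c z) = z := by
  ext j
  rw [diagScale_apply, diagScale_apply, inv_mul_cancel_left₀ (hc _).ne']

theorem ellQ_eq_norm_sq {n : ℕ} (a : Fin n → ℝ) (z : R2n n) :
    ellQ n a z = ‖diagScale n (fun i => (a i)⁻¹) z‖ ^ 2 := by
  rw [← real_inner_self_eq_norm_sq, inner_coord, ellQ]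
  refine Finset.sum_congr rfl fun i _ => ?_
  rw [← coordEquiv_one, ← coordEquiv_zero, diagScale_apply, diagScale_apply,
    Equiv.symm_apply_apply, Equiv.symm_apply_apply]
  ring

theorem mem_ellipsoid_iff {n : ℕ} (a : Fin n → ℝ) (z : R2n n) :
    z ∈ ellipsoid n a ↔ ‖diagScale n (fun i => (a i)⁻¹) z‖ < 1 := by
  rw [ellipsoid, mem_ofPred_eq, ellQ_eq_norm_sq, sq_lt_one_iff₀ (norm_nonneg _)]

theorem ellipsoid_eq_image {n : ℕ} {a : Fin n → ℝ} (ha : ∀ i, 0 < a i) :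
    ellipsoid n a = diagScale n a '' ball 0 1 := by
  ext z
  rw [mem_ellipsoid_iff]
  constructor
  · exact fun h => ⟨_, mem_ball_zero_iff.2 h, diagScale_diagScale_inv ha z⟩
  · rintro ⟨w, hw, rfl⟩
    rw [diagScale_inv_diagScale ha]
    exact mem_ball_zero_iff.1 hw

theorem volume_ellipsoid {n : ℕ} {a : Fin n → ℝ} (ha : ∀ i, 0 < a i) :
    volume (ellipsoid n a) = ENNReal.ofReal ((∏ i, a i) ^ 2) * volume (ball (0 : R2n n) 1) := by
  rw [ellipsoid_eq_image ha, Measure.addHaar_image_linearMap, det_diagScale,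
    abs_of_nonneg (sq_nonneg _)]

theorem isOpen_ellipsoid (n : ℕ) (a : Fin n → ℝ) : IsOpen (ellipsoid n a) := by
  have h : ellipsoid n a = {z | ‖diagScale n (fun i => (a i)⁻¹) z‖ < 1} :=
    Set.ext (mem_ellipsoid_iff a)
  have hc : Continuous fun z => ‖diagScale n (fun i => (a i)⁻¹) z‖ :=
    (LinearMap.continuous_of_finiteDimensional _).norm
  rw [h]
  exact isOpen_lt hc continuous_const

theorem isBounded_ellipsoid {n : ℕ} {a : Fin n → ℝ} (ha : ∀ i, 0 < a i) :
    IsBounded (ellipsoid n a) := by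
  rw [ellipsoid_eq_image ha]
  exact ((isCompact_closedBall 0 1).image
    (LinearMap.continuous_of_finiteDimensional _)).isBounded.subset (image_mono ball_subset_closedBall)

theorem convex_ellipsoid {n : ℕ} {a : Fin n → ℝ} (ha : ∀ i, 0 < a i) :
    Convex ℝ (ellipsoid n a) := by
  rw [ellipsoid_eq_image ha]
  exact (convex_ball 0 1).linear_image _

theorem isPreconnected_compl_ellipsoid {n : ℕ} (hn : 1 ≤ n) {a : Fin n → ℝ} (ha : ∀ i, 0 < a i) :
    IsPreconnected (ellipsoid n a)ᶜ := by
  have hrank : 1 < Module.rank ℝ (R2n n) := by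
    rw [← Module.finrank_eq_rank, finrank_euclideanSpace_fin]
    exact_mod_cast (by omega : 1 < 2 * n)
  have hpc := ((isPreconnected_sphere hrank (0 : R2n n) 1).prod
    (isPreconnected_Ici (a := (1 : ℝ)))).image (fun p => diagScale n a (p.2 • p.1))
    ((LinearMap.continuous_of_finiteDimensional (diagScale n a)).comp (by fun_prop)).continuousOn
  convert hpc using 1
  ext z
  rw [mem_compl_iff, mem_ellipsoid_iff, not_lt]
  constructor
  · intro h
    have h0 := (zero_lt_one.trans_le h).ne'
    refine ⟨(‖diagScale n (fun i => (a i)⁻¹) z‖⁻¹ • diagScale n (fun i => (a i)⁻¹) z,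
      ‖diagScale n (fun i => (a i)⁻¹) z‖), ⟨?_, h⟩, ?_⟩
    · rw [mem_sphere_zero_iff_norm, norm_smul, norm_inv, norm_norm, inv_mul_cancel₀ h0]
    · simp only [smul_inv_smul₀ h0, diagScale_diagScale_inv ha]
  · rintro ⟨⟨p, t⟩, ⟨hp, ht⟩, rfl⟩
    have ht' : (1 : ℝ) ≤ t := ht
    rw [diagScale_inv_diagScale ha, norm_smul, mem_sphere_zero_iff_norm.1 hp, mul_one,
      Real.norm_eq_abs]
    exact ht'.trans (le_abs_self _)

end StandardSymplecticSpace

section EllipsoidalShell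

theorem volume_ellShell_lt_top {n : ℕ} {a : Fin n → ℝ} (ha : ∀ i, 0 < a i) {ε : ℝ} (hε : 0 < ε) :
    volume (ellShell n a ε) < ⊤ :=
  ((isBounded_ellipsoid fun i => mul_pos (by linarith) (ha i)).subset sdiff_subset).measure_lt_top

theorem volume_real_ellipsoid_mul {n : ℕ} {a : Fin n → ℝ} (ha : ∀ i, 0 < a i) {c : ℝ}
    (hc : 0 < c) : volume.real (ellipsoid n fun i => c * a i) =
      (c ^ n * ∏ i, a i) ^ 2 * volume.real (ball (0 : R2n n) 1) := by
  rw [measureReal_def, volume_ellipsoid fun i => mul_pos hc (ha i), ENNReal.toReal_mul,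
    ENNReal.toReal_ofReal (sq_nonneg _), Finset.prod_mul_distrib, Finset.prod_const,
    Finset.card_univ, Fintype.card_fin, measureReal_def]

/-- Any sphere which embeds symplectically into a thin ellipsoidal shell bounds a ball of smaller
volume than the shell. -/
theorem volume_ball_lt_volume_ellShell {n : ℕ} (hn : 2 ≤ n) {a : Fin n → ℝ} (ha : ∀ i, 0 < a i)
    (i₀ : Fin n) {ε : ℝ} (hε : 0 < ε) (hε1 : ε < 1)
    (hvol : ((1 + ε) * a i₀) ^ (2 * n) < ((1 - ε) ^ n * ∏ i, a i) ^ 2) {r : ℝ} (hr : 0 < r)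
    (hemb : SympEmbNbhd n (sphere (0 : R2n n) r) (ellShell n a ε)) :
    volume.real (ball (0 : R2n n) r) < volume.real (ellShell n a ε) := by
  obtain ⟨N, φ, hS, hN, hφ, hinj, hmaps, hsymp⟩ := hemb
  have hfr : Module.finrank ℝ (R2n n) = 2 * n := finrank_euclideanSpace_fin
  have hE : 2 < Module.finrank ℝ (R2n n) := by omega
  have : Nontrivial (R2n n) := Module.nontrivial_of_finrank_pos (zero_lt_two.trans hE)
  have hout : ∀ i, 0 < (1 + ε) * a i := fun i => mul_pos (by linarith) (ha i)
  have hinn : ∀ i, 0 < (1 - ε) * a i := fun i => mul_pos (by linarith) (ha i)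
  have hω : ∀ q ∈ N, ∀ v w, inner ℝ (stdJ n (fderiv ℝ φ q v)) (fderiv ℝ φ q w) =
      inner ℝ (stdJ n v) w := fun q hq v w => by
    rw [← sympForm_eq_inner, hsymp q hq, sympForm_eq_inner]
  have hI := (convex_ellipsoid hinn).closure.isPreconnected
  have hO := isPreconnected_compl_ellipsoid (by omega) hout
  have hOb : IsBounded (ellipsoid n fun i => (1 + ε) * a i)ᶜᶜ := by
    rw [compl_compl]
    exact isBounded_ellipsoid hout
  have hφI : ∀ p ∈ N, φ p ∉ closure (ellipsoid n fun i => (1 - ε) * a i) :=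
    fun p hp => (hmaps hp).2
  have hφO : ∀ p ∈ N, φ p ∉ (ellipsoid n fun i => (1 + ε) * a i)ᶜ :=
    fun p hp => not_not.2 (hmaps hp).1
  have hset : ellShell n a ε = (closure (ellipsoid n fun i => (1 - ε) * a i) ∪
      (ellipsoid n fun i => (1 + ε) * a i)ᶜ)ᶜ := by
    rw [compl_union, compl_compl, inter_comm]
    rfl
  rw [hset]
  rcases lt_or_ge ((1 + ε) * a i₀) r with h | h
  · have hI0 : closure (ellipsoid n fun i => (1 - ε) * a i) ∈ 𝓝 0 :=
      Filter.mem_of_superset ((isOpen_ellipsoid _ _).mem_nhds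
        ((mem_ellipsoid_iff _ _).2 (by simp))) subset_closure
    refine volume_ball_lt_of_thin stdJ_stdJ inner_stdJ_stdJ hE hN hr hS hφ hinj hω hI
      isClosed_closure.measurableSet hI0 hO hOb hφI hφO
      (e := EuclideanSpace.single ⟨2 * i₀.1, by have := i₀.isLt; omega⟩ 1) (by simp) (hout i₀) h
      fun z hz => ?_
    have hz' : ellQ n (fun i => (1 + ε) * a i) z < 1 := not_not.1 hz
    rw [inner_J_left stdJ_stdJ inner_stdJ_stdJ, EuclideanSpace.inner_single_left,
      EuclideanSpace.inner_single_left, stdJ_even]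
    have h1 := (Finset.single_le_sum (f := fun i : Fin n =>
      ((z ⟨2 * i.1, by have := i.isLt; omega⟩) ^ 2 +
        (z ⟨2 * i.1 + 1, by have := i.isLt; omega⟩) ^ 2) / ((1 + ε) * a i) ^ 2)
      (fun i _ => by positivity) (Finset.mem_univ i₀)).trans hz'.le
    rw [div_le_one (pow_pos (hout i₀) 2)] at h1
    simpa using h1
  · refine volume_ball_lt_of_volume_ball_lt stdJ_stdJ inner_stdJ_stdJ hE hN hr hS hφ hinj hω hI
      isClosed_closure.measurableSet hO hOb hφI hφO ?_
    have hb : 0 < volume.real (ball (0 : R2n n) 1) :=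
      ENNReal.toReal_pos (measure_ball_pos volume _ one_pos).ne' measure_ball_lt_top.ne
    calc volume.real (ball (0 : R2n n) r)
        = r ^ (2 * n) * volume.real (ball (0 : R2n n) 1) := by rw [volume_real_ball_eq hr.le, hfr]
      _ ≤ ((1 + ε) * a i₀) ^ (2 * n) * volume.real (ball (0 : R2n n) 1) := by gcongr
      _ < ((1 - ε) ^ n * ∏ i, a i) ^ 2 * volume.real (ball (0 : R2n n) 1) := by gcongr
      _ = volume.real (ellipsoid n fun i => (1 - ε) * a i) :=
        (volume_real_ellipsoid_mul ha (by linarith)).symm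
      _ ≤ volume.real (closure (ellipsoid n fun i => (1 - ε) * a i)) :=
        measureReal_mono subset_closure (isBounded_ellipsoid hinn).closure.measure_lt_top.ne

theorem tendsto_volume_real_ellShell {n : ℕ} {a : Fin n → ℝ} (ha : ∀ i, 0 < a i) :
    Tendsto (fun ε => volume.real (ellShell n a ε)) (𝓝[>] 0) (𝓝 0) := by
  have hlim : Tendsto (fun ε : ℝ => ((1 + ε) ^ n * ∏ i, a i) ^ 2 *
      volume.real (ball (0 : R2n n) 1) - ((1 - ε) ^ n * ∏ i, a i) ^ 2 *
      volume.real (ball (0 : R2n n) 1)) (𝓝[>] 0) (𝓝 0) := by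
    refine Tendsto.mono_left ?_ nhdsWithin_le_nhds
    refine (Continuous.tendsto (by fun_prop) (0 : ℝ)).trans_eq ?_
    simp
  refine squeeze_zero' (Eventually.of_forall fun ε => measureReal_nonneg) ?_ hlim
  filter_upwards [Ioo_mem_nhdsGT one_pos] with ε hε
  have hout : ∀ i, 0 < (1 + ε) * a i := fun i => mul_pos (by linarith [hε.1]) (ha i)
  have hinn : ∀ i, 0 < (1 - ε) * a i := fun i => mul_pos (by linarith [hε.2]) (ha i)
  rw [← volume_real_ellipsoid_mul ha (by linarith [hε.1]),
    ← volume_real_ellipsoid_mul ha (by linarith [hε.2])]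
  rw [← measureReal_sdiff ?_ (isOpen_ellipsoid _ _).measurableSet
    (isBounded_ellipsoid hout).measure_lt_top.ne]
  · exact measureReal_mono (sdiff_subset_sdiff_right subset_closure)
      ((isBounded_ellipsoid hout).subset sdiff_subset).measure_lt_top.ne
  · intro z hz
    have hz' : ellQ n (fun i => (1 - ε) * a i) z < 1 := hz
    refine (Finset.sum_le_sum fun i _ => ?_).trans_lt hz'
    have h1 := hinn i
    have h2 : (1 - ε) * a i ≤ (1 + ε) * a i :=
      mul_le_mul_of_nonneg_right (by linarith [hε.1]) (ha i).le
    gcongr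

end EllipsoidalShell

/-- For an ellipsoid with two different half axes, `s(U_ε) → 0` as `ε → 0⁺`; more
precisely, there exists `ε₀ > 0` depending only on the half axes such that for all
`ε ∈ (0, ε₀]` every symplectically embedded sphere `S_r^(2n-1)` in `U_ε` satisfies
`πⁿ r^(2n)/n! < vol(U_ε)`. -/
theorem spherical_capacity_tendsto_zero_on_ellipsoidal_shells
    (n : ℕ) (hn : 2 ≤ n) (a : Fin n → ℝ)
    (hpos : ∀ i, 0 < a i) (hmono : Monotone a)
    (hdiff : ∃ i j, a i ≠ a j) :
    Tendsto (fun ε : ℝ => sphericalCap n (ellShell n a ε)) (𝓝[>] (0 : ℝ)) (𝓝 0) ∧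
      ∃ ε₀ : ℝ, 0 < ε₀ ∧ ∀ ε ∈ Ioc (0 : ℝ) ε₀, ∀ r : ℝ, 0 < r →
        SympEmbNbhd n (sphere (0 : R2n n) r) (ellShell n a ε) →
        ENNReal.ofReal (π ^ n * r ^ (2 * n) / n.factorial) < volume (ellShell n a ε) := by
  have hfr : Module.finrank ℝ (R2n n) = 2 * n := finrank_euclideanSpace_fin
  have : Nontrivial (R2n n) := Module.nontrivial_of_finrank_pos (R := ℝ) (by omega)
  have hlt : a ⟨0, by omega⟩ ^ (2 * n) < (∏ i, a i) ^ 2 := by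
    have hmin : ∀ i, a ⟨0, by omega⟩ ≤ a i := fun i => hmono (Nat.zero_le _)
    obtain ⟨k, hk⟩ : ∃ k, a ⟨0, by omega⟩ < a k := by
      by_contra! h
      obtain ⟨i, j, hij⟩ := hdiff
      exact hij (((h i).antisymm (hmin i)).trans ((h j).antisymm (hmin j)).symm)
    have h1 : ∏ _i : Fin n, a ⟨0, by omega⟩ < ∏ i, a i :=
      Finset.prod_lt_prod (fun i _ => hpos _) (fun i _ => hmin i) ⟨k, Finset.mem_univ k, hk⟩
    rw [Finset.prod_const, Finset.card_univ, Fintype.card_fin] at h1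
    rw [mul_comm, pow_mul]
    have h2 := pow_pos (hpos ⟨0, by omega⟩) n
    gcongr
  obtain ⟨ε₀, ⟨hε₀, hε₀1⟩, hε₀vol⟩ : ∃ ε₀ : ℝ, ε₀ ∈ Ioo 0 1 ∧ ∀ ε ∈ Ioc (0 : ℝ) ε₀,
      ((1 + ε) * a ⟨0, by omega⟩) ^ (2 * n) < ((1 - ε) ^ n * ∏ i, a i) ^ 2 := by
    have h1 : ContinuousAt (fun ε : ℝ => ((1 + ε) * a ⟨0, by omega⟩) ^ (2 * n)) 0 := by fun_prop
    have h2 : ContinuousAt (fun ε : ℝ => ((1 - ε) ^ n * ∏ i, a i) ^ 2) 0 := by fun_prop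
    obtain ⟨η, hη, hball⟩ := Metric.eventually_nhds_iff.1
      (h1.eventually_lt h2 (by simpa using hlt))
    refine ⟨min (η / 2) (1 / 2), ⟨by positivity, (min_le_right _ _).trans_lt (by norm_num)⟩,
      fun ε hε => hball ?_⟩
    rw [Real.dist_eq, sub_zero, abs_of_pos hε.1]
    exact (hε.2.trans (min_le_left _ _)).trans_lt (by linarith)
  have hmain : ∀ ε ∈ Ioc (0 : ℝ) ε₀, ∀ r : ℝ, 0 < r →
      SympEmbNbhd n (sphere (0 : R2n n) r) (ellShell n a ε) →
      volume.real (ball (0 : R2n n) r) < volume.real (ellShell n a ε) := fun ε hε r hr hemb =>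
    volume_ball_lt_volume_ellShell hn hpos ⟨0, by omega⟩ hε.1 (hε.2.trans_lt hε₀1) (hε₀vol ε hε) hr
      hemb
  refine ⟨?_, ε₀, hε₀, fun ε hε r hr hemb => ?_⟩
  · rw [ENNReal.tendsto_nhds_zero]
    intro η hη
    have hc : Tendsto (fun s : ℝ => ENNReal.ofReal (π * s ^ 2)) (𝓝[>] 0) (𝓝 0) := by
      refine Tendsto.mono_left ?_ nhdsWithin_le_nhds
      have hc : Continuous fun s : ℝ => ENNReal.ofReal (π * s ^ 2) :=
        ENNReal.continuous_ofReal.comp (by fun_prop)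
      simpa using hc.tendsto 0
    obtain ⟨s, hsη, hs⟩ := ((hc.eventually_lt_const hη).and self_mem_nhdsWithin).exists
    have hs0 : 0 < s := hs
    have hb : 0 < volume.real (ball (0 : R2n n) s) :=
      ENNReal.toReal_pos (measure_ball_pos volume _ hs0).ne' measure_ball_lt_top.ne
    filter_upwards [(tendsto_volume_real_ellShell hpos).eventually_lt_const hb,
      Ioc_mem_nhdsGT hε₀] with ε hεs hε
    refine sSup_le ?_
    rintro _ ⟨r, hr, rfl, hemb⟩
    have hrs : r < s := by
      by_contra! h
      exact absurd ((hmain ε hε r hr hemb).trans hεs)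
        (not_lt.2 (measureReal_mono (ball_subset_ball h) measure_ball_lt_top.ne))
    refine le_trans (ENNReal.ofReal_le_ofReal ?_) hsη.le
    gcongr
  · have h1 := (ENNReal.toReal_lt_toReal measure_ball_lt_top.ne
      (volume_ellShell_lt_top hpos hε.1).ne).1 (hmain ε hε r hr hemb)
    rw [InnerProductSpace.volume_ball_of_dim_even hfr, hfr, ← ENNReal.ofReal_pow hr.le,
      ← ENNReal.ofReal_mul (by positivity)] at h1
    convert h1 using 2
    ring
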